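/- For every p ∈ [1, 4/3) there exist constants C_p > 0 and C > 0 such that the following holds. Let A ≥ 2, T > 0, and let (u,π) be a classical solution of the Navier–Stokes equations on [0,T] with ‖u(t,·)‖_{L^{3,∞}(ℝ³)} ≤ A for all t ∈ [0,T]. Then sup_{x₀∈ℝ³} ( ∫_{T/2}^{T} ∫_{B(x₀, T^{1/2})} ‖Dₓ²u(t,x)‖^p dx dt )^{1/p} ≤ C_p·A^C·T^{5/(2p) − 3/2}. -/

import Mathlib

noncomputable section
open Real MeasureTheory Filter Metric Set
open scoped ENNReal NNReal Topology FourierTransform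

/-- Three-dimensional Euclidean space. -/
abbrev E3 : Type := EuclideanSpace ℝ (Fin 3)

/-- The `i`-th partial derivative of a scalar function on `ℝ³`. -/
def pd (f : E3 → ℝ) (i : Fin 3) (x : E3) : ℝ :=
  fderiv ℝ f x (EuclideanSpace.single i 1)

/-- The Laplacian of a scalar function on `ℝ³`. -/
def lap (f : E3 → ℝ) (x : E3) : ℝ :=
  ∑ i : Fin 3, pd (fun y => pd f i y) i x

/-- `(u, pr)` is a classical solution of the Navier–Stokes equations on the time interval `I`. -/
def IsNSSol (u : ℝ → E3 → E3) (pr : ℝ → E3 → ℝ) (I : Set ℝ) : Prop :=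
  (ContDiff ℝ (⊤:ℕ∞) fun q : ℝ × E3 => u q.1 q.2) ∧
  (ContDiff ℝ (⊤:ℕ∞) fun q : ℝ × E3 => pr q.1 q.2) ∧
  (∀ t ∈ I, ∀ x : E3, ∀ i : Fin 3,
    deriv (fun s => u s x i) t - lap (fun y => u t y i) x
      + (∑ j : Fin 3, u t x j * pd (fun y => u t y i) j x) + pd (pr t) i x = 0) ∧
  (∀ t ∈ I, ∀ x : E3, (∑ i : Fin 3, pd (fun y => u t y i) i x) = 0)

/-- Rotation by angle `θ` about the `x₃`-axis. -/
def rotZ (θ : ℝ) (x : E3) : E3 :=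
  (WithLp.equiv 2 (Fin 3 → ℝ)).symm
    ![x 0 * Real.cos θ - x 1 * Real.sin θ, x 0 * Real.sin θ + x 1 * Real.cos θ, x 2]

/-- A time-dependent vector field is axisymmetric. -/
def AxiSym (u : ℝ → E3 → E3) : Prop := ∀ θ t x, u t (rotZ θ x) = rotZ θ (u t x)

/-- The weak `L^q` (quasi)norm `sup_{λ>0} λ · vol{|f| ≥ λ}^{1/q}`. -/
def wnorm' {F : Type*} [NormedAddCommGroup F] (f : E3 → F) (q : ℝ) : ℝ≥0∞ :=
  ⨆ (l : ℝ) (_ : 0 < l), ENNReal.ofReal l * (volume {x : E3 | l ≤ ‖f x‖}) ^ (1 / q)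

/-- The weak `L^3` norm. -/
def wnorm3 (f : E3 → E3) : ℝ≥0∞ := wnorm' f 3

/-- Distance to the `x₃`-axis. -/
def rr (x : E3) : ℝ := Real.sqrt (x 0 ^ 2 + x 1 ^ 2)


/-- Hölder's inequality for three functions with exponents adding up to one. -/
lemma lintegral_holder_three {α : Type*} [MeasurableSpace α] (μ : Measure α)
    {f g h : α → ℝ≥0∞} (hf : AEMeasurable f μ) (hg : AEMeasurable g μ) (hh : AEMeasurable h μ)
    {a b c : ℝ} (ha : 0 ≤ a) (hb : 0 ≤ b) (hc : 0 ≤ c) (habc : a + b + c = 1) :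
    ∫⁻ x, f x ^ a * g x ^ b * h x ^ c ∂μ ≤
      (∫⁻ x, f x ∂μ) ^ a * (∫⁻ x, g x ∂μ) ^ b * (∫⁻ x, h x ∂μ) ^ c := by
  have := ENNReal.lintegral_prod_norm_pow_le (μ := μ) Finset.univ (f := ![f, g, h])
    (p := ![a, b, c]) (by intro i _; fin_cases i <;> simpa) (by simp [Fin.sum_univ_three, habc])
    (by intro i _; fin_cases i <;> simpa)
  simpa [Fin.prod_univ_three] using this

/-- Jensen's inequality for a weighted integral. -/
lemma lintegral_weight_rpow_le {α : Type*} [MeasurableSpace α] (μ : Measure α)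
    {w F : α → ℝ≥0∞} (hw : AEMeasurable w μ) (hF : AEMeasurable F μ) {p : ℝ} (hp : 1 ≤ p) :
    (∫⁻ a, w a * F a ∂μ) ^ p ≤ (∫⁻ a, w a ∂μ) ^ (p - 1) * ∫⁻ a, w a * F a ^ p ∂μ := by
  have hp0 : 0 < p := by linarith
  have h := lintegral_holder_three μ hw (hw.mul (hF.pow_const p)) hw (a := 1 - 1 / p) (b := 1 / p)
    (c := 0) (by rw [sub_nonneg, div_le_one hp0]; exact hp) (by positivity) le_rfl (by ring)
  have h1 : ∀ a, w a ^ (1 - 1 / p) * (w a * F a ^ p) ^ (1 / p) = w a * F a := by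
    intro a
    rw [ENNReal.mul_rpow_of_nonneg _ _ (by positivity), ← ENNReal.rpow_mul,
      mul_one_div_cancel hp0.ne', ENNReal.rpow_one, ← mul_assoc,
      ← ENNReal.rpow_add_of_nonneg _ _ (by rw [sub_nonneg, div_le_one hp0]; exact hp)
        (by positivity)]
    simp
  simp only [Pi.mul_apply, ENNReal.rpow_zero, mul_one, h1] at h
  calc _ ≤ ((∫⁻ a, w a ∂μ) ^ (1 - 1 / p) * (∫⁻ a, w a * F a ^ p ∂μ) ^ (1 / p)) ^ p :=
        ENNReal.rpow_le_rpow h hp0.le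
    _ = _ := by
        rw [ENNReal.mul_rpow_of_nonneg _ _ hp0.le, ← ENNReal.rpow_mul, ← ENNReal.rpow_mul,
          one_div_mul_cancel hp0.ne', ENNReal.rpow_one]
        congr 2
        rw [sub_mul, one_div_mul_cancel hp0.ne', one_mul]

/-- A weighted form of Minkowski's integral inequality. -/
lemma lintegral_rpow_lintegral_le {α β : Type*} [MeasurableSpace α] [MeasurableSpace β]
    (μ : Measure α) (ν : Measure β) [SFinite μ] [SFinite ν]
    {w : α → ℝ≥0∞} {F : α → β → ℝ≥0∞} (hw : Measurable w) (hF : Measurable (Function.uncurry F))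
    {p : ℝ} (hp : 1 ≤ p) {N : ℝ≥0∞} (hN : ∀ a, ∫⁻ x, F a x ^ p ∂ν ≤ N) :
    ∫⁻ x, (∫⁻ a, w a * F a x ∂μ) ^ p ∂ν ≤ (∫⁻ a, w a ∂μ) ^ p * N := by
  have hp0 : 0 < p := by linarith
  have hFx : ∀ x, Measurable fun a => F a x := fun x =>
    hF.comp (measurable_id.prodMk measurable_const)
  have hm : Measurable fun q : β × α => w q.2 * F q.2 q.1 ^ p :=
    (hw.comp measurable_snd).mul ((hF.comp measurable_swap).pow_const p)
  calc _ ≤ ∫⁻ x, (∫⁻ a, w a ∂μ) ^ (p - 1) * ∫⁻ a, w a * F a x ^ p ∂μ ∂ν :=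
        lintegral_mono fun x => lintegral_weight_rpow_le μ hw.aemeasurable (hFx x).aemeasurable hp
    _ = (∫⁻ a, w a ∂μ) ^ (p - 1) * ∫⁻ x, ∫⁻ a, w a * F a x ^ p ∂μ ∂ν :=
        lintegral_const_mul _ hm.lintegral_prod_right'
    _ = (∫⁻ a, w a ∂μ) ^ (p - 1) * ∫⁻ a, ∫⁻ x, w a * F a x ^ p ∂ν ∂μ := by
        rw [lintegral_lintegral_swap hm.aemeasurable]
    _ ≤ (∫⁻ a, w a ∂μ) ^ (p - 1) * ∫⁻ a, w a * N ∂μ := by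
        gcongr with a
        have hFa : Measurable (F a) := hF.comp (measurable_const.prodMk measurable_id)
        rw [lintegral_const_mul _ (hFa.pow_const p)]
        gcongr
        exact hN a
    _ = _ := by
        rw [lintegral_mul_const _ hw, ← mul_assoc]
        congr 1
        nth_rewrite 2 [← ENNReal.rpow_one (∫⁻ a, w a ∂μ)]
        rw [← ENNReal.rpow_add_of_nonneg _ _ (by linarith) (by norm_num)]
        congr 1; ring

/-- The integral of the `p`-th power. -/
def Np (p : ℝ) (g : E3 → ℝ) : ℝ≥0∞ := ∫⁻ x, ‖g x‖ₑ ^ p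

/-- Smooth functions with compact support. -/
def CS (g : E3 → ℝ) : Prop := ContDiff ℝ (⊤ : ℕ∞) g ∧ HasCompactSupport g

/-- Weighted average of translates of `g`. -/
def Av {α : Type*} [MeasurableSpace α] (μ : Measure α) (w : α → ℝ) (h : α → E3) (g : E3 → ℝ)
    (x : E3) : ℝ := ∫ a, w a * g (x - h a) ∂μ

lemma contDiff_pd {g : E3 → ℝ} (hg : ContDiff ℝ (⊤ : ℕ∞) g) (i : Fin 3) :
    ContDiff ℝ (⊤ : ℕ∞) (pd g i) := by
  unfold pd
  exact (hg.fderiv_right (m := (⊤ : ℕ∞)) (by simp)).clm_apply contDiff_const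

lemma CS.dpd {g : E3 → ℝ} (hg : CS g) (i : Fin 3) : CS (pd g i) := by
  refine ⟨contDiff_pd hg.1 i, ?_⟩
  have := HasCompactSupport.fderiv (𝕜 := ℝ) hg.2
  exact this.comp_left (g := fun L : E3 →L[ℝ] ℝ => L (EuclideanSpace.single i 1)) rfl

lemma CS.differentiable {g : E3 → ℝ} (hg : CS g) : Differentiable ℝ g :=
  hg.1.differentiable (by simp)

lemma CS.continuous {g : E3 → ℝ} (hg : CS g) : Continuous g := hg.1.continuous

lemma CS.bdd {g : E3 → ℝ} (hg : CS g) : ∃ C, ∀ x, |g x| ≤ C := by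
  simpa using hg.2.exists_bound_of_continuous hg.continuous

lemma CS.integrable {g : E3 → ℝ} (hg : CS g) : Integrable g :=
  hg.continuous.integrable_of_hasCompactSupport hg.2

lemma CS.mul {f g : E3 → ℝ} (hf : ContDiff ℝ (⊤ : ℕ∞) f) (hg : CS g) :
    CS (fun x => f x * g x) := ⟨hf.mul hg.1, hg.2.mul_left⟩

lemma CS.add {f g : E3 → ℝ} (hf : CS f) (hg : CS g) : CS (fun x => f x + g x) :=
  ⟨hf.1.add hg.1, hf.2.add hg.2⟩

lemma CS.neg {f : E3 → ℝ} (hf : CS f) : CS (fun x => - f x) :=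
  ⟨hf.1.neg, hf.2.neg⟩

lemma CS.sub {f g : E3 → ℝ} (hf : CS f) (hg : CS g) : CS (fun x => f x - g x) := by
  simpa [sub_eq_add_neg] using hf.add hg.neg

lemma CS.zero : CS (fun _ => (0:ℝ)) := ⟨contDiff_const, HasCompactSupport.zero⟩

lemma CS.sum {ι : Type*} {s : Finset ι} {f : ι → E3 → ℝ} (hf : ∀ i ∈ s, CS (f i)) :
    CS (fun x => ∑ i ∈ s, f i x) := by
  classical
  induction s using Finset.induction_on with
  | empty => simpa using CS.zero
  | insert a s ha ih =>
    simp only [Finset.sum_insert ha]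
    exact (hf a (by simp)).add (ih fun i hi => hf i (by simp [hi]))

lemma CS.fderiv_bdd {g : E3 → ℝ} (hg : CS g) : ∃ C, ∀ x, ‖fderiv ℝ g x‖ ≤ C := by
  have h : HasCompactSupport (fderiv ℝ g) := HasCompactSupport.fderiv (𝕜 := ℝ) hg.2
  exact h.exists_bound_of_continuous (hg.1.continuous_fderiv (by simp))

section Av
variable {α : Type*} [MeasurableSpace α] {μ : Measure α} {w : α → ℝ} {h : α → E3} {g : E3 → ℝ}

lemma Av_integrable_integrand (hw : Integrable w μ) (hh : Measurable h) (hgm : Continuous g)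
    {C : ℝ} (hgC : ∀ x, |g x| ≤ C) (x : E3) : Integrable (fun a => w a * g (x - h a)) μ := by
  refine hw.mul_bdd (c := C) ?_ ?_
  · exact (hgm.measurable.comp (measurable_const.sub hh)).aestronglyMeasurable
  · exact ae_of_all _ fun a => by simpa using hgC _

lemma Av_abs_le (hw : Integrable w μ) {C : ℝ} (hgC : ∀ x, |g x| ≤ C) (x : E3) :
    |Av μ w h g x| ≤ (∫ a, |w a| ∂μ) * C := by
  unfold Av
  rw [← integral_mul_const]
  refine (abs_integral_le_integral_abs).trans ?_
  refine integral_mono_of_nonneg (ae_of_all _ fun a => abs_nonneg _) (hw.abs.mul_const C)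
    (ae_of_all _ fun a => ?_)
  simp only [abs_mul]
  gcongr
  exact hgC _

lemma Av_hasFDerivAt (hw : Integrable w μ) (hh : Measurable h) (hg : CS g) (x : E3) :
    HasFDerivAt (Av μ w h g) (∫ a, w a • fderiv ℝ g (x - h a) ∂μ) x := by
  obtain ⟨C, hC⟩ := hg.fderiv_bdd
  obtain ⟨C', hC'⟩ := hg.bdd
  refine hasFDerivAt_integral_of_dominated_of_fderiv_le (𝕜 := ℝ) (μ := μ)
    (F := fun x a => w a * g (x - h a)) (F' := fun x a => w a • fderiv ℝ g (x - h a))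
    (bound := fun a => |w a| * C) (s := univ) univ_mem ?_ ?_ ?_ ?_ ?_ ?_
  · exact Eventually.of_forall fun y =>
      (Av_integrable_integrand hw hh hg.continuous hC' y).aestronglyMeasurable
  · exact Av_integrable_integrand hw hh hg.continuous hC' x
  · refine hw.aestronglyMeasurable.smul ?_
    exact ((hg.1.continuous_fderiv (by simp)).measurable.comp
      (measurable_const.sub hh)).aestronglyMeasurable
  · refine ae_of_all _ fun a y _ => ?_
    rw [norm_smul]
    exact mul_le_mul_of_nonneg_left (hC _) (abs_nonneg _)
  · exact hw.abs.mul_const C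
  · refine ae_of_all _ fun a y _ => ?_
    have : HasFDerivAt (fun y => g (y - h a)) (fderiv ℝ g (y - h a)) y := by
      have := (hg.differentiable (y - h a)).hasFDerivAt.comp y
        ((hasFDerivAt_id y).sub_const (h a))
      rw [ContinuousLinearMap.comp_id] at this
      exact this
    exact this.const_mul (w a)

lemma pd_Av (hw : Integrable w μ) (hh : Measurable h) (hg : CS g) (i : Fin 3) :
    pd (Av μ w h g) i = Av μ w h (pd g i) := by
  funext x
  obtain ⟨C, hC⟩ := hg.fderiv_bdd
  unfold pd
  rw [(Av_hasFDerivAt hw hh hg x).fderiv, ContinuousLinearMap.integral_apply]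
  · rfl
  · refine Integrable.smul_bdd hw C ?_ ?_
    · exact ((hg.1.continuous_fderiv (by simp)).measurable.comp
        (measurable_const.sub hh)).aestronglyMeasurable
    · exact ae_of_all _ fun a => hC _

lemma Av_differentiable (hw : Integrable w μ) (hh : Measurable h) (hg : CS g) :
    Differentiable ℝ (Av μ w h g) := fun x => (Av_hasFDerivAt hw hh hg x).differentiableAt

end Av

/-- The derivative in terms of partial derivatives. -/
lemma fderiv_eq_sum_pd (g : E3 → ℝ) (x : E3) :
    fderiv ℝ g x = ∑ i : Fin 3, pd g i x • (EuclideanSpace.proj i : E3 →L[ℝ] ℝ) := by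
  ext v
  have hv : v = ∑ i : Fin 3, v i • EuclideanSpace.single i (1:ℝ) := by
    ext j; fin_cases j <;> simp [Fin.sum_univ_three]
  conv_lhs => rw [hv]
  simp [pd, map_sum, mul_comm]

lemma Av_contDiff {α : Type*} [MeasurableSpace α] {μ : Measure α} {w : α → ℝ} {h : α → E3}
    {g : E3 → ℝ} (hw : Integrable w μ) (hh : Measurable h) (hg : CS g) :
    ContDiff ℝ (⊤ : ℕ∞) (Av μ w h g) := by
  have key : ∀ n : ℕ, ∀ g : E3 → ℝ, CS g → ContDiff ℝ n (Av μ w h g) := by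
    intro n
    induction n with
    | zero => intro g hg; exact contDiff_zero.2 (Av_differentiable hw hh hg).continuous
    | succ n ih =>
      intro g hg
      have : ((n + 1 : ℕ) : WithTop ℕ∞) = (n : WithTop ℕ∞) + 1 := by simp
      rw [this, contDiff_succ_iff_fderiv]
      refine ⟨Av_differentiable hw hh hg, by simp, ?_⟩
      have h2 : fderiv ℝ (Av μ w h g) =
          fun x => ∑ i : Fin 3, Av μ w h (pd g i) x • (EuclideanSpace.proj i : E3 →L[ℝ] ℝ) := by
        funext x
        rw [fderiv_eq_sum_pd]
        simp only [pd_Av hw hh hg]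
      rw [h2]
      exact ContDiff.sum fun i _ => (ih _ (hg.dpd i)).smul contDiff_const
  exact contDiff_infty.2 fun n => key n g hg

lemma enorm_Av_le {α : Type*} [MeasurableSpace α] {μ : Measure α} {w : α → ℝ} {h : α → E3}
    {g : E3 → ℝ} (x : E3) :
    ‖Av μ w h g x‖ₑ ≤ ∫⁻ a, ‖w a‖ₑ * ‖g (x - h a)‖ₑ ∂μ := by
  unfold Av
  refine (enorm_integral_le_lintegral_enorm _).trans_eq ?_
  simp only [enorm_mul]

section Av2
variable {α : Type*} [MeasurableSpace α] {μ : Measure α} [SFinite μ] {w : α → ℝ} {h : α → E3}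
  {g : E3 → ℝ}

lemma Np_sub_const (p : ℝ) (g : E3 → ℝ) (y : E3) : Np p (fun x => g (x - y)) = Np p g := by
  unfold Np
  exact lintegral_sub_right_eq_self (fun x => ‖g x‖ₑ ^ p) y

lemma Np_Av_le (hw : Measurable w) (hh : Measurable h) (hg : Measurable g) {p : ℝ}
    (hp : 1 ≤ p) : Np p (Av μ w h g) ≤ (∫⁻ a, ‖w a‖ₑ ∂μ) ^ p * Np p g := by
  have hF : Measurable (Function.uncurry fun (a : α) (x : E3) => ‖g (x - h a)‖ₑ) :=
    (hg.comp (measurable_snd.sub (hh.comp measurable_fst))).enorm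
  refine (lintegral_mono fun x => ENNReal.rpow_le_rpow (enorm_Av_le x) (by linarith)).trans ?_
  exact lintegral_rpow_lintegral_le μ volume hw.enorm hF hp
    (fun a => (Np_sub_const p g (h a)).le)

lemma Av_integrable (hwi : Integrable w μ) (hw : Measurable w) (hh : Measurable h) (hg : CS g) :
    Integrable (Av μ w h g) := by
  refine ⟨(Av_differentiable hwi hh hg).continuous.aestronglyMeasurable, ?_⟩
  have := Np_Av_le (μ := μ) hw hh hg.continuous.measurable (p := 1) le_rfl
  simp only [Np, ENNReal.rpow_one] at this
  exact this.trans_lt (ENNReal.mul_lt_top hwi.2 hg.integrable.2)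

end Av2

/-- Polynomial multiples of the Gaussian `exp (-|z|²/4)`. -/
def GP (ψ : E3 → ℝ) : Prop :=
  ∃ p : MvPolynomial (Fin 3) ℝ, ψ = fun z => MvPolynomial.eval (fun i => z i) p *
    Real.exp (-‖z‖ ^ 2 / 4)

lemma contDiff_mvPolynomial_eval (p : MvPolynomial (Fin 3) ℝ) :
    ContDiff ℝ (⊤ : ℕ∞) fun z : E3 => MvPolynomial.eval (fun i => z i) p := by
  induction p using MvPolynomial.induction_on with
  | C a => simpa using contDiff_const
  | add p q hp hq => simpa using hp.add hq
  | mul_X p i hp =>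
    simp only [map_mul, MvPolynomial.eval_X]
    exact hp.mul (EuclideanSpace.proj i : E3 →L[ℝ] ℝ).contDiff

lemma pd_mul {f g : E3 → ℝ} {x : E3} (hf : DifferentiableAt ℝ f x) (hg : DifferentiableAt ℝ g x)
    (i : Fin 3) : pd (fun y => f y * g y) i x = pd f i x * g x + f x * pd g i x := by
  unfold pd
  rw [fderiv_fun_mul hf hg]
  simp; ring

lemma pd_add {f g : E3 → ℝ} {x : E3} (hf : DifferentiableAt ℝ f x) (hg : DifferentiableAt ℝ g x)
    (i : Fin 3) : pd (fun y => f y + g y) i x = pd f i x + pd g i x := by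
  unfold pd
  rw [fderiv_fun_add hf hg]
  simp

lemma pd_sub {f g : E3 → ℝ} {x : E3} (hf : DifferentiableAt ℝ f x) (hg : DifferentiableAt ℝ g x)
    (i : Fin 3) : pd (fun y => f y - g y) i x = pd f i x - pd g i x := by
  unfold pd
  rw [fderiv_fun_sub hf hg]
  simp

lemma pd_neg {f : E3 → ℝ} {x : E3} (i : Fin 3) : pd (fun y => - f y) i x = - pd f i x := by
  unfold pd
  rw [fderiv_fun_neg]
  simp

lemma pd_const (c : ℝ) (i : Fin 3) (x : E3) : pd (fun _ => c) i x = 0 := by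
  simp [pd]

lemma pd_const_mul {f : E3 → ℝ} {x : E3} (c : ℝ) (i : Fin 3) (hf : DifferentiableAt ℝ f x) :
    pd (fun y => c * f y) i x = c * pd f i x := by
  unfold pd
  rw [fderiv_const_mul hf]
  simp

lemma pd_sum {ι : Type*} {s : Finset ι} {f : ι → E3 → ℝ} {x : E3}
    (hf : ∀ j ∈ s, DifferentiableAt ℝ (f j) x) (i : Fin 3) :
    pd (fun y => ∑ j ∈ s, f j y) i x = ∑ j ∈ s, pd (f j) i x := by
  unfold pd
  rw [fderiv_fun_sum hf]
  simp

lemma pd_comm {f : E3 → ℝ} (hf : ContDiff ℝ (⊤ : ℕ∞) f) (i j : Fin 3) :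
    pd (pd f i) j = pd (pd f j) i := by
  funext x
  have h2 : IsSymmSndFDerivAt ℝ f x := hf.contDiffAt.isSymmSndFDerivAt (by simp only [minSmoothness_of_isRCLikeNormedField]; exact WithTop.coe_le_coe.2 (le_top : (2 : ℕ∞) ≤ ⊤))
  have hd : DifferentiableAt ℝ (fderiv ℝ f) x :=
    ((hf.fderiv_right (m := (⊤ : ℕ∞)) (by simp)).differentiable (by simp)) x
  have h1 : ∀ a b : Fin 3, pd (pd f a) b x =
      fderiv ℝ (fderiv ℝ f) x (EuclideanSpace.single b 1) (EuclideanSpace.single a 1) := by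
    intro a b
    unfold pd
    rw [fderiv_clm_apply hd (by fun_prop)]
    simp
  rw [h1, h1]
  exact h2 _ _

lemma pd_coord (i j : Fin 3) (x : E3) : pd (fun z => z j) i x = if i = j then 1 else 0 := by
  have : (fun z : E3 => z j) = (EuclideanSpace.proj j : E3 →L[ℝ] ℝ) := rfl
  unfold pd
  rw [this, ContinuousLinearMap.fderiv]
  simp [eq_comm]

lemma pd_mvPolynomial_eval (p : MvPolynomial (Fin 3) ℝ) (i : Fin 3) (x : E3) :
    pd (fun z : E3 => MvPolynomial.eval (fun i => z i) p) i x =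
      MvPolynomial.eval (fun i => x i) (MvPolynomial.pderiv i p) := by
  have hd : ∀ q : MvPolynomial (Fin 3) ℝ,
      DifferentiableAt ℝ (fun z : E3 => MvPolynomial.eval (fun i => z i) q) x := fun q =>
    (contDiff_mvPolynomial_eval q).differentiable (by simp) x
  induction p using MvPolynomial.induction_on with
  | C a => simp [pd_const]
  | add p q hp hq =>
    simp only [map_add]
    rw [pd_add (hd p) (hd q), hp, hq]
  | mul_X p j hp =>
    have h := pd_mul (hd p) (hd (MvPolynomial.X j)) i
    simp only [MvPolynomial.eval_X] at h
    simp only [map_mul, MvPolynomial.eval_X, Derivation.leibniz, smul_eq_mul, map_add,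
      MvPolynomial.pderiv_X]
    rw [h, hp, pd_coord]
    by_cases hij : i = j
    · subst hij; simp; ring
    · simp [hij]; ring

lemma contDiff_gauss : ContDiff ℝ (⊤ : ℕ∞) fun z : E3 => Real.exp (-‖z‖ ^ 2 / 4) :=
  Real.contDiff_exp.comp (((contDiff_norm_sq ℝ).neg).div_const 4)

lemma pd_gauss (i : Fin 3) (x : E3) : pd (fun z : E3 => Real.exp (-‖z‖ ^ 2 / 4)) i x =
    -(x i / 2) * Real.exp (-‖x‖ ^ 2 / 4) := by
  unfold pd
  have h1 : HasFDerivAt (fun z : E3 => ‖z‖ ^ 2) (2 • innerSL ℝ x) x :=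
    (hasStrictFDerivAt_norm_sq x).hasFDerivAt
  have h2 : HasFDerivAt (fun z : E3 => Real.exp (-‖z‖ ^ 2 / 4)) _ x :=
    ((h1.neg.mul_const (4⁻¹ : ℝ)).exp)
  have h3 : (fun z : E3 => Real.exp (-‖z‖ ^ 2 / 4)) = fun z : E3 => Real.exp (-‖z‖ ^ 2 * 4⁻¹) := by
    funext z; rw [div_eq_mul_inv]
  rw [h2.fderiv]
  simp [EuclideanSpace.inner_single_right]
  ring_nf

lemma GP.contDiff {ψ : E3 → ℝ} (h : GP ψ) : ContDiff ℝ (⊤ : ℕ∞) ψ := by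
  obtain ⟨p, rfl⟩ := h
  exact (contDiff_mvPolynomial_eval p).mul contDiff_gauss

lemma GP.differentiable {ψ : E3 → ℝ} (h : GP ψ) : Differentiable ℝ ψ :=
  h.contDiff.differentiable (by simp)

lemma GP.continuous {ψ : E3 → ℝ} (h : GP ψ) : Continuous ψ := h.contDiff.continuous

lemma GP.dpd {ψ : E3 → ℝ} (h : GP ψ) (i : Fin 3) : GP (pd ψ i) := by
  obtain ⟨p, rfl⟩ := h
  refine ⟨MvPolynomial.pderiv i p - MvPolynomial.C (1/2) * MvPolynomial.X i * p, ?_⟩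
  funext x
  rw [pd_mul ((contDiff_mvPolynomial_eval p).differentiable (by simp) x)
    (contDiff_gauss.differentiable (by simp) x), pd_mvPolynomial_eval, pd_gauss]
  simp
  ring

lemma exists_pow_mul_exp_le (m : ℕ) :
    ∃ C : ℝ, ∀ r : ℝ, 0 ≤ r → (1 + r) ^ m * Real.exp (-r ^ 2 / 8) ≤ C := by
  refine ⟨m.factorial * Real.exp 3, fun r hr => ?_⟩
  have h1 : (1 + r) ^ m ≤ m.factorial * Real.exp (1 + r) := by
    have := Real.pow_div_factorial_le_exp (1 + r) (by linarith) m
    rw [div_le_iff₀ (by positivity)] at this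
    linarith
  calc _ ≤ m.factorial * Real.exp (1 + r) * Real.exp (-r ^ 2 / 8) := by gcongr
    _ = m.factorial * Real.exp (1 + r + -r ^ 2 / 8) := by rw [mul_assoc, ← Real.exp_add]
    _ ≤ _ := by
      gcongr
      nlinarith [sq_nonneg (r - 4)]

lemma exists_eval_le (p : MvPolynomial (Fin 3) ℝ) :
    ∃ C : ℝ, ∃ m : ℕ, 0 ≤ C ∧ ∀ z : E3, |MvPolynomial.eval (fun i => z i) p| ≤ C * (1 + ‖z‖) ^ m := by
  induction p using MvPolynomial.induction_on with
  | C a => exact ⟨|a|, 0, abs_nonneg _, fun z => by simp⟩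
  | add p q hp hq =>
    obtain ⟨C, m, hC, hp⟩ := hp
    obtain ⟨D, n, hD, hq⟩ := hq
    refine ⟨C + D, m + n, by positivity, fun z => ?_⟩
    have h1 : (1 : ℝ) ≤ 1 + ‖z‖ := by linarith [norm_nonneg z]
    have h2 : (1 + ‖z‖) ^ m ≤ (1 + ‖z‖) ^ (m + n) := pow_le_pow_right₀ h1 (by omega)
    have h3 : (1 + ‖z‖) ^ n ≤ (1 + ‖z‖) ^ (m + n) := pow_le_pow_right₀ h1 (by omega)
    rw [map_add]
    refine (abs_add_le _ _).trans ?_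
    rw [add_mul]
    exact add_le_add ((hp z).trans (by gcongr)) ((hq z).trans (by gcongr))
  | mul_X p i hp =>
    obtain ⟨C, m, hC, hp⟩ := hp
    refine ⟨C, m + 1, hC, fun z => ?_⟩
    rw [map_mul, MvPolynomial.eval_X, abs_mul, pow_succ, ← mul_assoc]
    gcongr
    · exact hp z
    · have := PiLp.norm_apply_le z i
      rw [Real.norm_eq_abs] at this
      linarith

lemma GP.bound {ψ : E3 → ℝ} (h : GP ψ) (N : ℕ) :
    ∃ C : ℝ, ∀ z, (1 + ‖z‖) ^ N * |ψ z| ≤ C * Real.exp (-‖z‖ ^ 2 / 8) := by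
  obtain ⟨p, rfl⟩ := h
  obtain ⟨C, m, hC, hp⟩ := exists_eval_le p
  obtain ⟨D, hD⟩ := exists_pow_mul_exp_le (m + N)
  refine ⟨C * D, fun z => ?_⟩
  have h1 : Real.exp (-‖z‖ ^ 2 / 4) = Real.exp (-‖z‖ ^ 2 / 8) * Real.exp (-‖z‖ ^ 2 / 8) := by
    rw [← Real.exp_add]; ring_nf
  rw [abs_mul, abs_of_pos (Real.exp_pos _), h1]
  calc _ ≤ (1 + ‖z‖) ^ N * ((C * (1 + ‖z‖) ^ m) *
        (Real.exp (-‖z‖ ^ 2 / 8) * Real.exp (-‖z‖ ^ 2 / 8))) := by gcongr; exact hp z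
    _ = C * ((1 + ‖z‖) ^ (m + N) * Real.exp (-‖z‖ ^ 2 / 8)) * Real.exp (-‖z‖ ^ 2 / 8) := by
      rw [pow_add]; ring
    _ ≤ _ := by gcongr; exact hD _ (norm_nonneg z)

lemma integrable_gauss {b : ℝ} (hb : 0 < b) :
    Integrable fun z : E3 => Real.exp (-b * ‖z‖ ^ 2) := by
  by_contra h
  have h1 := GaussianFourier.integral_rexp_neg_mul_sq_norm (V := E3) hb
  rw [integral_undef h] at h1
  have : 0 < (π / b) ^ (Module.finrank ℝ E3 / 2 : ℝ) := by positivity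
  linarith

lemma GP.integrable_moment {ψ : E3 → ℝ} (h : GP ψ) (N : ℕ) :
    Integrable fun z => (1 + ‖z‖) ^ N * |ψ z| := by
  obtain ⟨C, hC⟩ := h.bound N
  refine ((integrable_gauss (b := 1 / 8) (by norm_num)).const_mul C).mono' ?_ ?_
  · exact (((continuous_const.add continuous_norm).pow N).mul
      h.continuous.abs).aestronglyMeasurable
  · refine ae_of_all _ fun z => ?_
    rw [Real.norm_of_nonneg (by positivity)]
    refine (hC z).trans_eq ?_
    congr 2; ring

lemma GP.integrable {ψ : E3 → ℝ} (h : GP ψ) : Integrable ψ := by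
  have := h.integrable_moment 0
  simp only [pow_zero, one_mul] at this
  exact (integrable_norm_iff h.continuous.aestronglyMeasurable).1 this

lemma GP.bdd {ψ : E3 → ℝ} (h : GP ψ) : ∃ C, ∀ z, |ψ z| ≤ C := by
  obtain ⟨C, hC⟩ := h.bound 0
  have hC0 : 0 ≤ C := by
    have := hC 0
    simp only [norm_zero] at this
    have h2 : (0:ℝ) ≤ (1 + 0) ^ 0 * |ψ 0| := by positivity
    have h3 := Real.exp_pos (-0 ^ 2 / 8)
    nlinarith
  refine ⟨C, fun z => ?_⟩
  have := hC z
  simp only [pow_zero, one_mul] at this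
  refine this.trans (mul_le_of_le_one_right hC0 ?_)
  rw [Real.exp_le_one_iff]
  have : 0 ≤ ‖z‖ ^ 2 := by positivity
  linarith

/-- Moments of Gaussian-type kernels are finite. -/
lemma GP.lintegral_moment {ψ : E3 → ℝ} (h : GP ψ) (N : ℕ) :
    ∫⁻ z, ENNReal.ofReal ((1 + ‖z‖) ^ N) * ‖ψ z‖ₑ < ∞ := by
  have := (h.integrable_moment N).2
  rw [hasFiniteIntegral_iff_enorm] at this
  refine lt_of_le_of_lt (lintegral_mono fun z => ?_) this
  rw [Real.enorm_eq_ofReal_abs, Real.enorm_eq_ofReal_abs,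
    ← ENNReal.ofReal_mul (by positivity), abs_mul, abs_abs,
    abs_of_nonneg (a := (1 + ‖z‖) ^ N) (by positivity)]

lemma GP.lintegral_lt_top {ψ : E3 → ℝ} (h : GP ψ) : ∫⁻ z, ‖ψ z‖ₑ < ∞ := h.integrable.2

lemma GP.lintegral_rpow_lt_top {ψ : E3 → ℝ} (h : GP ψ) {q : ℝ} (hq : 1 ≤ q) :
    ∫⁻ z, ‖ψ z‖ₑ ^ q < ∞ := by
  obtain ⟨C, hC⟩ := h.bdd
  have hle : ∀ z, ‖ψ z‖ₑ ^ q ≤ ENNReal.ofReal C ^ (q - 1) * ‖ψ z‖ₑ := by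
    intro z
    have h1 : ‖ψ z‖ₑ ≤ ENNReal.ofReal C := by
      rw [Real.enorm_eq_ofReal_abs]; exact ENNReal.ofReal_le_ofReal (hC z)
    calc ‖ψ z‖ₑ ^ q = ‖ψ z‖ₑ ^ (q - 1) * ‖ψ z‖ₑ ^ (1:ℝ) := by
          rw [← ENNReal.rpow_add_of_nonneg _ _ (by linarith) (by norm_num)]; congr 1; ring
      _ ≤ _ := by
        rw [ENNReal.rpow_one]; gcongr
  refine lt_of_le_of_lt (lintegral_mono hle) ?_
  rw [lintegral_const_mul _ h.continuous.measurable.enorm]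
  exact ENNReal.mul_lt_top (ENNReal.rpow_lt_top_of_nonneg (by linarith) (by simp)) h.lintegral_lt_top

lemma GP.integral_pd {ψ : E3 → ℝ} (h : GP ψ) (i : Fin 3) : ∫ z, pd ψ i z = 0 := by
  have := integral_mul_fderiv_eq_neg_fderiv_mul_of_integrable (μ := (volume : Measure E3))
    (f := fun _ => (1:ℝ)) (g := ψ) (v := EuclideanSpace.single i (1:ℝ)) (𝕜 := ℝ)
    (by simp) (by simpa using! (h.dpd i).integrable) (by simpa using h.integrable)
    (by fun_prop) (fun x _ => h.differentiable x)
  simpa using! this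

/-- The heat kernel at unit time. -/
def gk (z : E3) : ℝ := (∫ y : E3, Real.exp (-‖y‖ ^ 2 / 4))⁻¹ * Real.exp (-‖z‖ ^ 2 / 4)

lemma gk_GP : GP gk := by
  refine ⟨MvPolynomial.C (∫ y : E3, Real.exp (-‖y‖ ^ 2 / 4))⁻¹, ?_⟩
  funext z
  simp [gk]

lemma integral_gk : ∫ z, gk z = 1 := by
  unfold gk
  rw [integral_const_mul, inv_mul_cancel₀]
  have h1 := GaussianFourier.integral_rexp_neg_mul_sq_norm (V := E3) (b := 1 / 4) (by norm_num)
  have h2 : (fun y : E3 => Real.exp (-‖y‖ ^ 2 / 4)) = fun y => Real.exp (-(1 / 4) * ‖y‖ ^ 2) := by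
    funext y; congr 1; ring
  rw [h2, h1]
  positivity

lemma gk_neg (z : E3) : gk (-z) = gk z := by simp [gk]

lemma coord_mul_gk (i : Fin 3) (z : E3) : z i * gk z = -2 * pd gk i z := by
  unfold gk
  rw [pd_const_mul _ _ (contDiff_gauss.differentiable (by simp) z), pd_gauss]
  ring

lemma integral_mul_pd {f g : E3 → ℝ} (i : Fin 3) (hf : Differentiable ℝ f)
    (hg : Differentiable ℝ g) (h1 : Integrable fun x => pd f i x * g x)
    (h2 : Integrable fun x => f x * pd g i x) (h3 : Integrable fun x => f x * g x) :
    ∫ x, f x * pd g i x = - ∫ x, pd f i x * g x :=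
  integral_mul_fderiv_eq_neg_fderiv_mul_of_integrable h1 h2 h3 (fun x _ => hf x) (fun x _ => hg x)

lemma CS.integral_mul_pd {f g : E3 → ℝ} (i : Fin 3) (hf : ContDiff ℝ (⊤ : ℕ∞) f) (hg : CS g) :
    ∫ x, f x * _root_.pd g i x = - ∫ x, _root_.pd f i x * g x :=
  _root_.integral_mul_pd i (hf.differentiable (by simp)) hg.differentiable
    (CS.mul (contDiff_pd hf i) hg).integrable (CS.mul hf (hg.dpd i)).integrable
    (CS.mul hf hg).integrable

/-- Jointly smooth functions of time and space. -/
def JS (F : ℝ → E3 → ℝ) : Prop := ContDiff ℝ (⊤ : ℕ∞) fun q : ℝ × E3 => F q.1 q.2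

/-- Jointly smooth functions with compact support in space-time. -/
def TF (F : ℝ → E3 → ℝ) : Prop := JS F ∧ HasCompactSupport fun q : ℝ × E3 => F q.1 q.2

/-- The time derivative. -/
def dt (F : ℝ → E3 → ℝ) (t : ℝ) (x : E3) : ℝ := deriv (fun s => F s x) t

section JSsec
variable {F H : ℝ → E3 → ℝ}

lemma JS.slice (hF : JS F) (t : ℝ) : ContDiff ℝ (⊤ : ℕ∞) (F t) :=
  ContDiff.comp (g := fun q : ℝ × E3 => F q.1 q.2) hF (contDiff_prodMk_right t)

lemma JS.hasFDerivAt (hF : JS F) (q : ℝ × E3) :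
    HasFDerivAt (fun q : ℝ × E3 => F q.1 q.2) (fderiv ℝ (fun q : ℝ × E3 => F q.1 q.2) q) q :=
  (hF.differentiable (by simp) q).hasFDerivAt

lemma JS.hasDerivAt (hF : JS F) (t : ℝ) (x : E3) :
    HasDerivAt (fun s => F s x) (fderiv ℝ (fun q : ℝ × E3 => F q.1 q.2) (t, x) (1, 0)) t :=
  HasFDerivAt.comp_hasDerivAt (f := fun s : ℝ => (s, x)) t (hF.hasFDerivAt (t, x))
    ((hasDerivAt_id t).prodMk (hasDerivAt_const t x))

lemma JS.dt_eq (hF : JS F) (t : ℝ) (x : E3) :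
    dt F t x = fderiv ℝ (fun q : ℝ × E3 => F q.1 q.2) (t, x) (1, 0) := (hF.hasDerivAt t x).deriv

lemma JS.fderiv_slice (hF : JS F) (t : ℝ) (x v : E3) :
    fderiv ℝ (F t) x v = fderiv ℝ (fun q : ℝ × E3 => F q.1 q.2) (t, x) (0, v) := by
  have h := (hF.hasFDerivAt (t, x)).comp x (hasFDerivAt_prodMk_right (𝕜 := ℝ) t x)
  have h2 : F t = (fun q : ℝ × E3 => F q.1 q.2) ∘ Prod.mk t := rfl
  rw [h2, h.fderiv]
  simp

lemma JS.fderiv_apply_contDiff (hF : JS F) (v : ℝ × E3) :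
    ContDiff ℝ (⊤ : ℕ∞) fun q : ℝ × E3 => fderiv ℝ (fun q : ℝ × E3 => F q.1 q.2) q v :=
  (ContDiff.fderiv_right (m := (⊤ : ℕ∞)) hF (by simp)).clm_apply contDiff_const

lemma JS.dt (hF : JS F) : JS (dt F) := by
  have : (fun q : ℝ × E3 => _root_.dt F q.1 q.2) =
      fun q => fderiv ℝ (fun q : ℝ × E3 => F q.1 q.2) q (1, 0) := by
    funext q; exact hF.dt_eq q.1 q.2
  unfold JS; rw [this]; exact hF.fderiv_apply_contDiff _

lemma JS.dpd (hF : JS F) (i : Fin 3) : JS (fun t => pd (F t) i) := by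
  have : (fun q : ℝ × E3 => pd (F q.1) i q.2) =
      fun q => fderiv ℝ (fun q : ℝ × E3 => F q.1 q.2) q (0, EuclideanSpace.single i 1) := by
    funext q; exact hF.fderiv_slice q.1 q.2 _
  unfold JS; rw [this]; exact hF.fderiv_apply_contDiff _

lemma JS.add (hF : JS F) (hH : JS H) : JS (fun t x => F t x + H t x) := ContDiff.add hF hH
lemma JS.sub (hF : JS F) (hH : JS H) : JS (fun t x => F t x - H t x) := ContDiff.sub hF hH
lemma JS.mul (hF : JS F) (hH : JS H) : JS (fun t x => F t x * H t x) := ContDiff.mul hF hH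
lemma JS.neg (hF : JS F) : JS (fun t x => - F t x) := ContDiff.neg hF
lemma JS.sum {ι : Type*} {s : Finset ι} {F : ι → ℝ → E3 → ℝ} (hF : ∀ i ∈ s, JS (F i)) :
    JS (fun t x => ∑ i ∈ s, F i t x) :=
  ContDiff.sum (f := fun i (q : ℝ × E3) => F i q.1 q.2) hF

lemma JS.const {g : E3 → ℝ} (hg : ContDiff ℝ (⊤ : ℕ∞) g) : JS (fun _ => g) :=
  hg.comp contDiff_snd

lemma JS.measurable (hF : JS F) : Measurable (Function.uncurry F) :=
  ContDiff.continuous (𝕜 := ℝ) hF |>.measurable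

lemma JS.pd_dt_comm (hF : JS F) (i : Fin 3) (t : ℝ) :
    pd (_root_.dt F t) i = _root_.dt (fun t => pd (F t) i) t := by
  funext x
  set U := fun q : ℝ × E3 => F q.1 q.2 with hU
  have hsym : IsSymmSndFDerivAt ℝ U (t, x) := (ContDiff.contDiffAt hF).isSymmSndFDerivAt (by
    simp only [minSmoothness_of_isRCLikeNormedField]
    exact WithTop.coe_le_coe.2 (le_top : (2 : ℕ∞) ≤ ⊤))
  have hd : DifferentiableAt ℝ (fderiv ℝ U) (t, x) :=
    ((ContDiff.fderiv_right (m := (⊤ : ℕ∞)) hF (by simp)).differentiable (by simp)) _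
  have h1 : ∀ a b : ℝ × E3, fderiv ℝ (fun q => fderiv ℝ U q a) (t, x) b =
      fderiv ℝ (fderiv ℝ U) (t, x) b a := by
    intro a b
    rw [fderiv_clm_apply hd (by fun_prop)]
    simp
  rw [(hF.dpd i).dt_eq t x]
  unfold pd
  rw [(hF.dt).fderiv_slice]
  have e1 : (fun q : ℝ × E3 => _root_.dt F q.1 q.2) = fun q => fderiv ℝ U q (1, 0) := by
    funext q; exact hF.dt_eq q.1 q.2
  have e2 : (fun q : ℝ × E3 => fderiv ℝ (F q.1) q.2 (EuclideanSpace.single i 1)) =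
      fun q => fderiv ℝ U q (0, EuclideanSpace.single i 1) := by
    funext q; exact hF.fderiv_slice q.1 q.2 _
  rw [e1]
  rw [e2, h1, h1]
  exact hsym _ _

lemma TF.slice (hF : TF F) (t : ℝ) : CS (F t) := by
  refine ⟨hF.1.slice t, ?_⟩
  refine HasCompactSupport.intro (hF.2.isCompact.image continuous_snd) fun x hx => ?_
  by_contra h
  exact hx ⟨(t, x), subset_tsupport _ h, rfl⟩

lemma TF.bdd (hF : TF F) : ∃ C, 0 ≤ C ∧ ∀ t x, |F t x| ≤ C := by
  obtain ⟨C, hC⟩ := hF.2.exists_bound_of_continuous (ContDiff.continuous (𝕜 := ℝ) hF.1)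
  exact ⟨C, (norm_nonneg _).trans (hC (0, 0)), fun t x => hC (t, x)⟩

lemma TF.fderiv_bdd (hF : TF F) :
    ∃ C, 0 ≤ C ∧ ∀ q, ‖fderiv ℝ (fun q : ℝ × E3 => F q.1 q.2) q‖ ≤ C := by
  have h : HasCompactSupport (fderiv ℝ (fun q : ℝ × E3 => F q.1 q.2)) :=
    HasCompactSupport.fderiv (𝕜 := ℝ) hF.2
  obtain ⟨C, hC⟩ := h.exists_bound_of_continuous
    (ContDiff.continuous_fderiv (𝕜 := ℝ) hF.1 (by simp))
  exact ⟨C, (norm_nonneg _).trans (hC (0, 0)), hC⟩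

lemma TF.dpd (hF : TF F) (i : Fin 3) : TF (fun t => pd (F t) i) := by
  refine ⟨hF.1.dpd i, ?_⟩
  have : (fun q : ℝ × E3 => pd (F q.1) i q.2) =
      fun q => fderiv ℝ (fun q : ℝ × E3 => F q.1 q.2) q (0, EuclideanSpace.single i 1) := by
    funext q; exact hF.1.fderiv_slice q.1 q.2 _
  rw [this]
  exact (HasCompactSupport.fderiv (𝕜 := ℝ) hF.2).comp_left
    (g := fun L : ℝ × E3 →L[ℝ] ℝ => L (0, EuclideanSpace.single i 1)) rfl

lemma TF.dt (hF : TF F) : TF (dt F) := by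
  refine ⟨hF.1.dt, ?_⟩
  have : (fun q : ℝ × E3 => _root_.dt F q.1 q.2) =
      fun q => fderiv ℝ (fun q : ℝ × E3 => F q.1 q.2) q (1, 0) := by
    funext q; exact hF.1.dt_eq q.1 q.2
  rw [this]
  exact (HasCompactSupport.fderiv (𝕜 := ℝ) hF.2).comp_left
    (g := fun L : ℝ × E3 →L[ℝ] ℝ => L (1, 0)) rfl

lemma TF.add (hF : TF F) (hH : TF H) : TF (fun t x => F t x + H t x) :=
  ⟨hF.1.add hH.1, hF.2.add hH.2⟩
lemma TF.neg (hF : TF F) : TF (fun t x => - F t x) := ⟨hF.1.neg, hF.2.neg⟩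
lemma TF.sub (hF : TF F) (hH : TF H) : TF (fun t x => F t x - H t x) := by
  simpa [sub_eq_add_neg] using hF.add hH.neg
lemma TF.mul (hF : JS F) (hH : TF H) : TF (fun t x => F t x * H t x) :=
  ⟨hF.mul hH.1, hH.2.mul_left⟩
lemma TF.zero : TF (fun _ _ => (0 : ℝ)) := ⟨contDiff_const, HasCompactSupport.zero⟩
lemma TF.sum {ι : Type*} {s : Finset ι} {F : ι → ℝ → E3 → ℝ} (hF : ∀ i ∈ s, TF (F i)) :
    TF (fun t x => ∑ i ∈ s, F i t x) := by
  classical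
  induction s using Finset.induction_on with
  | empty => simpa using TF.zero
  | insert a s ha ih =>
    simp only [Finset.sum_insert ha]
    exact (hF a (by simp)).add (ih fun i hi => hF i (by simp [hi]))

end JSsec

/-- Convolution with the kernel `ψ` rescaled to the parabolic scale `√s`. -/
def Ker (ψ : E3 → ℝ) (s : ℝ) (g : E3 → ℝ) : E3 → ℝ := Av volume ψ (fun z => √s • z) g

/-- The product of Lebesgue measure on `(0,1]` and on space. -/
def m01 : Measure (ℝ × E3) := (volume.restrict (Ioc 0 1)).prod volume

instance : SFinite m01 := by unfold m01; infer_instance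

/-- Integral of the kernels `Ker ψ s` over `s ∈ (0,1]` with weight `s⁻ᵃ`. -/
def GK (a : ℝ) (ψ : E3 → ℝ) (g : E3 → ℝ) : E3 → ℝ :=
  Av m01 (fun q => q.1 ^ (-a) * ψ q.2) (fun q => √q.1 • q.2) g

lemma measurable_sqrt_smul (s : ℝ) : Measurable fun z : E3 => √s • z := by fun_prop
lemma measurable_sqrt_smul' : Measurable fun q : ℝ × E3 => √q.1 • q.2 := by fun_prop

section
variable {ψ g : E3 → ℝ}

lemma integrable_rpow_neg {a : ℝ} (ha : a < 1) :
    Integrable (fun s : ℝ => s ^ (-a)) (volume.restrict (Ioc 0 1)) := by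
  have := intervalIntegral.intervalIntegrable_rpow' (a := 0) (b := 1) (r := -a) (by linarith)
  rwa [intervalIntegrable_iff_integrableOn_Ioc_of_le (by norm_num)] at this

lemma GK_weight (hψ : GP ψ) {a : ℝ} (ha : a < 1) :
    Integrable (fun q : ℝ × E3 => q.1 ^ (-a) * ψ q.2) m01 :=
  (integrable_rpow_neg ha).mul_prod hψ.integrable

lemma GK_weight_measurable (hψ : GP ψ) (a : ℝ) :
    Measurable (fun q : ℝ × E3 => q.1 ^ (-a) * ψ q.2) :=
  (measurable_fst.pow_const (-a)).mul (hψ.continuous.measurable.comp measurable_snd)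

lemma Ker_pd_comm (hψ : GP ψ) (s : ℝ) (hg : CS g) (i : Fin 3) :
    pd (Ker ψ s g) i = Ker ψ s (pd g i) := pd_Av hψ.integrable (measurable_sqrt_smul s) hg i

lemma Ker_contDiff (hψ : GP ψ) (s : ℝ) (hg : CS g) : ContDiff ℝ (⊤ : ℕ∞) (Ker ψ s g) :=
  Av_contDiff hψ.integrable (measurable_sqrt_smul s) hg

lemma Ker_integrable (hψ : GP ψ) (s : ℝ) (hg : CS g) : Integrable (Ker ψ s g) :=
  Av_integrable hψ.integrable hψ.continuous.measurable (measurable_sqrt_smul s) hg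

lemma GK_pd_comm (hψ : GP ψ) {a : ℝ} (ha : a < 1) (hg : CS g) (i : Fin 3) :
    pd (GK a ψ g) i = GK a ψ (pd g i) := pd_Av (GK_weight hψ ha) measurable_sqrt_smul' hg i

lemma GK_contDiff (hψ : GP ψ) {a : ℝ} (ha : a < 1) (hg : CS g) :
    ContDiff ℝ (⊤ : ℕ∞) (GK a ψ g) := Av_contDiff (GK_weight hψ ha) measurable_sqrt_smul' hg

lemma GK_integrable (hψ : GP ψ) {a : ℝ} (ha : a < 1) (hg : CS g) : Integrable (GK a ψ g) :=
  Av_integrable (GK_weight hψ ha) (GK_weight_measurable hψ a) measurable_sqrt_smul' hg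

lemma GK_bdd (hψ : GP ψ) {a : ℝ} (ha : a < 1) (hg : CS g) : ∃ C, ∀ x, |GK a ψ g x| ≤ C := by
  obtain ⟨C, hC⟩ := hg.bdd
  exact ⟨_, fun x => Av_abs_le (GK_weight hψ ha) hC x⟩

lemma GK_eq (hψ : GP ψ) {a : ℝ} (ha : a < 1) (hg : CS g) (x : E3) :
    GK a ψ g x = ∫ s in Ioc (0:ℝ) 1, s ^ (-a) * Ker ψ s g x := by
  obtain ⟨C, hC⟩ := hg.bdd
  unfold GK Av m01
  rw [integral_prod]
  · refine integral_congr_ae (ae_of_all _ fun s => ?_)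
    simp only [mul_assoc]
    rw [integral_const_mul]
    rfl
  · exact Av_integrable_integrand (GK_weight hψ ha) measurable_sqrt_smul' hg.continuous hC x

/-- A derivative can be moved to the kernel. -/
lemma Ker_pd (hψ : GP ψ) {s : ℝ} (hs : 0 < s) (hg : CS g) (i : Fin 3) (x : E3) :
    √s * Ker ψ s (pd g i) x = Ker (pd ψ i) s g x := by
  have hs' : 0 < √s := Real.sqrt_pos.2 hs
  obtain ⟨C, hC⟩ := hg.bdd
  obtain ⟨C', hC'⟩ := (hg.dpd i).bdd
  have hd : ∀ z, HasFDerivAt (fun z => g (x - √s • z)) (-(√s • fderiv ℝ g (x - √s • z))) z := by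
    intro z
    have h1 : HasFDerivAt (fun z : E3 => x - √s • z) (-(√s • ContinuousLinearMap.id ℝ E3)) z :=
      ((hasFDerivAt_id z).const_smul (√s)).const_sub x
    have h2 := (hg.differentiable (x - √s • z)).hasFDerivAt.comp z h1
    refine h2.congr_fderiv ?_
    ext v; simp
  have hpd : ∀ z, pd (fun z => g (x - √s • z)) i z = -(√s * pd g i (x - √s • z)) := by
    intro z
    unfold pd
    rw [(hd z).fderiv]; simp
  have h := integral_mul_pd (f := ψ) (g := fun z => g (x - √s • z)) i hψ.differentiable
    (fun z => (hd z).differentiableAt)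
    (Av_integrable_integrand (hψ.dpd i).integrable (measurable_sqrt_smul s) hg.continuous hC x)
    (by
      simp only [hpd]
      have := Av_integrable_integrand hψ.integrable (measurable_sqrt_smul s)
        (hg.dpd i).continuous hC' x
      refine (this.const_mul (-√s)).congr (ae_of_all _ fun z => ?_)
      simp only; ring)
    (Av_integrable_integrand hψ.integrable (measurable_sqrt_smul s) hg.continuous hC x)
  simp only [hpd] at h
  have h3 : ∀ z, ψ z * -(√s * pd g i (x - √s • z)) = -√s * (ψ z * pd g i (x - √s • z)) := by
    intro z; ring
  simp only [h3] at h
  rw [integral_const_mul] at h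
  have h4 := neg_inj.1 ((neg_mul _ _).symm.trans h)
  exact h4

lemma GK_pd (hψ : GP ψ) {a : ℝ} (ha : a < 1 / 2) (hg : CS g) (i : Fin 3) (x : E3) :
    GK a ψ (pd g i) x = GK (a + 1 / 2) (pd ψ i) g x := by
  rw [GK_eq hψ (by linarith) (hg.dpd i), GK_eq (hψ.dpd i) (by linarith) hg]
  refine setIntegral_congr_fun measurableSet_Ioc fun s hs => ?_
  rw [← Ker_pd hψ hs.1 hg, neg_add, Real.rpow_add hs.1, ← mul_assoc, mul_assoc (s ^ (-a))]
  have : s ^ (-(1 / 2 : ℝ)) * √s = 1 := by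
    rw [Real.sqrt_eq_rpow, ← Real.rpow_add hs.1]; simp
  rw [this, mul_one]

/-- The smoothing operator `∫₀¹ e^{sΔ} ds`. -/
def G (g : E3 → ℝ) : E3 → ℝ := GK 0 gk g

/-- The heat semigroup at time one. -/
def P1 (g : E3 → ℝ) : E3 → ℝ := Ker gk 1 g

lemma integral_mul_Av {α : Type*} [MeasurableSpace α] {μ : Measure α} [SFinite μ] {w : α → ℝ}
    {h : α → E3} {g₁ g₂ : E3 → ℝ} (hw : Integrable w μ) (hh : Measurable h) (hg₁ : CS g₁)
    (hg₂ : CS g₂) :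
    ∫ x, g₁ x * Av μ w h g₂ x = ∫ x, Av μ w (fun a => - h a) g₁ x * g₂ x := by
  obtain ⟨C₁, hC₁⟩ := hg₁.bdd
  obtain ⟨C₂, hC₂⟩ := hg₂.bdd
  have e1 : ∀ x, g₁ x * Av μ w h g₂ x = ∫ a, w a * g₁ x * g₂ (x - h a) ∂μ := by
    intro x
    unfold Av
    rw [← integral_const_mul]
    congr 1; funext a; ring
  have e2 : ∀ x, Av μ w (fun a => - h a) g₁ x * g₂ x = ∫ a, w a * g₁ (x + h a) * g₂ x ∂μ := by
    intro x
    unfold Av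
    rw [← integral_mul_const]
    simp only [sub_neg_eq_add]
  simp only [e1, e2]
  have i1 : Integrable (Function.uncurry fun (x : E3) (a : α) => w a * g₁ x * g₂ (x - h a))
      (volume.prod μ) := by
    have : Integrable (fun q : E3 × α => g₁ q.1 * w q.2) (volume.prod μ) :=
      hg₁.integrable.mul_prod hw
    refine (this.mul_bdd (g := fun q : E3 × α => g₂ (q.1 - h q.2)) (c := C₂) ?_ ?_).congr
      (ae_of_all _ fun q => ?_)
    · exact (hg₂.continuous.measurable.comp
        (measurable_fst.sub (hh.comp measurable_snd))).aestronglyMeasurable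
    · exact ae_of_all _ fun q => hC₂ _
    · simp only [Function.uncurry]; ring
  have i2 : Integrable (Function.uncurry fun (x : E3) (a : α) => w a * g₁ (x + h a) * g₂ x)
      (volume.prod μ) := by
    have : Integrable (fun q : E3 × α => g₂ q.1 * w q.2) (volume.prod μ) :=
      hg₂.integrable.mul_prod hw
    refine (this.mul_bdd (g := fun q : E3 × α => g₁ (q.1 + h q.2)) (c := C₁) ?_ ?_).congr
      (ae_of_all _ fun q => ?_)
    · exact (hg₁.continuous.measurable.comp
        (measurable_fst.add (hh.comp measurable_snd))).aestronglyMeasurable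
    · exact ae_of_all _ fun q => hC₁ _
    · simp only [Function.uncurry]; ring
  rw [integral_integral_swap i1, integral_integral_swap i2]
  refine integral_congr_ae (ae_of_all _ fun a => ?_)
  simp only
  rw [← integral_add_right_eq_self (fun x => w a * g₁ x * g₂ (x - h a)) (h a)]
  simp

lemma integral_mul_G {g₁ g₂ : E3 → ℝ} (hg₁ : CS g₁) (hg₂ : CS g₂) :
    ∫ x, g₁ x * G g₂ x = ∫ x, G g₁ x * g₂ x := by
  unfold G
  have h1 := integral_mul_Av (GK_weight gk_GP (a := 0) (by norm_num)) measurable_sqrt_smul' hg₁ hg₂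
  unfold GK
  rw [h1]
  congr 1
  funext x
  congr 1
  have hmp : MeasurePreserving (fun q : ℝ × E3 => (q.1, -q.2)) m01 m01 :=
    (MeasurePreserving.id _).prod (Measure.measurePreserving_neg _)
  have he : MeasurableEmbedding (fun q : ℝ × E3 => (q.1, -q.2)) :=
    ((MeasurableEquiv.refl ℝ).prodCongr (MeasurableEquiv.neg E3)).measurableEmbedding
  unfold Av
  rw [← hmp.integral_comp he]
  simp [gk_neg]

end

lemma CS.lap {g : E3 → ℝ} (hg : CS g) : CS (lap g) :=
  CS.sum (f := fun i => pd (pd g i) i) fun i _ => (hg.dpd i).dpd i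

lemma TF.lap {F : ℝ → E3 → ℝ} (hF : TF F) : TF (fun t => lap (F t)) :=
  TF.sum (F := fun i t => pd (pd (F t) i) i) fun i _ => (hF.dpd i).dpd i

lemma Av_hasDerivAt_time {α : Type*} [MeasurableSpace α] {μ : Measure α} {w : α → ℝ} {h : α → E3}
    (hw : Integrable w μ) (hh : Measurable h) {F : ℝ → E3 → ℝ} (hF : TF F) (t : ℝ) (x : E3) :
    HasDerivAt (fun t => Av μ w h (F t) x) (Av μ w h (dt F t) x) t := by
  obtain ⟨C, hC0, hC⟩ := hF.bdd
  obtain ⟨C', hC0', hC'⟩ := hF.dt.bdd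
  refine (hasDerivAt_integral_of_dominated_loc_of_deriv_le (μ := μ)
    (F := fun t a => w a * F t (x - h a)) (F' := fun t a => w a * dt F t (x - h a))
    (bound := fun a => |w a| * C') (s := univ) univ_mem ?_ ?_ ?_ ?_ ?_ ?_).2
  · exact Eventually.of_forall fun t => (Av_integrable_integrand hw hh (hF.slice t).continuous
      (hC t) x).aestronglyMeasurable
  · exact Av_integrable_integrand hw hh (hF.slice t).continuous (hC t) x
  · exact (Av_integrable_integrand hw hh (hF.dt.slice t).continuous
      (hC' t) x).aestronglyMeasurable
  · refine ae_of_all _ fun a s _ => ?_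
    rw [norm_mul]
    exact mul_le_mul_of_nonneg_left (hC' _ _) (abs_nonneg _)
  · exact hw.abs.mul_const C'
  · refine ae_of_all _ fun a s _ => ?_
    have := (hF.1.hasDerivAt s (x - h a)).const_mul (w a)
    rwa [← hF.1.dt_eq] at this

lemma Ker_sum {ι : Type*} (s : Finset ι) {ψ : E3 → ℝ} (hψ : GP ψ) (τ : ℝ) {g : ι → E3 → ℝ}
    (hg : ∀ i ∈ s, CS (g i)) (x : E3) :
    Ker ψ τ (fun y => ∑ i ∈ s, g i y) x = ∑ i ∈ s, Ker ψ τ (g i) x := by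
  unfold Ker Av
  rw [← integral_finsetSum]
  · simp only [Finset.mul_sum]
  · intro i hi
    obtain ⟨C, hC⟩ := (hg i hi).bdd
    exact Av_integrable_integrand hψ.integrable (measurable_sqrt_smul τ) (hg i hi).continuous hC x

section linear
variable {α : Type*} [MeasurableSpace α] {μ : Measure α} {w : α → ℝ} {h : α → E3}
  {f g : E3 → ℝ}

lemma Av_add (hw : Integrable w μ) (hh : Measurable h) (hf : CS f) (hg : CS g) (x : E3) :
    Av μ w h (fun y => f y + g y) x = Av μ w h f x + Av μ w h g x := by
  obtain ⟨C, hC⟩ := hf.bdd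
  obtain ⟨C', hC'⟩ := hg.bdd
  unfold Av
  rw [← integral_add (Av_integrable_integrand hw hh hf.continuous hC x)
    (Av_integrable_integrand hw hh hg.continuous hC' x)]
  simp only [mul_add]

lemma Av_sub (hw : Integrable w μ) (hh : Measurable h) (hf : CS f) (hg : CS g) (x : E3) :
    Av μ w h (fun y => f y - g y) x = Av μ w h f x - Av μ w h g x := by
  obtain ⟨C, hC⟩ := hf.bdd
  obtain ⟨C', hC'⟩ := hg.bdd
  unfold Av
  rw [← integral_sub (Av_integrable_integrand hw hh hf.continuous hC x)
    (Av_integrable_integrand hw hh hg.continuous hC' x)]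
  simp only [mul_sub]

lemma Av_neg (x : E3) : Av μ w h (fun y => - f y) x = - Av μ w h f x := by
  unfold Av
  rw [← integral_neg]
  simp only [mul_neg]

lemma Av_sum {ι : Type*} {s : Finset ι} (hw : Integrable w μ) (hh : Measurable h)
    {g : ι → E3 → ℝ} (hg : ∀ i ∈ s, CS (g i)) (x : E3) :
    Av μ w h (fun y => ∑ i ∈ s, g i y) x = ∑ i ∈ s, Av μ w h (g i) x := by
  unfold Av
  rw [← integral_finsetSum]
  · simp only [Finset.mul_sum]
  · intro i hi
    obtain ⟨C, hC⟩ := (hg i hi).bdd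
    exact Av_integrable_integrand hw hh (hg i hi).continuous hC x

end linear

lemma Ker_continuous_time {ψ : E3 → ℝ} (hψ : GP ψ) {F : ℝ → E3 → ℝ} (hF : TF F) (x : E3) :
    Continuous fun τ => Ker ψ τ (F τ) x := by
  obtain ⟨C, hC0, hC⟩ := hF.bdd
  unfold Ker Av
  refine continuous_of_dominated (bound := fun z => |ψ z| * C) ?_ ?_ ?_ ?_
  · exact fun τ => (Av_integrable_integrand hψ.integrable (measurable_sqrt_smul τ)
      (hF.slice τ).continuous (hC τ) x).aestronglyMeasurable
  · refine fun τ => ae_of_all _ fun z => ?_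
    rw [norm_mul]
    exact mul_le_mul_of_nonneg_left (hC _ _) (abs_nonneg _)
  · exact hψ.integrable.abs.mul_const C
  · refine ae_of_all _ fun z => ?_
    have h1 : Continuous fun τ : ℝ => (τ, x - √τ • z) := by fun_prop
    exact continuous_const.mul ((ContDiff.continuous (𝕜 := ℝ) hF.1).comp h1)

lemma hasDerivAt_Ker_gk {F : ℝ → E3 → ℝ} (hF : TF F) {τ : ℝ} (hτ : 0 < τ) (x : E3) :
    HasDerivAt (fun τ => Ker gk τ (F τ) x)
      (Ker gk τ (fun y => dt F τ y + lap (F τ) y) x) τ := by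
  obtain ⟨C, hC0, hC⟩ := hF.bdd
  obtain ⟨C', hC0', hC'⟩ := hF.fderiv_bdd
  set U := fun q : ℝ × E3 => F q.1 q.2 with hU
  have hcurve : ∀ z : E3, ∀ s : ℝ, 0 < s →
      HasDerivAt (fun s => (s, x - √s • z)) ((1 : ℝ), -((1 / (2 * √s)) • z)) s := by
    intro z s hs
    refine (hasDerivAt_id s).prodMk ?_
    exact ((Real.hasDerivAt_sqrt hs.ne').smul_const z).const_sub x
  have hUc : Continuous (fderiv ℝ U) := ContDiff.continuous_fderiv (𝕜 := ℝ) hF.1 (by simp)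
  have key := (hasDerivAt_integral_of_dominated_loc_of_deriv_le (μ := (volume : Measure E3))
    (x₀ := τ) (F := fun s z => gk z * F s (x - √s • z))
    (F' := fun s z => gk z * fderiv ℝ U (s, x - √s • z) ((1 : ℝ), -((1 / (2 * √s)) • z)))
    (bound := fun z => ((1 + ‖z‖) ^ 1 * |gk z|) * (C' * (1 + 1 / (2 * √(τ / 2)))))
    (s := Ioi (τ / 2)) (Ioi_mem_nhds (by linarith)) ?_ ?_ ?_ ?_ ?_ ?_).2
  · refine key.congr_deriv ?_
    have h1 : ∀ z, gk z * fderiv ℝ U (τ, x - √τ • z) ((1 : ℝ), -((1 / (2 * √τ)) • z)) =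
        gk z * dt F τ (x - √τ • z) +
          ∑ i : Fin 3, (√τ)⁻¹ * (pd gk i z * pd (F τ) i (x - √τ • z)) := by
      intro z
      have h2 : ((1 : ℝ), -((1 / (2 * √τ)) • z)) =
          ((1 : ℝ), (0 : E3)) + -(1 / (2 * √τ)) • ((0 : ℝ), z) := by simp
      rw [h2, map_add, map_smul, hF.1.dt_eq, ← hF.1.fderiv_slice, fderiv_eq_sum_pd, mul_add]
      congr 1
      simp only [sum_apply, smul_apply, smul_eq_mul,
        Finset.mul_sum]
      refine Finset.sum_congr rfl fun i _ => ?_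
      have h3 := coord_mul_gk i z
      have h4 : (EuclideanSpace.proj i : E3 →L[ℝ] ℝ) z = z i := rfl
      rw [h4]
      have h5 : pd gk i z = -(z i * gk z) / 2 := by rw [h3]; ring
      rw [h5]
      have : √τ ≠ 0 := (Real.sqrt_pos.2 hτ).ne'
      field_simp
    simp only [h1]
    rw [integral_add, integral_finsetSum]
    · have h6 : ∀ i : Fin 3, ∫ z, (√τ)⁻¹ * (pd gk i z * pd (F τ) i (x - √τ • z)) =
          Ker gk τ (pd (pd (F τ) i) i) x := by
        intro i
        rw [integral_const_mul]
        have := Ker_pd gk_GP hτ ((hF.slice τ).dpd i) i x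
        rw [inv_mul_eq_iff_eq_mul₀ (Real.sqrt_pos.2 hτ).ne']
        exact this.symm
      simp only [h6]
      have h7 := Av_add gk_GP.integrable (measurable_sqrt_smul τ) (hF.dt.slice τ)
        (hF.slice τ).lap x
      have h8 := Ker_sum Finset.univ gk_GP τ (g := fun i => pd (pd (F τ) i) i)
        (fun i _ => ((hF.slice τ).dpd i).dpd i) x
      have h9 : Ker gk τ (lap (F τ)) x = ∑ i : Fin 3, Ker gk τ (pd (pd (F τ) i) i) x := h8
      rw [← h9]
      exact h7.symm
    · intro i _
      obtain ⟨D, hD⟩ := ((hF.slice τ).dpd i).bdd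
      exact (Av_integrable_integrand (gk_GP.dpd i).integrable (measurable_sqrt_smul τ)
        ((hF.slice τ).dpd i).continuous hD x).const_mul _
    · obtain ⟨D, _, hD⟩ := hF.dt.bdd
      exact Av_integrable_integrand gk_GP.integrable (measurable_sqrt_smul τ)
        (hF.dt.slice τ).continuous (hD τ) x
    · refine integrable_finsetSum _ fun i _ => ?_
      obtain ⟨D, hD⟩ := ((hF.slice τ).dpd i).bdd
      exact (Av_integrable_integrand (gk_GP.dpd i).integrable (measurable_sqrt_smul τ)
        ((hF.slice τ).dpd i).continuous hD x).const_mul _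
  · exact Eventually.of_forall fun s => (Av_integrable_integrand gk_GP.integrable
      (measurable_sqrt_smul s) (hF.slice s).continuous (hC s) x).aestronglyMeasurable
  · exact Av_integrable_integrand gk_GP.integrable
      (measurable_sqrt_smul τ) (hF.slice τ).continuous (hC τ) x
  · refine Continuous.aestronglyMeasurable ?_
    refine gk_GP.continuous.mul ?_
    exact (hUc.comp (by fun_prop)).clm_apply (by fun_prop)
  · refine ae_of_all _ fun z s hs => ?_
    have hs0 : τ / 2 < s := hs
    have h1 : ‖((1 : ℝ), -((1 / (2 * √s)) • z))‖ ≤ (1 + ‖z‖) * (1 + 1 / (2 * √(τ / 2))) := by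
      have h2 : 1 / (2 * √s) ≤ 1 / (2 * √(τ / 2)) := by
        have : 0 < √(τ / 2) := Real.sqrt_pos.2 (by linarith)
        gcongr
      have h3 : (0 : ℝ) ≤ 1 / (2 * √(τ / 2)) := by positivity
      have h4 := norm_nonneg z
      rw [Prod.norm_def, norm_neg, norm_smul, norm_one, Real.norm_of_nonneg (by positivity)]
      refine max_le ?_ ?_
      · nlinarith
      · have : 1 / (2 * √s) * ‖z‖ ≤ 1 / (2 * √(τ / 2)) * ‖z‖ := by gcongr
        nlinarith
    rw [norm_mul, pow_one, Real.norm_eq_abs]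
    have h5 := (fderiv ℝ U (s, x - √s • z)).le_opNorm ((1 : ℝ), -((1 / (2 * √s)) • z))
    calc _ ≤ |gk z| * (C' * ((1 + ‖z‖) * (1 + 1 / (2 * √(τ / 2))))) := by
          gcongr
          exact h5.trans (by gcongr; exact hC' _)
      _ = _ := by ring
  · exact (gk_GP.integrable_moment 1).mul_const _
  · refine ae_of_all _ fun z s hs => ?_
    have hs0 : 0 < s := lt_trans (by linarith) (show τ / 2 < s from hs)
    exact (HasFDerivAt.comp_hasDerivAt (f := fun s : ℝ => (s, x - √s • z)) s
      (hF.1.hasFDerivAt (s, x - √s • z)) (hcurve z s hs0)).const_mul (gk z)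

lemma Ker_gk_zero (g : E3 → ℝ) (x : E3) : Ker gk 0 g x = g x := by
  unfold Ker Av
  simp only [Real.sqrt_zero, zero_smul, sub_zero]
  rw [integral_mul_const, integral_gk, one_mul]

lemma integral_Ker_heat {F : ℝ → E3 → ℝ} (hF : TF F) (x : E3) :
    ∫ s in (0:ℝ)..1, Ker gk s (fun y => dt F s y + lap (F s) y) x =
      Ker gk 1 (F 1) x - F 0 x := by
  rw [intervalIntegral.integral_eq_sub_of_hasDerivAt_of_le (by norm_num)
    (f := fun τ => Ker gk τ (F τ) x) (Ker_continuous_time gk_GP hF x).continuousOn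
    (fun s hs => hasDerivAt_Ker_gk hF hs.1 x)
    (Ker_continuous_time gk_GP (hF.dt.add hF.lap) x |>.intervalIntegrable _ _)]
  rw [Ker_gk_zero]

lemma TF.comp_sub {F : ℝ → E3 → ℝ} (hF : TF F) (t : ℝ) : TF (fun s => F (t - s)) := by
  refine ⟨ContDiff.comp (g := fun q : ℝ × E3 => F q.1 q.2) (f := fun q : ℝ × E3 => (t - q.1, q.2))
    hF.1 (by fun_prop), ?_⟩
  exact hF.2.comp_homeomorph ((Homeomorph.subLeft t).prodCongr (Homeomorph.refl E3))

/-- Duhamel's formula. -/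
lemma duhamel {F : ℝ → E3 → ℝ} (hF : TF F) (t : ℝ) (x : E3) :
    F t x = Ker gk 1 (F (t - 1)) x +
      ∫ s in (0:ℝ)..1, Ker gk s (fun y => dt F (t - s) y - lap (F (t - s)) y) x := by
  have h := integral_Ker_heat (hF.comp_sub t) x
  have h1 : ∀ s y, dt (fun s => F (t - s)) s y = - dt F (t - s) y := by
    intro s y
    unfold dt
    exact deriv_comp_const_sub (f := fun s => F s y) t s
  simp only [h1, sub_zero] at h
  have h2 : ∀ s : ℝ, Ker gk s (fun y => - dt F (t - s) y + lap (F (t - s)) y) x =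
      - Ker gk s (fun y => dt F (t - s) y - lap (F (t - s)) y) x := by
    intro s
    unfold Ker
    rw [← Av_neg]
    congr 1; funext y; ring
  simp only [h2] at h
  rw [intervalIntegral.integral_neg] at h
  linarith

/-- A smooth time cutoff equal to one near `[-1, 2]`. -/
def tcut : ContDiffBump (0 : ℝ) := ⟨3, 4, by norm_num, by norm_num⟩

lemma tcut_contDiff : ContDiff ℝ (⊤ : ℕ∞) (tcut : ℝ → ℝ) := tcut.contDiff

lemma tcut_one {t : ℝ} (ht : |t| ≤ 3) : tcut t = 1 :=
  tcut.one_of_mem_closedBall (by simpa [tcut] using ht)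

lemma TF.of_CS {F : ℝ → E3 → ℝ} (hF : JS F) {K : Set E3} (hK : IsCompact K)
    (h0 : ∀ t, ∀ x ∉ K, F t x = 0) : TF (fun t x => tcut t * F t x) := by
  refine ⟨JS.mul (F := fun t _ => tcut t) (tcut_contDiff.comp contDiff_fst) hF, ?_⟩
  refine HasCompactSupport.intro ((isCompact_closedBall (0:ℝ) 4).prod hK) fun q hq => ?_
  by_cases h : q.2 ∈ K
  · have : q.1 ∉ closedBall (0:ℝ) 4 := fun h' => hq ⟨h', h⟩
    have : tcut q.1 = 0 := tcut.zero_of_le_dist (by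
      simp only [mem_closedBall, not_le] at this
      exact this.le)
    simp [this]
  · simp [h0 q.1 q.2 h]

lemma tcut_eventually {t : ℝ} (ht : |t| < 3) : (tcut : ℝ → ℝ) =ᶠ[𝓝 t] fun _ => 1 := by
  have : ∀ᶠ s in 𝓝 t, |s| < 3 := (continuous_abs.tendsto t).eventually_lt_const ht
  exact this.mono fun s hs => tcut_one hs.le

lemma lap_G {g : E3 → ℝ} (hg : CS g) (x : E3) : lap (G g) x = P1 g x - g x := by
  have hTF : TF (fun t x => tcut t * g x) :=
    TF.of_CS (JS.const hg.1) hg.2.isCompact fun t x hx => image_eq_zero_of_notMem_tsupport hx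
  have h := integral_Ker_heat hTF x
  have hlap : lap (G g) x = G (lap g) x := by
    have h1 : ∀ i, pd (pd (G g) i) i = G (pd (pd g i) i) := by
      intro i
      unfold G
      rw [GK_pd_comm gk_GP (by norm_num) hg, GK_pd_comm gk_GP (by norm_num) (hg.dpd i)]
    have h2 : lap (G g) x = ∑ i, pd (pd (G g) i) i x := rfl
    rw [h2]
    simp only [h1]
    exact (Av_sum (GK_weight gk_GP (a := 0) (by norm_num)) measurable_sqrt_smul'
      (g := fun i => pd (pd g i) i) (fun i _ => (hg.dpd i).dpd i) x).symm
  rw [hlap]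
  unfold G
  rw [GK_eq gk_GP (by norm_num) hg.lap, ← intervalIntegral.integral_of_le (by norm_num)]
  have e1 : Ker gk 1 (fun x => tcut 1 * g x) x = P1 g x := by
    rw [tcut_one (by norm_num)]; simp [P1]
  have e0 : tcut (0:ℝ) * g x = g x := by rw [tcut_one (by norm_num)]; simp
  rw [e1, e0] at h
  rw [← h]
  refine intervalIntegral.integral_congr fun s hs => ?_
  rw [uIcc_of_le (by norm_num)] at hs
  have hs3 : |s| < 3 := by rw [abs_lt]; constructor <;> linarith [hs.1, hs.2]
  simp only [neg_zero, Real.rpow_zero, one_mul]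
  congr 1
  funext y
  have : dt (fun t x => tcut t * g x) s y = 0 := by
    unfold dt
    have he : (fun s => tcut s * g y) =ᶠ[𝓝 s] fun _ => 1 * g y :=
      (tcut_eventually hs3).mono fun r hr => by simp only [hr]
    rw [he.deriv_eq]; simp
  rw [this, tcut_one hs3.le]
  simp

lemma lintegral_comp_sub_smul {f : E3 → ℝ≥0∞} (hf : Measurable f) (x : E3) {r : ℝ} (hr : 0 < r) :
    ∫⁻ z, f (x - r • z) = ENNReal.ofReal (r ^ (-3 : ℝ)) * ∫⁻ z, f z := by
  have h1 := Measure.map_addHaar_smul (volume : Measure E3) hr.ne'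
  have h2 : ∫⁻ z, f (x - r • z) = ∫⁻ z, f (x - z) ∂(Measure.map (fun z => r • z) volume) := by
    have hm : Measurable fun z => f (x - z) := hf.comp (by fun_prop)
    rw [lintegral_map hm (measurable_const_smul r)]
  rw [h2, h1, lintegral_smul_measure, lintegral_sub_left_eq_self (fun z => f z) x]
  have h3 : |(r ^ Module.finrank ℝ E3)⁻¹| = r ^ (-3 : ℝ) := by
    have : Module.finrank ℝ E3 = 3 := by simp
    rw [this, abs_of_pos (by positivity), Real.rpow_neg hr.le]
    norm_cast
  rw [h3, smul_eq_mul]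

/-- Nonnegative version of `Ker`. -/
def LK (ψ : E3 → ℝ) (s : ℝ) (g : E3 → ℝ) (x : E3) : ℝ≥0∞ := ∫⁻ z, ‖ψ z‖ₑ * ‖g (x - √s • z)‖ₑ

lemma LK_measurable {ψ g : E3 → ℝ} (hψ : Measurable ψ) (hg : Measurable g) :
    Measurable (Function.uncurry fun s x => LK ψ s g x) := by
  unfold LK Function.uncurry
  refine Measurable.lintegral_prod_right' (f := fun q : (ℝ × E3) × E3 =>
    ‖ψ q.2‖ₑ * ‖g (q.1.2 - √q.1.1 • q.2)‖ₑ) ?_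
  refine (hψ.comp measurable_snd).enorm.mul (hg.comp ?_).enorm
  fun_prop

lemma enorm_Ker_le {ψ g : E3 → ℝ} (s : ℝ) (x : E3) : ‖Ker ψ s g x‖ₑ ≤ LK ψ s g x :=
  enorm_Av_le x

/-- Young's inequality for a rescaled kernel. -/
lemma young_LK {ψ g : E3 → ℝ} (hψ : Measurable ψ) (hg : Measurable g) {p r : ℝ} (hp : 0 < p)
    (hr : 4 / 3 ≤ r) (hpr : 1 / r = 1 / p - 1 / 4) {s : ℝ} (hs : 0 < s) :
    ∫⁻ x, LK ψ s g x ^ r ≤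
      (∫⁻ z, ‖ψ z‖ₑ ^ (4 / 3 : ℝ)) ^ (3 / 4 * r) *
        (ENNReal.ofReal (s ^ (-(3 / 8) * r)) * Np p g ^ (r / p)) := by
  have hr0 : 0 < r := by linarith
  have hs' : 0 < √s := Real.sqrt_pos.2 hs
  set Ψ := ∫⁻ z, ‖ψ z‖ₑ ^ (4 / 3 : ℝ) with hΨ
  have hr34 : 1 / r ≤ 3 / 4 := by rw [div_le_div_iff₀ hr0 (by norm_num)]; linarith
  have hpointwise : ∀ x, LK ψ s g x ^ r ≤
      (∫⁻ z, ‖ψ z‖ₑ ^ (4 / 3 : ℝ) * ‖g (x - √s • z)‖ₑ ^ p) *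
        (Ψ ^ (3 / 4 * r - 1) * (ENNReal.ofReal (√s ^ (-3 : ℝ)) * Np p g) ^ (r / 4)) := by
    intro x
    have hgm : Measurable fun z => g (x - √s • z) := hg.comp (by fun_prop)
    have h := lintegral_holder_three (volume : Measure E3)
      (f := fun z => ‖ψ z‖ₑ ^ (4 / 3 : ℝ) * ‖g (x - √s • z)‖ₑ ^ p)
      (g := fun z => ‖ψ z‖ₑ ^ (4 / 3 : ℝ)) (h := fun z => ‖g (x - √s • z)‖ₑ ^ p)
      ((hψ.enorm.pow_const _).mul (hgm.enorm.pow_const _)).aemeasurable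
      (hψ.enorm.pow_const _).aemeasurable (hgm.enorm.pow_const _).aemeasurable
      (a := 1 / r) (b := 3 / 4 - 1 / r) (c := 1 / 4) (by positivity) (by linarith) (by norm_num)
      (by ring)
    have e1 : ∀ z, (‖ψ z‖ₑ ^ (4 / 3 : ℝ) * ‖g (x - √s • z)‖ₑ ^ p) ^ (1 / r) *
        (‖ψ z‖ₑ ^ (4 / 3 : ℝ)) ^ (3 / 4 - 1 / r) * (‖g (x - √s • z)‖ₑ ^ p) ^ (1 / 4 : ℝ) =
        ‖ψ z‖ₑ * ‖g (x - √s • z)‖ₑ := by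
      intro z
      rw [ENNReal.mul_rpow_of_nonneg _ _ (by positivity)]
      simp only [← ENNReal.rpow_mul]
      have h34 : 0 ≤ 3 / 4 - 1 / r := by linarith
      calc _ = (‖ψ z‖ₑ ^ (4 / 3 * (1 / r)) * ‖ψ z‖ₑ ^ (4 / 3 * (3 / 4 - 1 / r))) *
            (‖g (x - √s • z)‖ₑ ^ (p * (1 / r)) * ‖g (x - √s • z)‖ₑ ^ (p * (1 / 4))) := by ring
        _ = _ := by
          rw [← ENNReal.rpow_add_of_nonneg _ _ (by positivity) (by positivity),
            ← ENNReal.rpow_add_of_nonneg _ _ (by positivity) (by positivity)]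
          have e3 : p * (1 / r) + p * (1 / 4) = 1 := by rw [hpr]; field_simp; ring
          have e4 : (4:ℝ) / 3 * (1 / r) + 4 / 3 * (3 / 4 - 1 / r) = 1 := by ring
          rw [e3, e4, ENNReal.rpow_one, ENNReal.rpow_one]
    simp only [e1] at h
    rw [lintegral_comp_sub_smul (f := fun y => ‖g y‖ₑ ^ p) (hg.enorm.pow_const _) x hs'] at h
    refine (ENNReal.rpow_le_rpow h hr0.le).trans_eq ?_
    rw [ENNReal.mul_rpow_of_nonneg _ _ hr0.le, ENNReal.mul_rpow_of_nonneg _ _ hr0.le,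
      ← ENNReal.rpow_mul, ← ENNReal.rpow_mul, ← ENNReal.rpow_mul, one_div_mul_cancel hr0.ne',
      ENNReal.rpow_one, mul_assoc]
    congr 3
    · field_simp
    · ring
  have hm : Measurable fun q : E3 × E3 => ‖ψ q.2‖ₑ ^ (4 / 3 : ℝ) * ‖g (q.1 - √s • q.2)‖ₑ ^ p := by
    refine ((hψ.comp measurable_snd).enorm.pow_const _).mul ((hg.comp ?_).enorm.pow_const _)
    fun_prop
  have hN : ∫⁻ x, ∫⁻ z, ‖ψ z‖ₑ ^ (4 / 3 : ℝ) * ‖g (x - √s • z)‖ₑ ^ p = Ψ * Np p g := by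
    rw [lintegral_lintegral_swap hm.aemeasurable]
    have : ∀ z, ∫⁻ x, ‖ψ z‖ₑ ^ (4 / 3 : ℝ) * ‖g (x - √s • z)‖ₑ ^ p =
        ‖ψ z‖ₑ ^ (4 / 3 : ℝ) * Np p g := by
      intro z
      have hgm : Measurable fun x => ‖g (x - √s • z)‖ₑ ^ p :=
        (hg.comp (by fun_prop)).enorm.pow_const _
      rw [lintegral_const_mul _ hgm]
      congr 1
      exact Np_sub_const p g (√s • z)
    simp only [this]
    rw [lintegral_mul_const _ (hψ.enorm.pow_const _)]
  calc _ ≤ ∫⁻ x, (∫⁻ z, ‖ψ z‖ₑ ^ (4 / 3 : ℝ) * ‖g (x - √s • z)‖ₑ ^ p) *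
        (Ψ ^ (3 / 4 * r - 1) * (ENNReal.ofReal (√s ^ (-3 : ℝ)) * Np p g) ^ (r / 4)) :=
        lintegral_mono hpointwise
    _ = Ψ * Np p g *
        (Ψ ^ (3 / 4 * r - 1) * (ENNReal.ofReal (√s ^ (-3 : ℝ)) * Np p g) ^ (r / 4)) := by
        rw [lintegral_mul_const _ hm.lintegral_prod_right', hN]
    _ = (Ψ ^ (1:ℝ) * Ψ ^ (3 / 4 * r - 1)) * (ENNReal.ofReal (s ^ (-(3 / 8) * r)) *
          (Np p g ^ (1:ℝ) * Np p g ^ (r / 4))) := by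
        rw [ENNReal.mul_rpow_of_nonneg _ _ (by positivity), ENNReal.ofReal_rpow_of_nonneg
          (by positivity) (by positivity), ← Real.rpow_mul hs'.le, ENNReal.rpow_one,
          ENNReal.rpow_one, Real.sqrt_eq_rpow, ← Real.rpow_mul hs.le]
        have : (1:ℝ) / 2 * (-3 * (r / 4)) = -(3 / 8) * r := by ring
        rw [this]; ring
    _ = _ := by
        rw [← ENNReal.rpow_add_of_nonneg _ _ (by norm_num) (by linarith),
          ← ENNReal.rpow_add_of_nonneg _ _ (by norm_num) (by linarith)]
        have e1 : 1 + (3 / 4 * r - 1) = 3 / 4 * r := by ring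
        have e2 : 1 + r / 4 = r / p := by
          have : r * (1 / r) = r * (1 / p - 1 / 4) := by rw [hpr]
          rw [mul_one_div_cancel hr0.ne'] at this
          rw [this]; ring
        rw [e1, e2]

lemma enorm_GK_le {ψ g : E3 → ℝ} (hψ : GP ψ) {a : ℝ} (ha : a < 1) (hg : CS g) (x : E3) :
    ‖GK a ψ g x‖ₑ ≤ ∫⁻ s in Ioc (0:ℝ) 1, ENNReal.ofReal (s ^ (-a)) * LK ψ s g x := by
  rw [GK_eq hψ ha hg]
  refine (enorm_integral_le_lintegral_enorm _).trans ?_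
  refine setLIntegral_mono' measurableSet_Ioc fun s hs => ?_
  rw [enorm_mul, Real.enorm_of_nonneg (Real.rpow_nonneg hs.1.le _)]
  gcongr
  exact enorm_Ker_le s x

lemma lintegral_rpow_neg_lt_top {a : ℝ} (ha : a < 1) :
    ∫⁻ s in Ioc (0:ℝ) 1, ENNReal.ofReal (s ^ (-a)) < ∞ := by
  have h := (integrable_rpow_neg ha).2
  rw [hasFiniteIntegral_iff_enorm] at h
  refine lt_of_le_of_lt (lintegral_mono fun s => ?_) h
  rw [Real.enorm_eq_ofReal_abs]
  exact ENNReal.ofReal_le_ofReal (le_abs_self _)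

/-- Minkowski's inequality in the time variable with a power weight. -/
lemma minkowski_time {X : Type*} [MeasurableSpace X] {ν : Measure X} [SFinite ν]
    {F : ℝ → X → ℝ≥0∞} (hF : Measurable (Function.uncurry F)) {p b : ℝ} (hp : 1 ≤ p)
    {N : ℝ≥0∞}
    (hN : ∀ s ∈ Ioc (0:ℝ) 1, ∫⁻ x, F s x ^ p ∂ν ≤ ENNReal.ofReal (s ^ (-b * p)) * N) :
    ∫⁻ x, (∫⁻ s in Ioc (0:ℝ) 1, F s x) ^ p ∂ν ≤
      (∫⁻ s in Ioc (0:ℝ) 1, ENNReal.ofReal (s ^ (-b))) ^ p * N := by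
  set F' : ℝ → X → ℝ≥0∞ := fun s x => (Ioc (0:ℝ) 1).indicator 1 s *
    (ENNReal.ofReal (s ^ b) * F s x) with hF'
  have hw : Measurable fun s : ℝ => ENNReal.ofReal (s ^ (-b)) :=
    (measurable_id.pow_const (-b)).ennreal_ofReal
  have h1 : ∀ x, ∫⁻ s in Ioc (0:ℝ) 1, F s x =
      ∫⁻ s in Ioc (0:ℝ) 1, ENNReal.ofReal (s ^ (-b)) * F' s x := by
    intro x
    refine setLIntegral_congr_fun measurableSet_Ioc fun s hs => ?_
    simp only [hF', indicator_of_mem hs, Pi.one_apply, one_mul]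
    rw [← mul_assoc, ← ENNReal.ofReal_mul (Real.rpow_nonneg hs.1.le _), ← Real.rpow_add hs.1]
    simp
  simp only [h1]
  have hp0 : 0 ≤ p := by linarith
  refine lintegral_rpow_lintegral_le _ _ hw ?_ hp fun s => ?_
  · have hi : Measurable ((Ioc (0:ℝ) 1).indicator (1 : ℝ → ℝ≥0∞)) :=
      measurable_one.indicator measurableSet_Ioc
    exact (hi.comp measurable_fst).mul
      (((measurable_fst.pow_const b).ennreal_ofReal).mul hF)
  · by_cases hs : s ∈ Ioc (0:ℝ) 1
    · simp only [hF', indicator_of_mem hs, Pi.one_apply, one_mul]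
      have hFs : Measurable fun x => F s x := hF.comp (measurable_const.prodMk measurable_id)
      simp only [ENNReal.mul_rpow_of_nonneg _ _ hp0]
      rw [lintegral_const_mul _ (hFs.pow_const p)]
      calc _ ≤ ENNReal.ofReal (s ^ b) ^ p * (ENNReal.ofReal (s ^ (-b * p)) * N) := by
            gcongr; exact hN s hs
        _ = N := by
            rw [ENNReal.ofReal_rpow_of_nonneg (Real.rpow_nonneg hs.1.le _) hp0,
              ← Real.rpow_mul hs.1.le, ← mul_assoc, ← ENNReal.ofReal_mul
              (Real.rpow_nonneg hs.1.le _), ← Real.rpow_add hs.1]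
            simp
    · simp only [hF', indicator_of_notMem hs, zero_mul]
      rw [ENNReal.zero_rpow_of_pos (by linarith)]
      simp

/-- Young's inequality for the smoothing operators. -/
lemma young_GK {ψ : E3 → ℝ} (hψ : GP ψ) {a : ℝ} (ha : a < 5 / 8) {p r : ℝ} (hp : 0 < p)
    (hr : 4 / 3 ≤ r) (hpr : 1 / r = 1 / p - 1 / 4) :
    ∃ C : ℝ≥0∞, C < ∞ ∧ ∀ g, CS g → Np r (GK a ψ g) ≤ C * Np p g ^ (r / p) := by
  have hr0 : 0 < r := by linarith
  refine ⟨(∫⁻ s in Ioc (0:ℝ) 1, ENNReal.ofReal (s ^ (-(a + 3 / 8)))) ^ r *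
    (∫⁻ z, ‖ψ z‖ₑ ^ (4 / 3 : ℝ)) ^ (3 / 4 * r), ?_, fun g hg => ?_⟩
  · exact ENNReal.mul_lt_top (ENNReal.rpow_lt_top_of_nonneg hr0.le
      (lintegral_rpow_neg_lt_top (by linarith)).ne)
      (ENNReal.rpow_lt_top_of_nonneg (by positivity)
      (hψ.lintegral_rpow_lt_top (by norm_num)).ne)
  · have hψm := hψ.continuous.measurable
    have hgm := hg.continuous.measurable
    calc Np r (GK a ψ g) ≤ ∫⁻ x, (∫⁻ s in Ioc (0:ℝ) 1, ENNReal.ofReal (s ^ (-a)) * LK ψ s g x) ^ r :=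
          lintegral_mono fun x => ENNReal.rpow_le_rpow (enorm_GK_le hψ (by linarith) hg x) hr0.le
      _ ≤ _ := by
          rw [mul_assoc]
          refine minkowski_time ?_ (by linarith) fun s hs => ?_
          · exact ((measurable_fst.pow_const _).ennreal_ofReal).mul (LK_measurable hψm hgm)
          · simp only [ENNReal.mul_rpow_of_nonneg _ _ hr0.le]
            have hLm : Measurable fun x => LK ψ s g x ^ r := ((LK_measurable hψm hgm).comp
              (measurable_const.prodMk measurable_id)).pow_const r
            rw [lintegral_const_mul _ hLm]
            refine (mul_le_mul_right (young_LK hψm hgm hp hr hpr hs.1) _).trans_eq ?_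
            rw [ENNReal.ofReal_rpow_of_nonneg (Real.rpow_nonneg hs.1.le _) hr0.le,
              ← Real.rpow_mul hs.1.le]
            have : -(a + 3 / 8) * r = -a * r + -(3 / 8) * r := by ring
            rw [this, Real.rpow_add hs.1, ENNReal.ofReal_mul (Real.rpow_nonneg hs.1.le _)]
            ring

lemma Np_GK_le {ψ : E3 → ℝ} (hψ : GP ψ) {a : ℝ} (ha : a < 1) {p : ℝ} (hp : 1 ≤ p) :
    ∃ C : ℝ≥0∞, C < ∞ ∧ ∀ g, CS g → Np p (GK a ψ g) ≤ C * Np p g :=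
  ⟨_, ENNReal.rpow_lt_top_of_nonneg (by linarith) (GK_weight hψ ha).2.ne, fun _ hg =>
    Np_Av_le (GK_weight_measurable hψ a) measurable_sqrt_smul' hg.continuous.measurable hp⟩

lemma Np_Ker_le {ψ : E3 → ℝ} (hψ : GP ψ) {p : ℝ} (hp : 1 ≤ p) :
    ∃ C : ℝ≥0∞, C < ∞ ∧ ∀ g, CS g → ∀ s, Np p (Ker ψ s g) ≤ C * Np p g :=
  ⟨_, ENNReal.rpow_lt_top_of_nonneg (by linarith) hψ.lintegral_lt_top.ne, fun _ hg s =>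
    Np_Av_le hψ.continuous.measurable (measurable_sqrt_smul s) hg.continuous.measurable hp⟩

lemma young_Ker_one {ψ : E3 → ℝ} (hψ : GP ψ) {p r : ℝ} (hp : 0 < p)
    (hr : 4 / 3 ≤ r) (hpr : 1 / r = 1 / p - 1 / 4) :
    ∃ C : ℝ≥0∞, C < ∞ ∧ ∀ g, CS g → Np r (Ker ψ 1 g) ≤ C * Np p g ^ (r / p) := by
  have hr0 : 0 < r := by linarith
  refine ⟨(∫⁻ z, ‖ψ z‖ₑ ^ (4 / 3 : ℝ)) ^ (3 / 4 * r), ENNReal.rpow_lt_top_of_nonneg (by positivity)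
      (hψ.lintegral_rpow_lt_top (by norm_num)).ne, fun g hg => ?_⟩
  refine (lintegral_mono fun x => ENNReal.rpow_le_rpow (enorm_Ker_le 1 x) hr0.le).trans ?_
  refine (young_LK hψ.continuous.measurable hg.continuous.measurable hp hr hpr one_pos).trans_eq ?_
  simp

lemma Np_add_le {p : ℝ} (hp : 1 ≤ p) {f g : E3 → ℝ} (hf : Measurable f) :
    Np p (fun x => f x + g x) ≤ 2 ^ (p - 1) * (Np p f + Np p g) := by
  unfold Np
  rw [← lintegral_add_left (hf.enorm.pow_const p), ← lintegral_const_mul' _ _ (by finiteness)]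
  refine lintegral_mono fun x => ?_
  exact (ENNReal.rpow_le_rpow (enorm_add_le _ _) (by linarith)).trans
    (ENNReal.rpow_add_le_mul_rpow_add_rpow _ _ hp)

lemma Np_neg (p : ℝ) (f : E3 → ℝ) : Np p (fun x => - f x) = Np p f := by
  simp [Np]

/-- A type of data carrying a size parameter that is at least `2`. -/
class Wt (ι : Type*) where
  /-- The size parameter. -/
  a : ι → ℝ≥0∞
  two_le : ∀ i, 2 ≤ a i

instance {ι β : Type*} [Wt ι] : Wt (ι × β) := ⟨fun q => Wt.a q.1, fun q => Wt.two_le q.1⟩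

/-- Domination up to a power of the size parameter. -/
def Pol {ι : Type*} [Wt ι] (X Y : ι → ℝ≥0∞) : Prop := ∃ n : ℕ, ∀ i, X i ≤ Wt.a i ^ n * Y i

namespace Pol
variable {ι : Type*} [Wt ι] {X Y Z X' Y' : ι → ℝ≥0∞}

lemma one_le_a (i : ι) : 1 ≤ Wt.a i := le_trans (by norm_num) (Wt.two_le i)

lemma of_le (h : ∀ i, X i ≤ Y i) : Pol X Y := ⟨0, by simpa using h⟩

lemma refl (X : ι → ℝ≥0∞) : Pol X X := of_le fun _ => le_rfl

lemma trans (h : Pol X Y) (h' : Pol Y Z) : Pol X Z := by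
  obtain ⟨n, hn⟩ := h
  obtain ⟨m, hm⟩ := h'
  refine ⟨n + m, fun i => (hn i).trans ?_⟩
  rw [pow_add, mul_assoc]
  gcongr
  exact hm i

lemma mono_left (h : ∀ i, X i ≤ Y i) (h' : Pol Y Z) : Pol X Z := (of_le h).trans h'

lemma mono_right (h : Pol X Y) (h' : ∀ i, Y i ≤ Z i) : Pol X Z := h.trans (of_le h')

lemma pow_mono {i : ι} {n m : ℕ} (h : n ≤ m) : Wt.a i ^ n ≤ Wt.a i ^ m :=
  pow_le_pow_right₀ (one_le_a i) h

lemma const_le {C : ℝ≥0∞} (hC : C ≠ ∞) : ∃ n : ℕ, ∀ i : ι, C ≤ Wt.a i ^ n := by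
  lift C to ℝ≥0 using hC
  obtain ⟨n, hn⟩ := pow_unbounded_of_one_lt C (by norm_num : (1:ℝ≥0) < 2)
  refine ⟨n, fun i => le_trans ?_ (pow_le_pow_left' (Wt.two_le i) n)⟩
  have : (C : ℝ≥0∞) ≤ ((2 ^ n : ℝ≥0) : ℝ≥0∞) := ENNReal.coe_le_coe.2 hn.le
  simpa using this

lemma const_mul {C : ℝ≥0∞} (hC : C ≠ ∞) (h : Pol X Y) : Pol (fun i => C * X i) Y := by
  obtain ⟨n, hn⟩ := h
  obtain ⟨m, hm⟩ := const_le (ι := ι) hC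
  refine ⟨m + n, fun i => ?_⟩
  rw [pow_add, mul_assoc]
  exact mul_le_mul' (hm i) (hn i)

lemma mul_const {C : ℝ≥0∞} (hC : C ≠ ∞) (h : Pol X Y) : Pol (fun i => X i * C) Y := by
  simpa only [mul_comm] using h.const_mul hC

lemma const {C : ℝ≥0∞} (hC : C ≠ ∞) : Pol (fun _ : ι => C) (fun _ => 1) := by
  simpa using (refl (fun _ : ι => (1:ℝ≥0∞))).const_mul hC

lemma wt : Pol (fun i : ι => Wt.a i) (fun _ => 1) := ⟨1, by simp⟩

lemma mul (h : Pol X Y) (h' : Pol X' Y') : Pol (fun i => X i * X' i) (fun i => Y i * Y' i) := by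
  obtain ⟨n, hn⟩ := h
  obtain ⟨m, hm⟩ := h'
  refine ⟨n + m, fun i => (mul_le_mul' (hn i) (hm i)).trans_eq ?_⟩
  rw [pow_add]; ring

lemma mul_one (h : Pol X Y) (h' : Pol X' fun _ => 1) : Pol (fun i => X i * X' i) Y := by
  simpa using h.mul h'

lemma one_mul (h' : Pol X' fun _ => 1) (h : Pol X Y) : Pol (fun i => X' i * X i) Y := by
  simpa using h'.mul h

lemma add (h : Pol X Z) (h' : Pol Y Z) : Pol (fun i => X i + Y i) Z := by
  obtain ⟨n, hn⟩ := h
  obtain ⟨m, hm⟩ := h'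
  refine ⟨1 + max n m, fun i => ?_⟩
  calc X i + Y i ≤ Wt.a i ^ (max n m) * Z i + Wt.a i ^ (max n m) * Z i :=
        add_le_add ((hn i).trans (mul_le_mul' (pow_mono (le_max_left _ _)) le_rfl))
          ((hm i).trans (mul_le_mul' (pow_mono (le_max_right _ _)) le_rfl))
    _ = 2 * (Wt.a i ^ (max n m) * Z i) := by ring
    _ ≤ Wt.a i * (Wt.a i ^ (max n m) * Z i) := by gcongr; exact Wt.two_le i
    _ = _ := by rw [pow_add]; ring

lemma add_mono (h : Pol X Y) (h' : Pol X' Y') :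
    Pol (fun i => X i + X' i) (fun i => Y i + Y' i) :=
  (h.mono_right fun _ => le_self_add).add (h'.mono_right fun _ => le_add_self)

lemma sum {κ : Type*} (s : Finset κ) {X : κ → ι → ℝ≥0∞} (h : ∀ k ∈ s, Pol (X k) Z) :
    Pol (fun i => ∑ k ∈ s, X k i) Z := by
  classical
  induction s using Finset.induction_on with
  | empty => exact of_le fun i => by simp
  | insert k s hk ih =>
    simp only [Finset.sum_insert hk]
    exact (h k (by simp)).add (ih fun l hl => h l (by simp [hl]))

lemma rpow {r : ℝ} (hr : 0 ≤ r) (h : Pol X Y) : Pol (fun i => X i ^ r) (fun i => Y i ^ r) := by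
  obtain ⟨n, hn⟩ := h
  refine ⟨⌈n * r⌉₊, fun i => (ENNReal.rpow_le_rpow (hn i) hr).trans ?_⟩
  rw [ENNReal.mul_rpow_of_nonneg _ _ hr, ← ENNReal.rpow_natCast, ← ENNReal.rpow_mul,
    ← ENNReal.rpow_natCast]
  gcongr
  · exact one_le_a i
  · exact Nat.le_ceil _

lemma rpow_one {r : ℝ} (hr : 0 ≤ r) (h : Pol X fun _ => 1) : Pol (fun i => X i ^ r) fun _ => 1 := by
  simpa using h.rpow hr

lemma comp {κ : Type*} [Wt κ] (f : κ → ι) (hf : ∀ k, Wt.a (f k) = Wt.a k) (h : Pol X Y) :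
    Pol (fun k => X (f k)) (fun k => Y (f k)) := by
  obtain ⟨n, hn⟩ := h
  exact ⟨n, fun k => by rw [← hf]; exact hn _⟩

/-- Absorption of a square root. -/
lemma absorb (hX : ∀ i, X i ≠ ∞) (h : Pol X fun i => 1 + X i ^ (1 / 2 : ℝ)) :
    Pol X fun _ => 1 := by
  obtain ⟨n, hn⟩ := h
  refine ⟨2 * (n + 1), fun i => ?_⟩
  rcases le_total (X i) 1 with h1 | h1
  · rw [_root_.mul_one]; exact h1.trans (one_le_pow₀ (one_le_a i))
  · have h2 : 1 ≤ X i ^ (1 / 2 : ℝ) := ENNReal.one_le_rpow h1 (by norm_num)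
    have h3 : X i ^ (1 / 2 : ℝ) * X i ^ (1 / 2 : ℝ) = X i := by
      rw [← ENNReal.rpow_add_of_nonneg _ _ (by norm_num) (by norm_num)]; norm_num
    have h4 : X i ^ (1 / 2 : ℝ) * X i ^ (1 / 2 : ℝ) ≤ Wt.a i ^ (n + 1) * X i ^ (1 / 2 : ℝ) := by
      rw [h3]
      refine (hn i).trans ?_
      calc Wt.a i ^ n * (1 + X i ^ (1 / 2 : ℝ)) ≤
          Wt.a i ^ n * (X i ^ (1 / 2 : ℝ) + X i ^ (1 / 2 : ℝ)) := by gcongr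
        _ = Wt.a i ^ n * (2 * X i ^ (1 / 2 : ℝ)) := by ring
        _ ≤ Wt.a i ^ n * (Wt.a i * X i ^ (1 / 2 : ℝ)) := by gcongr; exact Wt.two_le i
        _ = _ := by rw [pow_succ]; ring
    have h5 : X i ^ (1 / 2 : ℝ) ≠ ∞ := ENNReal.rpow_ne_top_of_nonneg (by norm_num) (hX i)
    have h6 : X i ^ (1 / 2 : ℝ) ≤ Wt.a i ^ (n + 1) :=
      (ENNReal.mul_le_mul_iff_left (by positivity) h5).1 h4
    calc X i = X i ^ (1 / 2 : ℝ) * X i ^ (1 / 2 : ℝ) := h3.symm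
      _ ≤ Wt.a i ^ (n + 1) * Wt.a i ^ (n + 1) := mul_le_mul' h6 h6
      _ = _ := by rw [_root_.mul_one]; ring

end Pol

/-- A smooth divergence-free field on `ℝ³` with a weak `L³` bound. -/
structure Sl where
  /-- The size of the field. -/
  A : ℝ
  two_le : 2 ≤ A
  /-- The components of the field. -/
  v : Fin 3 → E3 → ℝ
  smooth : ∀ i, ContDiff ℝ (⊤ : ℕ∞) (v i)
  div : ∀ x, ∑ i, pd (v i) i x = 0
  weak : ∀ i l, 0 < l → volume {x | l ≤ |v i x|} ≤ ENNReal.ofReal (A ^ 3 * l ^ (-3 : ℝ))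

instance : Wt Sl where
  a s := ENNReal.ofReal s.A
  two_le s := by simpa using ENNReal.ofReal_le_ofReal s.two_le

lemma lintegral_rpow_le_of_weak {α : Type*} [MeasurableSpace α] {q : ℝ} (hq1 : 1 ≤ q)
    (hq3 : q < 3) : ∃ C : ℝ≥0∞, C ≠ ∞ ∧ ∀ (μ : Measure α) (f : α → ℝ) (W : ℝ), 0 ≤ W →
      Measurable f → (∀ x, 0 ≤ f x) →
      (∀ l, 0 < l → μ {x | l ≤ f x} ≤ ENNReal.ofReal (W * l ^ (-3 : ℝ))) →
      ∫⁻ x, ENNReal.ofReal (f x ^ q) ∂μ ≤ C * (μ univ + ENNReal.ofReal W) := by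
  have hI : ∫⁻ t in Ioi (1:ℝ), ENNReal.ofReal (t ^ (q - 4)) ≠ ∞ := by
    have h := (integrableOn_Ioi_rpow_of_lt (by linarith : q - 4 < -1) one_pos).2
    rw [hasFiniteIntegral_iff_enorm] at h
    refine (lt_of_le_of_lt (lintegral_mono fun s => ?_) h).ne
    rw [Real.enorm_eq_ofReal_abs]
    exact ENNReal.ofReal_le_ofReal (le_abs_self _)
  refine ⟨ENNReal.ofReal q * (1 + ∫⁻ t in Ioi (1:ℝ), ENNReal.ofReal (t ^ (q - 4))),
    by finiteness, fun μ f W hW hf hf0 hweak => ?_⟩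
  rw [lintegral_rpow_eq_lintegral_meas_le_mul μ (ae_of_all _ hf0) hf.aemeasurable (by linarith),
    mul_assoc]
  gcongr
  rw [← Ioc_union_Ioi_eq_Ioi (zero_le_one' ℝ)]
  refine (lintegral_union_le _ _ _).trans ?_
  have h1 : ∫⁻ t in Ioc (0:ℝ) 1, μ {a | t ≤ f a} * ENNReal.ofReal (t ^ (q - 1)) ≤ μ univ := by
    calc _ ≤ ∫⁻ t in Ioc (0:ℝ) 1, μ univ := by
          refine setLIntegral_mono' measurableSet_Ioc fun t ht => ?_
          refine (mul_le_mul' (measure_mono (subset_univ _))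
            (ENNReal.ofReal_le_one.2 (Real.rpow_le_one ht.1.le ht.2 (by linarith)))).trans_eq
            (mul_one _)
      _ = μ univ := by simp
  have h2 : ∫⁻ t in Ioi (1:ℝ), μ {a | t ≤ f a} * ENNReal.ofReal (t ^ (q - 1)) ≤
      ENNReal.ofReal W * ∫⁻ t in Ioi (1:ℝ), ENNReal.ofReal (t ^ (q - 4)) := by
    rw [← lintegral_const_mul' _ _ (by finiteness)]
    refine setLIntegral_mono' measurableSet_Ioi fun t ht => ?_
    have ht0 : 0 < t := lt_trans one_pos ht
    refine (mul_le_mul' (hweak t ht0) le_rfl).trans_eq ?_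
    rw [ENNReal.ofReal_mul hW, mul_assoc, ← ENNReal.ofReal_mul (by positivity),
      ← Real.rpow_add ht0]
    ring_nf
  calc _ ≤ μ univ + ENNReal.ofReal W * ∫⁻ t in Ioi (1:ℝ), ENNReal.ofReal (t ^ (q - 4)) :=
        add_le_add h1 h2
    _ ≤ (μ univ + ENNReal.ofReal W) + (μ univ + ENNReal.ofReal W) *
        ∫⁻ t in Ioi (1:ℝ), ENNReal.ofReal (t ^ (q - 4)) := by
        gcongr
        · exact le_self_add
        · exact le_add_self
    _ = _ := by ring

lemma enorm_rpow_eq (x q : ℝ) (hq : 0 ≤ q) : ‖x‖ₑ ^ q = ENNReal.ofReal (|x| ^ q) := by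
  rw [Real.enorm_eq_ofReal_abs, ENNReal.ofReal_rpow_of_nonneg (abs_nonneg _) hq]

/-- Local integrability below the weak exponent. -/
lemma Sl.Np_mul_le {φ : E3 → ℝ} (hφ : CS φ) (i : Fin 3) {q : ℝ} (hq1 : 1 ≤ q) (hq3 : q < 3) :
    Pol (fun s : Sl => Np q (fun x => φ x * s.v i x)) fun _ => 1 := by
  obtain ⟨C, hC, h⟩ := lintegral_rpow_le_of_weak (α := E3) hq1 hq3
  obtain ⟨M, hM⟩ := hφ.bdd
  set K := tsupport φ
  have hK : IsCompact K := hφ.2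
  have hq0 : 0 ≤ q := by linarith
  have h1 : ∀ s : Sl, Np q (fun x => φ x * s.v i x) ≤
      (ENNReal.ofReal M ^ q * C) * (volume K + Wt.a s * (Wt.a s * Wt.a s)) := by
    intro s
    have h2 : Np q (fun x => φ x * s.v i x) ≤
        ENNReal.ofReal M ^ q * ∫⁻ x in K, ENNReal.ofReal (|s.v i x| ^ q) := by
      rw [← lintegral_const_mul' _ _ (by finiteness), ← lintegral_indicator hK.measurableSet]
      refine lintegral_mono fun x => ?_
      by_cases hx : x ∈ K
      · rw [indicator_of_mem hx, ← enorm_rpow_eq _ _ hq0, enorm_mul,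
          ENNReal.mul_rpow_of_nonneg _ _ hq0]
        gcongr
        rw [Real.enorm_eq_ofReal_abs]
        exact ENNReal.ofReal_le_ofReal (hM x)
      · have hx0 : φ x = 0 := image_eq_zero_of_notMem_tsupport hx
        simp [hx0, ENNReal.zero_rpow_of_pos (by linarith : 0 < q)]
    refine h2.trans ?_
    rw [mul_assoc]
    gcongr
    refine (h (volume.restrict K) (fun x => |s.v i x|) (s.A ^ 3) (by have := s.two_le; positivity)
      (s.smooth i).continuous.abs.measurable (fun _ => abs_nonneg _) fun l hl => ?_).trans ?_
    · exact (Measure.restrict_apply_le _ _).trans (s.weak i l hl)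
    · rw [Measure.restrict_apply_univ]
      have hA0 : 0 ≤ s.A := by linarith [s.two_le]
      have : ENNReal.ofReal (s.A ^ 3) = Wt.a s * (Wt.a s * Wt.a s) := by
        change _ = ENNReal.ofReal s.A * (ENNReal.ofReal s.A * ENNReal.ofReal s.A)
        rw [ENNReal.ofReal_pow hA0]; ring
      rw [this]
  refine Pol.mono_left h1 (Pol.const_mul (by finiteness) (Pol.add (Pol.const ?_) ?_))
  · exact hK.measure_lt_top.ne
  · exact Pol.wt.mul_one (Pol.wt.mul_one Pol.wt)

lemma exists_cut {φ : E3 → ℝ} (hφ : CS φ) :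
    ∃ η : E3 → ℝ, CS η ∧ (∀ x, |η x| ≤ 1) ∧ ∀ x ∈ tsupport φ, η x = 1 := by
  obtain ⟨R, hR0, hR⟩ := hφ.2.isBounded.subset_closedBall_lt 0 0
  let b : ContDiffBump (0 : E3) := ⟨R, R + 1, hR0, by linarith⟩
  exact ⟨b, ⟨b.contDiff, b.hasCompactSupport⟩, fun x => by
    rw [abs_of_nonneg b.nonneg]; exact b.le_one, fun x hx => b.one_of_mem_closedBall (hR hx)⟩

lemma enorm_integral_mul_le {f g : E3 → ℝ} (hf : Measurable f) (hg : Measurable g) {p q : ℝ}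
    (hpq : p.HolderConjugate q) :
    ‖∫ x, f x * g x‖ₑ ≤ Np p f ^ (1 / p) * Np q g ^ (1 / q) := by
  refine (enorm_integral_le_lintegral_enorm _).trans ?_
  simp only [enorm_mul]
  exact ENNReal.lintegral_mul_le_Lp_mul_Lq _ hpq hf.enorm.aemeasurable hg.enorm.aemeasurable

lemma enorm_integral_mul_three_le {f g h : E3 → ℝ} (hf : Measurable f) (hg : Measurable g)
    (hh : Measurable h) {p q r : ℝ} (hp : 0 < p) (hq : 0 < q) (hr : 0 < r)
    (hpq : 1 / p + 1 / q + 1 / r = 1) :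
    ‖∫ x, f x * g x * h x‖ₑ ≤ Np p f ^ (1 / p) * Np q g ^ (1 / q) * Np r h ^ (1 / r) := by
  refine (enorm_integral_le_lintegral_enorm _).trans ?_
  have h1 := lintegral_holder_three (volume : Measure E3) (f := fun x => ‖f x‖ₑ ^ p)
    (g := fun x => ‖g x‖ₑ ^ q) (h := fun x => ‖h x‖ₑ ^ r)
    (hf.enorm.pow_const _).aemeasurable (hg.enorm.pow_const _).aemeasurable
    (hh.enorm.pow_const _).aemeasurable (a := 1 / p) (b := 1 / q) (c := 1 / r)
    (by positivity) (by positivity) (by positivity) hpq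
  simp only [← ENNReal.rpow_mul, mul_one_div_cancel hp.ne', mul_one_div_cancel hq.ne',
    mul_one_div_cancel hr.ne', ENNReal.rpow_one] at h1
  simp only [enorm_mul]
  exact h1

/-- The `L^p` norm. -/
def nm (p : ℝ) (g : E3 → ℝ) : ℝ≥0∞ := Np p g ^ (1 / p)

lemma nm_add_le {p : ℝ} (hp : 1 ≤ p) {f g : E3 → ℝ} (hf : Measurable f) (hg : Measurable g) :
    nm p (fun x => f x + g x) ≤ nm p f + nm p g := by
  refine le_trans ?_ (ENNReal.lintegral_Lp_add_le hf.enorm.aemeasurable hg.enorm.aemeasurable hp)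
  refine ENNReal.rpow_le_rpow (lintegral_mono fun x => ENNReal.rpow_le_rpow ?_ (by linarith))
    (by positivity)
  exact enorm_add_le _ _

lemma nm_neg (p : ℝ) (f : E3 → ℝ) : nm p (fun x => - f x) = nm p f := by rw [nm, Np_neg]; rfl

lemma nm_sub_le {p : ℝ} (hp : 1 ≤ p) {f g : E3 → ℝ} (hf : Measurable f) (hg : Measurable g) :
    nm p (fun x => f x - g x) ≤ nm p f + nm p g := by
  simp only [sub_eq_add_neg]
  refine (nm_add_le hp hf hg.neg).trans_eq ?_
  rw [← nm_neg p g]; rfl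

lemma nm_zero {p : ℝ} (hp : 0 < p) : nm p (fun _ => 0) = 0 := by
  simp [nm, Np, ENNReal.zero_rpow_of_pos hp, hp]

lemma nm_sum_le {p : ℝ} (hp : 1 ≤ p) {κ : Type*} (s : Finset κ) {f : κ → E3 → ℝ}
    (hf : ∀ k ∈ s, Measurable (f k)) : nm p (fun x => ∑ k ∈ s, f k x) ≤ ∑ k ∈ s, nm p (f k) := by
  classical
  induction s using Finset.induction_on with
  | empty => simp [nm_zero (by linarith : 0 < p)]
  | insert k s hk ih =>
    simp only [Finset.sum_insert hk]
    refine (nm_add_le hp (hf k (by simp))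
      (Finset.measurable_fun_sum s fun l hl => hf l (by simp [hl]))).trans ?_
    gcongr
    exact ih fun l hl => hf l (by simp [hl])

/-- Smooth bounded integrable functions. -/
structure IB (g : E3 → ℝ) : Prop where
  smooth : ContDiff ℝ (⊤ : ℕ∞) g
  integrable : Integrable g
  bdd : ∃ C, ∀ x, |g x| ≤ C

lemma IB.measurable {g : E3 → ℝ} (hg : IB g) : Measurable g := hg.smooth.continuous.measurable

lemma IB.mul_integrable {f g : E3 → ℝ} (hf : IB f) (hg : IB g) :
    Integrable fun x => f x * g x := by
  obtain ⟨C, hC⟩ := hg.bdd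
  exact hf.integrable.mul_bdd (c := C) hg.measurable.aestronglyMeasurable (ae_of_all _ hC)

lemma IB.sub {f g : E3 → ℝ} (hf : IB f) (hg : IB g) : IB fun x => f x - g x := by
  obtain ⟨C, hC⟩ := hf.bdd
  obtain ⟨D, hD⟩ := hg.bdd
  exact ⟨hf.smooth.sub hg.smooth, hf.integrable.sub hg.integrable, C + D, fun x =>
    (abs_sub _ _).trans (add_le_add (hC x) (hD x))⟩

lemma CS.IB {g : E3 → ℝ} (hg : CS g) : IB g := ⟨hg.1, hg.integrable, hg.bdd⟩

lemma CS.G_IB {g : E3 → ℝ} (hg : CS g) : _root_.IB (G g) :=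
  ⟨GK_contDiff gk_GP (by norm_num) hg, GK_integrable gk_GP (by norm_num) hg,
    GK_bdd gk_GP (by norm_num) hg⟩

lemma CS.P1_IB {g : E3 → ℝ} (hg : CS g) : _root_.IB (P1 g) := by
  refine ⟨Ker_contDiff gk_GP 1 hg, Ker_integrable gk_GP 1 hg, ?_⟩
  obtain ⟨C, hC⟩ := hg.bdd
  exact ⟨_, fun x => Av_abs_le gk_GP.integrable hC x⟩

lemma pd_G {g : E3 → ℝ} (hg : CS g) (i : Fin 3) : pd (G g) i = G (pd g i) :=
  GK_pd_comm gk_GP (by norm_num) hg i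

lemma pd_P1 {g : E3 → ℝ} (hg : CS g) (i : Fin 3) : pd (P1 g) i = P1 (pd g i) :=
  Ker_pd_comm gk_GP 1 hg i

lemma IB.integral_mul_pd {f g : E3 → ℝ} (hf : IB f) (hg : IB g) (i : Fin 3) (hf' : IB (pd f i))
    (hg' : IB (pd g i)) : ∫ x, f x * pd g i x = - ∫ x, pd f i x * g x :=
  _root_.integral_mul_pd i (hf.smooth.differentiable (by simp)) (hg.smooth.differentiable (by simp))
    (hf'.mul_integrable hg) (hf.mul_integrable hg') (hf.mul_integrable hg)

lemma IB.Np_two {g : E3 → ℝ} (hg : IB g) : Np 2 g = ENNReal.ofReal (∫ x, g x * g x) := by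
  rw [ofReal_integral_eq_lintegral_ofReal (hg.mul_integrable hg)
    (ae_of_all _ fun x => mul_self_nonneg _)]
  refine lintegral_congr fun x => ?_
  rw [enorm_rpow_eq _ _ (by norm_num)]
  congr 1
  rw [Real.rpow_two, sq_abs, sq]

lemma nm_two_sq (g : E3 → ℝ) : nm 2 g * nm 2 g = Np 2 g := by
  unfold nm
  rw [← ENNReal.rpow_add_of_nonneg _ _ (by norm_num) (by norm_num)]; norm_num

lemma rpow_Np_div {p r : ℝ} (hr : 0 < r) (g : E3 → ℝ) :
    (Np p g ^ (r / p)) ^ (1 / r) = nm p g := by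
  rw [← ENNReal.rpow_mul, nm]
  congr 1
  field_simp

lemma nm_G_le {p : ℝ} (hp : 1 ≤ p) : ∃ C : ℝ≥0∞, C ≠ ∞ ∧ ∀ g, CS g → nm p (G g) ≤ C * nm p g ∧
    nm p (P1 g) ≤ C * nm p g ∧ ∀ i, nm p (G (pd g i)) ≤ C * nm p g ∧
      nm p (P1 (pd g i)) ≤ C * nm p g := by
  have hp0 : 0 ≤ 1 / p := by positivity
  obtain ⟨C₁, h1, H1⟩ := Np_GK_le gk_GP (a := 0) (by norm_num) hp
  obtain ⟨C₂, h2, H2⟩ := Np_Ker_le gk_GP hp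
  choose C₃ h3 H3 using fun i => Np_GK_le (gk_GP.dpd i) (a := 0 + 1 / 2) (by norm_num) hp
  choose C₄ h4 H4 using fun i => Np_Ker_le (gk_GP.dpd i) hp
  have key : ∀ {C : ℝ≥0∞} {f g : E3 → ℝ}, Np p f ≤ C * Np p g → C ≤ C₁ + C₂ + ∑ i, C₃ i + ∑ i, C₄ i →
      nm p f ≤ (C₁ + C₂ + ∑ i, C₃ i + ∑ i, C₄ i) ^ (1 / p) * nm p g := by
    intro C f g h hC
    unfold nm
    rw [← ENNReal.mul_rpow_of_nonneg _ _ hp0]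
    exact ENNReal.rpow_le_rpow (h.trans (by gcongr)) hp0
  refine ⟨(C₁ + C₂ + ∑ i, C₃ i + ∑ i, C₄ i) ^ (1 / p), ENNReal.rpow_ne_top_of_nonneg hp0 ?_,
    fun g hg => ⟨key (H1 g hg) ?_, key (H2 g hg 1) ?_, fun i => ⟨?_, ?_⟩⟩⟩
  · have := fun i => (h3 i).ne
    have := fun i => (h4 i).ne
    simp [h1.ne, h2.ne, *]
  · rw [add_assoc, add_assoc]; exact le_self_add
  · rw [add_comm C₁, add_assoc, add_assoc]; exact le_self_add
  · refine key (C := C₃ i) ?_ ?_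
    · have : G (pd g i) = GK (0 + 1 / 2) (pd gk i) g :=
        funext fun x => GK_pd gk_GP (by norm_num) hg i x
      rw [this]; exact H3 i g hg
    · refine le_trans ?_ (le_self_add)
      exact (Finset.single_le_sum (f := C₃) (fun _ _ => zero_le) (Finset.mem_univ i)).trans
        le_add_self
  · refine key (C := C₄ i) ?_ ?_
    · have : P1 (pd g i) = Ker (pd gk i) 1 g := by
        funext x
        have := Ker_pd gk_GP one_pos hg i x
        simpa [P1] using this
      rw [this]; exact H4 i g hg 1
    · exact (Finset.single_le_sum (f := C₄) (fun _ _ => zero_le) (Finset.mem_univ i)).trans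
        le_add_self

lemma young_G {p r : ℝ} (hp : 0 < p) (hr : 4 / 3 ≤ r) (hpr : 1 / r = 1 / p - 1 / 4) :
    ∃ C : ℝ≥0∞, C ≠ ∞ ∧ ∀ g, CS g → nm r (G g) ≤ C * nm p g ∧ nm r (P1 g) ≤ C * nm p g ∧
      ∀ i, nm r (G (pd g i)) ≤ C * nm p g := by
  have hr0 : 0 < r := by linarith
  have hp0 : 0 ≤ 1 / r := by positivity
  obtain ⟨C₁, h1, H1⟩ := young_GK gk_GP (a := 0) (by norm_num) hp hr hpr
  obtain ⟨C₂, h2, H2⟩ := young_Ker_one gk_GP hp hr hpr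
  choose C₃ h3 H3 using fun i => young_GK (gk_GP.dpd i) (a := 0 + 1 / 2) (by norm_num) hp hr hpr
  have key : ∀ {C : ℝ≥0∞} {f g : E3 → ℝ}, Np r f ≤ C * Np p g ^ (r / p) →
      C ≤ C₁ + C₂ + ∑ i, C₃ i → nm r f ≤ (C₁ + C₂ + ∑ i, C₃ i) ^ (1 / r) * nm p g := by
    intro C f g h hC
    rw [← rpow_Np_div (p := p) hr0 g, ← ENNReal.mul_rpow_of_nonneg _ _ hp0]
    exact ENNReal.rpow_le_rpow (h.trans (by gcongr)) hp0
  refine ⟨(C₁ + C₂ + ∑ i, C₃ i) ^ (1 / r), ENNReal.rpow_ne_top_of_nonneg hp0 ?_,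
    fun g hg => ⟨key (H1 g hg) ?_, key (H2 g hg) ?_, fun i => ?_⟩⟩
  · have := fun i => (h3 i).ne
    simp [h1.ne, h2.ne, *]
  · rw [add_assoc]; exact le_self_add
  · rw [add_comm C₁, add_assoc]; exact le_self_add
  · refine key (C := C₃ i) ?_ ?_
    · have : G (pd g i) = GK (0 + 1 / 2) (pd gk i) g :=
        funext fun x => GK_pd gk_GP (by norm_num) hg i x
      rw [this]; exact H3 i g hg
    · exact (Finset.single_le_sum (f := C₃) (fun _ _ => zero_le) (Finset.mem_univ i)).trans
        le_add_self

/-- The Hessian of `G f` is controlled by `f` in `L²`. -/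
lemma nm_pd_pd_G_le : ∃ C : ℝ≥0∞, C ≠ ∞ ∧ ∀ f, CS f → ∀ i l,
    nm 2 (G (pd (pd f i) l)) ≤ C * nm 2 f := by
  obtain ⟨C, hC, H⟩ := nm_G_le (p := 2) (by norm_num)
  refine ⟨C + 1, by finiteness, fun f hf i l => ?_⟩
  have hlap : nm 2 (lap (G f)) ≤ (C + 1) * nm 2 f := by
    have : lap (G f) = fun x => P1 f x - f x := funext fun x => lap_G hf x
    rw [this]
    refine (nm_sub_le (by norm_num) hf.P1_IB.measurable hf.continuous.measurable).trans ?_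
    rw [add_mul, one_mul]
    gcongr
    exact (H f hf).2.1
  refine le_trans ?_ hlap
  unfold nm
  refine ENNReal.rpow_le_rpow ?_ (by norm_num)
  have hlapIB : IB (lap (G f)) := by
    have : lap (G f) = fun x => P1 f x - f x := funext fun x => lap_G hf x
    rw [this]
    exact hf.P1_IB.sub hf.IB
  rw [((hf.dpd i).dpd l).G_IB.Np_two, hlapIB.Np_two]
  refine ENNReal.ofReal_le_ofReal ?_
  have ibp : ∀ {g h : E3 → ℝ}, CS g → CS h → ∀ i,
      ∫ x, G g x * G (pd h i) x = - ∫ x, G (pd g i) x * G h x := by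
    intro g h hg hh i
    have := hg.G_IB.integral_mul_pd hh.G_IB i (by rw [pd_G hg]; exact (hg.dpd i).G_IB)
      (by rw [pd_G hh]; exact (hh.dpd i).G_IB)
    rwa [pd_G hg, pd_G hh] at this
  have hcomm : ∀ i l, pd (pd f i) l = pd (pd f l) i := fun i l => pd_comm hf.1 i l
  have e1 : ∀ i l, ∫ x, G (pd (pd f i) l) x * G (pd (pd f i) l) x =
      ∫ x, G (pd (pd f i) i) x * G (pd (pd f l) l) x := by
    intro i l
    rw [ibp ((hf.dpd i).dpd l) (hf.dpd i) l]
    have : pd (pd (pd f i) l) l = pd (pd (pd f l) l) i := by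
      rw [hcomm i l, pd_comm (hf.dpd l).1 i l]
    rw [this]
    have h2 := ibp (hf.dpd i) ((hf.dpd l).dpd l) i
    have h3 : ∀ a b : E3 → ℝ, ∫ x, a x * b x = ∫ x, b x * a x := fun a b => by
      simp only [mul_comm]
    rw [h3, h2, neg_neg]
  have e2 : ∫ x, lap (G f) x * lap (G f) x = ∑ i, ∑ l, ∫ x, G (pd (pd f i) l) x * G (pd (pd f i) l) x := by
    simp only [e1]
    have : ∀ x, lap (G f) x * lap (G f) x =
        ∑ i, ∑ l, G (pd (pd f i) i) x * G (pd (pd f l) l) x := by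
      intro x
      have : lap (G f) x = ∑ i, G (pd (pd f i) i) x := by
        change ∑ i, pd (pd (G f) i) i x = _
        refine Finset.sum_congr rfl fun i _ => ?_
        rw [pd_G hf, pd_G (hf.dpd i)]
      rw [this, Finset.sum_mul_sum]
    simp only [this]
    rw [integral_finsetSum _ fun i _ => integrable_finsetSum _ fun l _ =>
      ((hf.dpd i).dpd i).G_IB.mul_integrable ((hf.dpd l).dpd l).G_IB]
    refine Finset.sum_congr rfl fun i _ => ?_
    rw [integral_finsetSum _ fun l _ =>
      ((hf.dpd i).dpd i).G_IB.mul_integrable ((hf.dpd l).dpd l).G_IB]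
  rw [e2]
  have hnn : ∀ i l, 0 ≤ ∫ x, G (pd (pd f i) l) x * G (pd (pd f i) l) x := fun i l =>
    integral_nonneg fun x => mul_self_nonneg _
  exact (Finset.single_le_sum (f := fun l => ∫ x, G (pd (pd f i) l) x * G (pd (pd f i) l) x)
    (fun l _ => hnn i l) (Finset.mem_univ l)).trans (Finset.single_le_sum
    (f := fun i => ∑ l, ∫ x, G (pd (pd f i) l) x * G (pd (pd f i) l) x)
    (fun i _ => Finset.sum_nonneg fun l _ => hnn i l) (Finset.mem_univ i))

lemma G_sub {f g : E3 → ℝ} (hf : CS f) (hg : CS g) :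
    G (fun x => f x - g x) = fun x => G f x - G g x :=
  funext fun x => Av_sub (GK_weight gk_GP (a := 0) (by norm_num)) measurable_sqrt_smul' hf hg x

lemma P1_sub {f g : E3 → ℝ} (hf : CS f) (hg : CS g) :
    P1 (fun x => f x - g x) = fun x => P1 f x - P1 g x :=
  funext fun x => Av_sub gk_GP.integrable (measurable_sqrt_smul 1) hf hg x

lemma G_neg (f : E3 → ℝ) : G (fun x => - f x) = fun x => - G f x :=
  funext fun x => Av_neg x

lemma G_sum {κ : Type*} {s : Finset κ} {f : κ → E3 → ℝ} (hf : ∀ i ∈ s, CS (f i)) :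
    G (fun x => ∑ i ∈ s, f i x) = fun x => ∑ i ∈ s, G (f i) x :=
  funext fun x => Av_sum (GK_weight gk_GP (a := 0) (by norm_num)) measurable_sqrt_smul' hf x

namespace Sl
variable {φ : E3 → ℝ}

/-- A localized component of the field. -/
def w (s : Sl) (φ : E3 → ℝ) (k : Fin 3) (x : E3) : ℝ := φ x * s.v k x

/-- The components of the vorticity. -/
def Om (s : Sl) (j k : Fin 3) (x : E3) : ℝ := pd (s.v k) j x - pd (s.v j) k x

/-- The localized vorticity. -/
def vf (s : Sl) (φ : E3 → ℝ) (j k : Fin 3) (x : E3) : ℝ := φ x * s.Om j k x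

/-- The commutator of localization and curl. -/
def cm (s : Sl) (φ : E3 → ℝ) (j k : Fin 3) (x : E3) : ℝ := s.w (pd φ j) k x - s.w (pd φ k) j x

lemma diff (s : Sl) (k : Fin 3) : Differentiable ℝ (s.v k) := (s.smooth k).differentiable (by simp)

lemma w_CS (s : Sl) (hφ : CS φ) (k : Fin 3) : CS (s.w φ k) := by
  have h : CS fun x => φ x * s.v k x := by simpa only [mul_comm] using CS.mul (s.smooth k) hφ
  exact h

lemma Om_smooth (s : Sl) (j k : Fin 3) : ContDiff ℝ (⊤ : ℕ∞) (s.Om j k) :=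
  (contDiff_pd (s.smooth k) j).sub (contDiff_pd (s.smooth j) k)

lemma vf_CS (s : Sl) (hφ : CS φ) (j k : Fin 3) : CS (s.vf φ j k) := by
  have h : CS fun x => φ x * s.Om j k x := by
    simpa only [mul_comm] using CS.mul (s.Om_smooth j k) hφ
  exact h

lemma cm_CS (s : Sl) (hφ : CS φ) (j k : Fin 3) : CS (s.cm φ j k) :=
  (s.w_CS (hφ.dpd j) k).sub (s.w_CS (hφ.dpd k) j)

lemma pd_w (s : Sl) (hφ : CS φ) (k j : Fin 3) (x : E3) :
    pd (s.w φ k) j x = s.w (pd φ j) k x + φ x * pd (s.v k) j x :=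
  pd_mul (hφ.differentiable x) (s.diff k x) j

lemma vf_eq (s : Sl) (hφ : CS φ) (j k : Fin 3) :
    s.vf φ j k = fun x => (pd (s.w φ k) j x - pd (s.w φ j) k x) - s.cm φ j k x := by
  funext x
  rw [s.pd_w hφ, s.pd_w hφ, vf, Om, cm]
  ring

lemma Om_neg (s : Sl) (j k : Fin 3) (x : E3) : s.Om k j x = - s.Om j k x := by
  unfold Om; ring

lemma nm_w (hφ : CS φ) (k : Fin 3) {q : ℝ} (hq1 : 1 ≤ q) (hq3 : q < 3) :
    Pol (fun s : Sl => nm q (s.w φ k)) fun _ => 1 :=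
  (Np_mul_le hφ k hq1 hq3).rpow_one (by positivity)

lemma nm_cm (hφ : CS φ) (j k : Fin 3) {q : ℝ} (hq1 : 1 ≤ q) (hq3 : q < 3) :
    Pol (fun s : Sl => nm q (s.cm φ j k)) fun _ => 1 :=
  Pol.mono_left (fun s => nm_sub_le hq1 (s.w_CS (hφ.dpd j) k).continuous.measurable
    (s.w_CS (hφ.dpd k) j).continuous.measurable)
    ((nm_w (hφ.dpd j) k hq1 hq3).add (nm_w (hφ.dpd k) j hq1 hq3))

lemma nm_G_vf (hφ : CS φ) (j k : Fin 3) :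
    Pol (fun s : Sl => nm 2 (G (s.vf φ j k)) + nm 2 (P1 (s.vf φ j k))) fun _ => 1 := by
  obtain ⟨C, hC, H⟩ := nm_G_le (p := 2) (by norm_num)
  refine Pol.mono_left (Y := fun s : Sl => C * nm 2 (s.w φ k) + C * nm 2 (s.w φ j) +
    C * nm 2 (s.cm φ j k) + (C * nm 2 (s.w φ k) + C * nm 2 (s.w φ j) +
    C * nm 2 (s.cm φ j k))) (fun s => ?_) ?_
  · have h1 := (s.w_CS hφ k).dpd j
    have h2 := (s.w_CS hφ j).dpd k
    have h3 := s.cm_CS hφ j k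
    gcongr
    · rw [s.vf_eq hφ, G_sub (h1.sub h2) h3, G_sub h1 h2]
      refine (nm_sub_le (by norm_num) (h1.G_IB.sub h2.G_IB).measurable h3.G_IB.measurable).trans ?_
      refine add_le_add ((nm_sub_le (by norm_num) h1.G_IB.measurable h2.G_IB.measurable).trans
        (add_le_add ?_ ?_)) ?_
      exacts [((H _ (s.w_CS hφ k)).2.2 j).1, ((H _ (s.w_CS hφ j)).2.2 k).1, (H _ h3).1]
    · rw [s.vf_eq hφ, P1_sub (h1.sub h2) h3, P1_sub h1 h2]
      refine (nm_sub_le (by norm_num) (h1.P1_IB.sub h2.P1_IB).measurable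
        h3.P1_IB.measurable).trans ?_
      refine add_le_add ((nm_sub_le (by norm_num) h1.P1_IB.measurable h2.P1_IB.measurable).trans
        (add_le_add ?_ ?_)) ?_
      exacts [((H _ (s.w_CS hφ k)).2.2 j).2, ((H _ (s.w_CS hφ j)).2.2 k).2, (H _ h3).2.1]
  · have a1 := (nm_w hφ k (q := 2) (by norm_num) (by norm_num)).const_mul hC
    have a2 := (nm_w hφ j (q := 2) (by norm_num) (by norm_num)).const_mul hC
    have a3 := (nm_cm hφ j k (q := 2) (by norm_num) (by norm_num)).const_mul hC
    exact ((a1.add a2).add a3).add ((a1.add a2).add a3)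

/-- Sobolev norm of order one. -/
def _root_.H1 (Y : E3 → ℝ) : ℝ≥0∞ := nm 2 Y + ∑ i, nm 2 (pd Y i)

lemma integral_w_pd (hφ : CS φ) (k j : Fin 3) : ∃ n : ℕ, ∀ (s : Sl) (Y : E3 → ℝ),
    ContDiff ℝ (⊤ : ℕ∞) Y →
    ‖∫ x, s.v k x * pd (fun x => φ x * Y x) j x‖ₑ ≤ Wt.a s ^ n * H1 Y := by
  let ι := Sl × {Y : E3 → ℝ // ContDiff ℝ (⊤ : ℕ∞) Y}
  suffices h : Pol (fun q : ι => ‖∫ x, q.1.v k x * pd (fun x => φ x * q.2.1 x) j x‖ₑ)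
      fun q => H1 q.2.1 by
    obtain ⟨n, hn⟩ := h
    exact ⟨n, fun s Y hY => hn (s, ⟨Y, hY⟩)⟩
  have hw : ∀ {ψ : E3 → ℝ}, CS ψ → Pol (fun q : ι => nm 2 (q.1.w ψ k)) fun _ => 1 := fun hψ =>
    (nm_w hψ k (by norm_num) (by norm_num)).comp (fun q : ι => q.1) fun _ => rfl
  refine Pol.mono_left (Y := fun q : ι => nm 2 (q.1.w (pd φ j) k) * nm 2 q.2.1 +
    nm 2 (q.1.w φ k) * nm 2 (pd q.2.1 j)) (fun q => ?_) ?_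
  · obtain ⟨s, Y, hY⟩ := q
    have hYd : Differentiable ℝ Y := hY.differentiable (by simp)
    have e : ∀ x, s.v k x * pd (fun x => φ x * Y x) j x =
        s.w (pd φ j) k x * Y x + s.w φ k x * pd Y j x := by
      intro x
      rw [pd_mul (hφ.differentiable x) (hYd x)]
      unfold w; ring
    have c1 := s.w_CS (hφ.dpd j) k
    have c2 := s.w_CS hφ k
    have i1 : Integrable fun x => s.w (pd φ j) k x * Y x := by
      have := (CS.mul hY c1).integrable
      simpa only [mul_comm] using this
    have i2 : Integrable fun x => s.w φ k x * pd Y j x := by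
      have := (CS.mul (contDiff_pd hY j) c2).integrable
      simpa only [mul_comm] using this
    simp only [e]
    rw [integral_add i1 i2]
    refine (enorm_add_le _ _).trans (add_le_add ?_ ?_)
    · exact enorm_integral_mul_le c1.continuous.measurable hY.continuous.measurable
        Real.HolderConjugate.two_two
    · exact enorm_integral_mul_le c2.continuous.measurable
        (contDiff_pd hY j).continuous.measurable Real.HolderConjugate.two_two
  · refine Pol.add ?_ ?_
    · exact ((hw (hφ.dpd j)).one_mul (Pol.refl _)).mono_right fun q => le_self_add
    · refine ((hw hφ).one_mul (Pol.refl _)).mono_right fun q => ?_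
      exact (Finset.single_le_sum (f := fun i => nm 2 (pd q.2.1 i)) (fun _ _ => zero_le)
        (Finset.mem_univ j)).trans le_add_self

lemma integral_vf_mul (s : Sl) (hφ : CS φ) (j k : Fin 3) {Y : E3 → ℝ}
    (hY : ContDiff ℝ (⊤ : ℕ∞) Y) : ∫ x, s.vf φ j k x * Y x =
      (∫ x, s.v j x * pd (fun x => φ x * Y x) k x) - ∫ x, s.v k x * pd (fun x => φ x * Y x) j x := by
  have hZ : CS fun x => φ x * Y x := by simpa only [mul_comm] using CS.mul hY hφ
  rw [CS.integral_mul_pd k (s.smooth j) hZ, CS.integral_mul_pd j (s.smooth k) hZ,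
    sub_neg_eq_add, neg_add_eq_sub, ← integral_sub (CS.mul (contDiff_pd (s.smooth k) j) hZ).integrable
    (CS.mul (contDiff_pd (s.smooth j) k) hZ).integrable]
  congr 1; funext x
  unfold vf Om; ring

/-- Pairing the localized vorticity with a function in `H¹`. -/
lemma integral_vf_mul_le (hφ : CS φ) (j k : Fin 3) : ∃ n : ℕ, ∀ (s : Sl) (Y : E3 → ℝ),
    ContDiff ℝ (⊤ : ℕ∞) Y → ‖∫ x, s.vf φ j k x * Y x‖ₑ ≤ Wt.a s ^ n * H1 Y := by
  let ι := Sl × {Y : E3 → ℝ // ContDiff ℝ (⊤ : ℕ∞) Y}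
  suffices h : Pol (fun q : ι => ‖∫ x, q.1.vf φ j k x * q.2.1 x‖ₑ) fun q => H1 q.2.1 by
    obtain ⟨n, hn⟩ := h
    exact ⟨n, fun s Y hY => hn (s, ⟨Y, hY⟩)⟩
  obtain ⟨n, hn⟩ := integral_w_pd hφ j k
  obtain ⟨m, hm⟩ := integral_w_pd hφ k j
  refine Pol.mono_left (fun q : ι => ?_) (Pol.add ⟨n, fun q : ι => hn q.1 q.2.1 q.2.2⟩
    ⟨m, fun q : ι => hm q.1 q.2.1 q.2.2⟩)
  rw [q.1.integral_vf_mul hφ j k q.2.2]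
  exact enorm_sub_le

/-- The potential of the localized vorticity is bounded in `H¹`. -/
lemma H1_G_vf (hφ : CS φ) (j k : Fin 3) : Pol (fun s : Sl => H1 (G (s.vf φ j k))) fun _ => 1 := by
  have h0 := nm_G_vf hφ j k
  have hB : Pol (fun s : Sl => nm 2 (G (s.vf φ j k))) fun _ => 1 :=
    h0.mono_left fun s => le_self_add
  have hP : Pol (fun s : Sl => nm 2 (P1 (s.vf φ j k))) fun _ => 1 :=
    h0.mono_left fun s => le_add_self
  refine hB.add ?_
  set N : Sl → ℝ≥0∞ := fun s => ∑ i, Np 2 (pd (G (s.vf φ j k)) i) with hN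
  have hIB : ∀ (s : Sl) i, IB (pd (G (s.vf φ j k)) i) := fun s i => by
    rw [pd_G (s.vf_CS hφ j k)]; exact ((s.vf_CS hφ j k).dpd i).G_IB
  have hsingle : ∀ (s : Sl) i, nm 2 (pd (G (s.vf φ j k)) i) ≤ N s ^ (1 / 2 : ℝ) := fun s i =>
    ENNReal.rpow_le_rpow (Finset.single_le_sum (f := fun i => Np 2 (pd (G (s.vf φ j k)) i))
      (fun _ _ => zero_le) (Finset.mem_univ i)) (by norm_num)
  have hNle : ∀ s : Sl, N s ≤ ‖∫ x, s.vf φ j k x * G (s.vf φ j k) x‖ₑ +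
      ‖∫ x, P1 (s.vf φ j k) x * G (s.vf φ j k) x‖ₑ := by
    intro s
    set f := s.vf φ j k with hf
    have hfC : CS f := s.vf_CS hφ j k
    have e1 : N s = ENNReal.ofReal (∑ i, ∫ x, pd (G f) i x * pd (G f) i x) := by
      rw [ENNReal.ofReal_sum_of_nonneg fun i _ => integral_nonneg fun x => mul_self_nonneg _]
      exact Finset.sum_congr rfl fun i _ => (hIB s i).Np_two
    have e2 : ∀ i, ∫ x, pd (G f) i x * pd (G f) i x = - ∫ x, pd (pd (G f) i) i x * G f x := by
      intro i
      have h2 : IB (pd (pd (G f) i) i) := by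
        rw [pd_G hfC, pd_G (hfC.dpd i)]; exact ((hfC.dpd i).dpd i).G_IB
      exact (hIB s i).integral_mul_pd hfC.G_IB i h2 (hIB s i)
    have e3 : ∑ i, ∫ x, pd (G f) i x * pd (G f) i x =
        (∫ x, f x * G f x) - ∫ x, P1 f x * G f x := by
      simp only [e2]
      rw [Finset.sum_neg_distrib, ← integral_finsetSum, ← integral_sub
        (hfC.IB.mul_integrable hfC.G_IB) (hfC.P1_IB.mul_integrable hfC.G_IB), ← integral_neg]
      · congr 1; funext x
        rw [← Finset.sum_mul]
        have := lap_G hfC x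
        have h' : ∑ i, pd (pd (G f) i) i x = P1 f x - f x := this
        rw [h']; ring
      · intro i _
        have h2 : IB (pd (pd (G f) i) i) := by
          rw [pd_G hfC, pd_G (hfC.dpd i)]; exact ((hfC.dpd i).dpd i).G_IB
        exact h2.mul_integrable hfC.G_IB
    rw [e1, e3]
    refine le_trans ?_ enorm_sub_le
    rw [Real.enorm_eq_ofReal_abs]
    exact ENNReal.ofReal_le_ofReal (le_abs_self _)
  have hfin : ∀ s, N s ≠ ∞ := fun s => by
    rw [hN]
    exact ENNReal.sum_ne_top.2 fun i _ => by rw [(hIB s i).Np_two]; exact ENNReal.ofReal_ne_top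
  obtain ⟨n, hn⟩ := integral_vf_mul_le hφ j k
  have hgrad : Pol (fun s : Sl => ∑ i, nm 2 (pd (G (s.vf φ j k)) i)) fun s => N s ^ (1 / 2 : ℝ) :=
    Pol.sum _ fun i _ => Pol.of_le fun s => hsingle s i
  have hmain : Pol N fun s => 1 + N s ^ (1 / 2 : ℝ) := by
    refine Pol.mono_left hNle (Pol.add ?_ ?_)
    · refine Pol.trans ⟨n, fun s => hn s _ (s.vf_CS hφ j k).G_IB.smooth⟩ ?_
      exact hB.add_mono hgrad
    · refine Pol.mono_left (fun s => enorm_integral_mul_le (s.vf_CS hφ j k).P1_IB.measurable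
        (s.vf_CS hφ j k).G_IB.measurable Real.HolderConjugate.two_two) ?_
      exact (hP.mul_one hB).mono_right fun s => le_self_add
  exact hgrad.trans ((Pol.absorb hfin hmain).rpow_one (by norm_num))

end Sl

lemma exists_cut_mul {φ : E3 → ℝ} (hφ : CS φ) :
    ∃ η : E3 → ℝ, CS η ∧ (∀ x, |η x| ≤ 1) ∧ (∀ x, φ x = φ x * η x) ∧
      (∀ i x, pd φ i x = pd φ i x * η x) ∧ ∀ x ∈ tsupport φ, η x = 1 := by
  obtain ⟨η, h1, h2, h3⟩ := exists_cut hφ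
  refine ⟨η, h1, h2, fun x => ?_, fun i x => ?_, h3⟩
  · by_cases hx : x ∈ tsupport φ
    · rw [h3 x hx, mul_one]
    · rw [image_eq_zero_of_notMem_tsupport hx, zero_mul]
  · by_cases hx : x ∈ tsupport φ
    · rw [h3 x hx, mul_one]
    · have : fderiv ℝ φ x = 0 := by
        by_contra h
        exact hx (support_fderiv_subset ℝ h)
      simp [pd, this]

lemma CS.integral_lap_mul {f g : E3 → ℝ} (hf : ContDiff ℝ (⊤ : ℕ∞) f) (hg : CS g) :
    ∫ x, _root_.lap f x * g x = ∫ x, f x * _root_.lap g x := by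
  have e1 : ∀ x, _root_.lap f x * g x = ∑ i, _root_.pd (_root_.pd f i) i x * g x := fun x => by
    rw [← Finset.sum_mul]; rfl
  have e2 : ∀ x, f x * _root_.lap g x = ∑ i, f x * _root_.pd (_root_.pd g i) i x := fun x => by
    rw [← Finset.mul_sum]; rfl
  simp only [e1, e2]
  rw [integral_finsetSum _ fun i _ => (CS.mul (contDiff_pd (contDiff_pd hf i) i) hg).integrable,
    integral_finsetSum _ fun i _ => (CS.mul hf ((hg.dpd i).dpd i)).integrable]
  refine Finset.sum_congr rfl fun i _ => ?_
  rw [CS.integral_mul_pd i hf (hg.dpd i), CS.integral_mul_pd i (contDiff_pd hf i) hg, neg_neg]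

lemma lap_mul {f g : E3 → ℝ} (hf : ContDiff ℝ (⊤ : ℕ∞) f) (hg : ContDiff ℝ (⊤ : ℕ∞) g) (x : E3) :
    lap (fun y => f y * g y) x = lap f x * g x + 2 * ∑ l, pd f l x * pd g l x + f x * lap g x := by
  have hfd : Differentiable ℝ f := hf.differentiable (by simp)
  have hgd : Differentiable ℝ g := hg.differentiable (by simp)
  have hfd' : ∀ i, Differentiable ℝ (pd f i) := fun i => (contDiff_pd hf i).differentiable (by simp)
  have hgd' : ∀ i, Differentiable ℝ (pd g i) := fun i => (contDiff_pd hg i).differentiable (by simp)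
  unfold lap
  rw [Finset.sum_mul, Finset.mul_sum, Finset.mul_sum, ← Finset.sum_add_distrib,
    ← Finset.sum_add_distrib]
  refine Finset.sum_congr rfl fun i _ => ?_
  have h1 : (fun y => pd (fun z => f z * g z) i y) = fun y => pd f i y * g y + f y * pd g i y :=
    funext fun y => pd_mul (hfd y) (hgd y) i
  have d1 : DifferentiableAt ℝ (fun y => pd f i y * g y) x := (hfd' i x).mul (hgd x)
  have d2 : DifferentiableAt ℝ (fun y => f y * pd g i y) x := (hfd x).mul (hgd' i x)
  rw [h1, pd_add d1 d2, pd_mul (hfd' i x) (hgd x),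
    pd_mul (hfd x) (hgd' i x)]
  ring

namespace Sl
variable {φ : E3 → ℝ}

/-- The squared `L²` norm of the localized vorticity. -/
def F (s : Sl) (φ : E3 → ℝ) : ℝ≥0∞ := ∑ j, ∑ k, Np 2 (s.vf φ j k)

lemma Np_vf_le (s : Sl) (φ : E3 → ℝ) (j k : Fin 3) : Np 2 (s.vf φ j k) ≤ s.F φ :=
  (Finset.single_le_sum (f := fun k => Np 2 (s.vf φ j k)) (fun _ _ => zero_le)
    (Finset.mem_univ k)).trans (Finset.single_le_sum
    (f := fun j => ∑ k, Np 2 (s.vf φ j k)) (fun _ _ => zero_le) (Finset.mem_univ j))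

lemma nm_vf (φ : E3 → ℝ) (j k : Fin 3) :
    Pol (fun s : Sl => nm 2 (s.vf φ j k)) fun s => s.F φ ^ (1 / 2 : ℝ) :=
  Pol.of_le fun s => ENNReal.rpow_le_rpow (s.Np_vf_le φ j k) (by norm_num)

lemma nm_pd_G (hφ : CS φ) (j k l : Fin 3) :
    Pol (fun s : Sl => nm 2 (pd (G (s.vf φ j k)) l)) fun _ => 1 := by
  refine Pol.mono_left (fun s => ?_) (H1_G_vf hφ j k)
  exact (Finset.single_le_sum (f := fun i => nm 2 (pd (G (s.vf φ j k)) i)) (fun _ _ => zero_le)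
    (Finset.mem_univ l)).trans le_add_self

lemma H1_pd_G (hφ : CS φ) (j k l : Fin 3) :
    Pol (fun s : Sl => H1 (pd (G (s.vf φ j k)) l)) fun s => 1 + s.F φ ^ (1 / 2 : ℝ) := by
  obtain ⟨C, hC, H⟩ := nm_pd_pd_G_le
  refine Pol.add_mono (nm_pd_G hφ j k l) (Pol.sum _ fun i _ => ?_)
  refine Pol.mono_left (fun s => ?_) ((nm_vf φ j k).const_mul hC)
  have hf := s.vf_CS hφ j k
  rw [pd_G hf, pd_G (hf.dpd l)]
  exact H _ hf l i

lemma viscous (hφ : CS φ) (j k : Fin 3) :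
    Pol (fun s : Sl => ‖(∫ x, lap (s.Om j k) x * (φ x * G (s.vf φ j k) x)) +
      ∫ x, s.vf φ j k x * s.vf φ j k x‖ₑ) fun s => 1 + s.F φ ^ (1 / 2 : ℝ) := by
  obtain ⟨n, hn⟩ := integral_vf_mul_le hφ.lap j k
  choose m hm using fun l => integral_vf_mul_le (hφ.dpd l) j k
  have hP : Pol (fun s : Sl => nm 2 (P1 (s.vf φ j k))) fun _ => 1 :=
    (nm_G_vf hφ j k).mono_left fun s => le_add_self
  refine Pol.mono_left (Y := fun s => Wt.a s ^ n * H1 (G (s.vf φ j k)) +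
    2 * ∑ l, Wt.a s ^ m l * H1 (pd (G (s.vf φ j k)) l) +
    nm 2 (s.vf φ j k) * nm 2 (P1 (s.vf φ j k))) (fun s => ?_) ?_
  · set f := s.vf φ j k with hf
    have hfC : CS f := s.vf_CS hφ j k
    have hB := hfC.G_IB.smooth
    have hZ : CS fun x => φ x * G f x := by simpa only [mul_comm] using CS.mul hB hφ
    have e : ∀ x, s.Om j k x * lap (fun x => φ x * G f x) x =
        s.vf (lap φ) j k x * G f x + 2 * ∑ l, s.vf (pd φ l) j k x * pd (G f) l x +
          f x * P1 f x - f x * f x := by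
      intro x
      rw [lap_mul hφ.1 hB, lap_G hfC]
      have : f x = φ x * s.Om j k x := rfl
      rw [this]
      unfold vf
      simp only [Finset.mul_sum, mul_add]
      have h2 : ∀ l, s.Om j k x * (2 * (pd φ l x * pd (G f) l x)) =
          2 * (pd φ l x * s.Om j k x * pd (G f) l x) := fun l => by ring
      simp only [h2]
      ring
    have i1 : Integrable fun x => s.vf (lap φ) j k x * G f x :=
      (s.vf_CS hφ.lap j k).IB.mul_integrable hfC.G_IB
    have i2 : ∀ l, Integrable fun x => s.vf (pd φ l) j k x * pd (G f) l x := fun l => by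
      rw [pd_G hfC]
      exact (s.vf_CS (hφ.dpd l) j k).IB.mul_integrable (hfC.dpd l).G_IB
    have i3 : Integrable fun x => f x * P1 f x := hfC.IB.mul_integrable hfC.P1_IB
    have i4 : Integrable fun x => f x * f x := hfC.IB.mul_integrable hfC.IB
    have i2' : Integrable fun x => 2 * ∑ l, s.vf (pd φ l) j k x * pd (G f) l x :=
      (integrable_finsetSum _ fun l _ => i2 l).const_mul 2
    rw [CS.integral_lap_mul (s.Om_smooth j k) hZ]
    simp only [e]
    have i12 : Integrable fun x => s.vf (lap φ) j k x * G f x +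
        2 * ∑ l, s.vf (pd φ l) j k x * pd (G f) l x := i1.add i2'
    have i123 : Integrable fun x => s.vf (lap φ) j k x * G f x +
        2 * ∑ l, s.vf (pd φ l) j k x * pd (G f) l x + f x * P1 f x := i12.add i3
    rw [integral_sub i123 i4, integral_add i12 i3, integral_add i1 i2',
      sub_add_cancel, integral_const_mul, integral_finsetSum _ fun l _ => i2 l]
    refine (enorm_add_le _ _).trans (add_le_add ((enorm_add_le _ _).trans (add_le_add ?_ ?_)) ?_)
    · exact hn s _ hB
    · rw [enorm_mul]
      gcongr
      · simp [Real.enorm_eq_ofReal_abs]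
      · refine (enorm_sum_le _ _).trans (Finset.sum_le_sum fun l _ => ?_)
        exact hm l s _ (contDiff_pd hB l)
    · exact enorm_integral_mul_le hfC.continuous.measurable hfC.P1_IB.measurable
        Real.HolderConjugate.two_two
  · refine Pol.add (Pol.add ?_ (Pol.const_mul (by finiteness) (Pol.sum _ fun l _ => ?_))) ?_
    · exact (Pol.trans ⟨n, fun _ => le_rfl⟩ (H1_G_vf hφ j k)).mono_right fun s => le_self_add
    · exact Pol.trans ⟨m l, fun _ => le_rfl⟩ (H1_pd_G hφ j k l)
    · exact ((nm_vf φ j k).mul_one hP).mono_right fun s => le_add_self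

/-- The nonlinearity in rotational form. -/
def M (s : Sl) (k : Fin 3) (x : E3) : ℝ := ∑ i, s.v i x * s.Om i k x

lemma M_smooth (s : Sl) (k : Fin 3) : ContDiff ℝ (⊤ : ℕ∞) (s.M k) :=
  ContDiff.sum fun i _ => (s.smooth i).mul (s.Om_smooth i k)

lemma M_eq (s : Sl) (k : Fin 3) (x : E3) : s.M k x =
    (∑ i, pd (fun y => s.v i y * s.v k y) i x) - 1 / 2 * ∑ i, pd (fun y => s.v i y * s.v i y) k x := by
  have h1 : ∀ i, pd (fun y => s.v i y * s.v k y) i x =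
      pd (s.v i) i x * s.v k x + s.v i x * pd (s.v k) i x := fun i =>
    pd_mul (s.diff i x) (s.diff k x) i
  have h2 : ∀ i, pd (fun y => s.v i y * s.v i y) k x = 2 * (s.v i x * pd (s.v i) k x) := fun i => by
    rw [pd_mul (s.diff i x) (s.diff i x) k]; ring
  simp only [h1, h2, Finset.sum_add_distrib]
  rw [← Finset.sum_mul, s.div, zero_mul, zero_add, ← Finset.mul_sum, ← mul_assoc]
  norm_num
  rw [← Finset.sum_sub_distrib]
  exact Finset.sum_congr rfl fun i _ => by unfold Om; ring

lemma M_dot (s : Sl) (x : E3) : ∑ k, s.M k x * s.v k x = 0 := by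
  simp only [M, Om, Fin.sum_univ_three]
  ring

/-- Sobolev norm of order one in `L⁴`. -/
def _root_.W4 (Y : E3 → ℝ) : ℝ≥0∞ := nm 4 Y + ∑ i, nm 4 (pd Y i)

lemma integral_quad (hφ : CS φ) (i l m : Fin 3) : ∃ n : ℕ, ∀ (s : Sl) (Y : E3 → ℝ),
    ContDiff ℝ (⊤ : ℕ∞) Y →
    ‖∫ x, (s.v i x * s.v l x) * pd (fun x => φ x * Y x) m x‖ₑ ≤ Wt.a s ^ n * W4 Y := by
  let ι := Sl × {Y : E3 → ℝ // ContDiff ℝ (⊤ : ℕ∞) Y}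
  suffices h : Pol (fun q : ι => ‖∫ x, (q.1.v i x * q.1.v l x) *
      pd (fun x => φ x * q.2.1 x) m x‖ₑ) fun q => W4 q.2.1 by
    obtain ⟨n, hn⟩ := h
    exact ⟨n, fun s Y hY => hn (s, ⟨Y, hY⟩)⟩
  obtain ⟨η, hη, -, hφη, hdη, -⟩ := exists_cut_mul hφ
  have hw : ∀ {ψ : E3 → ℝ} (k : Fin 3), CS ψ →
      Pol (fun q : ι => nm (8 / 3) (q.1.w ψ k)) fun _ => 1 := fun k hψ =>
    (nm_w hψ k (by norm_num) (by norm_num)).comp (fun q : ι => q.1) fun _ => rfl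
  refine Pol.mono_left (Y := fun q : ι =>
    nm (8 / 3) (q.1.w (pd φ m) i) * nm (8 / 3) (q.1.w η l) * nm 4 q.2.1 +
    nm (8 / 3) (q.1.w φ i) * nm (8 / 3) (q.1.w η l) * nm 4 (pd q.2.1 m)) (fun q => ?_) ?_
  · obtain ⟨s, Y, hY⟩ := q
    have hYd : Differentiable ℝ Y := hY.differentiable (by simp)
    have e : ∀ x, (s.v i x * s.v l x) * pd (fun x => φ x * Y x) m x =
        s.w (pd φ m) i x * s.w η l x * Y x + s.w φ i x * s.w η l x * pd Y m x := by
      intro x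
      rw [pd_mul (hφ.differentiable x) (hYd x)]
      unfold w
      linear_combination (s.v i x * s.v l x) * (Y x * hdη m x + pd Y m x * hφη x)
    have c1 := s.w_CS (hφ.dpd m) i
    have c2 := s.w_CS hφ i
    have c3 := s.w_CS hη l
    have i1 : Integrable fun x => s.w (pd φ m) i x * s.w η l x * Y x := by
      have := (CS.mul hY (CS.mul c1.1 c3)).integrable
      simpa only [mul_comm] using this
    have i2 : Integrable fun x => s.w φ i x * s.w η l x * pd Y m x := by
      have := (CS.mul (contDiff_pd hY m) (CS.mul c2.1 c3)).integrable
      simpa only [mul_comm] using this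
    simp only [e]
    rw [integral_add i1 i2]
    refine (enorm_add_le _ _).trans (add_le_add ?_ ?_)
    · exact enorm_integral_mul_three_le c1.continuous.measurable c3.continuous.measurable
        hY.continuous.measurable (by norm_num) (by norm_num) (by norm_num) (by norm_num)
    · exact enorm_integral_mul_three_le c2.continuous.measurable c3.continuous.measurable
        (contDiff_pd hY m).continuous.measurable (by norm_num) (by norm_num) (by norm_num)
        (by norm_num)
  · refine Pol.add ?_ ?_
    · exact (((hw i (hφ.dpd m)).mul_one (hw l hη)).one_mul (Pol.refl _)).mono_right
        fun q => le_self_add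
    · refine (((hw i hφ).mul_one (hw l hη)).one_mul (Pol.refl _)).mono_right fun q => ?_
      exact (Finset.single_le_sum (f := fun i => nm 4 (pd q.2.1 i)) (fun _ _ => zero_le)
        (Finset.mem_univ m)).trans le_add_self

lemma integral_M_mul (s : Sl) (k : Fin 3) {Z : E3 → ℝ} (hZ : CS Z) : ∫ x, s.M k x * Z x =
    -(∑ i, ∫ x, (s.v i x * s.v k x) * pd Z i x) +
      1 / 2 * ∑ i, ∫ x, (s.v i x * s.v i x) * pd Z k x := by
  have hs : ∀ i l, ContDiff ℝ (⊤ : ℕ∞) fun x => s.v i x * s.v l x := fun i l =>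
    (s.smooth i).mul (s.smooth l)
  have i1 : ∀ i, Integrable fun x => pd (fun y => s.v i y * s.v k y) i x * Z x := fun i =>
    (CS.mul (contDiff_pd (hs i k) i) hZ).integrable
  have i2 : ∀ i, Integrable fun x => pd (fun y => s.v i y * s.v i y) k x * Z x := fun i =>
    (CS.mul (contDiff_pd (hs i i) k) hZ).integrable
  simp only [CS.integral_mul_pd _ (hs _ _) hZ, M_eq]
  simp only [sub_mul, mul_assoc, Finset.sum_mul]
  rw [integral_sub (integrable_finsetSum _ fun i _ => i1 i)
    ((integrable_finsetSum _ fun i _ => i2 i).const_mul _),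
    integral_finsetSum _ fun i _ => i1 i, integral_const_mul, integral_finsetSum _ fun i _ => i2 i]
  simp only [Finset.sum_neg_distrib]
  ring

lemma integral_M_mul_le (hφ : CS φ) (k : Fin 3) : ∃ n : ℕ, ∀ (s : Sl) (Y : E3 → ℝ),
    ContDiff ℝ (⊤ : ℕ∞) Y → ‖∫ x, s.M k x * (φ x * Y x)‖ₑ ≤ Wt.a s ^ n * W4 Y := by
  let ι := Sl × {Y : E3 → ℝ // ContDiff ℝ (⊤ : ℕ∞) Y}
  suffices h : Pol (fun q : ι => ‖∫ x, q.1.M k x * (φ x * q.2.1 x)‖ₑ) fun q => W4 q.2.1 by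
    obtain ⟨n, hn⟩ := h
    exact ⟨n, fun s Y hY => hn (s, ⟨Y, hY⟩)⟩
  choose n hn using fun i l m => integral_quad hφ i l m
  refine Pol.mono_left (Y := fun q : ι => (∑ i, Wt.a q.1 ^ n i k i * W4 q.2.1) +
    ‖(1 / 2 : ℝ)‖ₑ * ∑ i, Wt.a q.1 ^ n i i k * W4 q.2.1) (fun q => ?_) ?_
  · obtain ⟨s, Y, hY⟩ := q
    have hZ : CS fun x => φ x * Y x := by simpa only [mul_comm] using CS.mul hY hφ
    rw [s.integral_M_mul k hZ]
    refine (enorm_add_le _ _).trans (add_le_add ?_ ?_)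
    · rw [enorm_neg]
      exact (enorm_sum_le _ _).trans (Finset.sum_le_sum fun i _ => hn i k i s Y hY)
    · rw [enorm_mul]
      gcongr
      exact (enorm_sum_le _ _).trans (Finset.sum_le_sum fun i _ => hn i i k s Y hY)
  · exact Pol.add (Pol.sum _ fun i _ => ⟨n i k i, fun q => le_rfl⟩)
      (Pol.const_mul (by simp) (Pol.sum _ fun i _ => ⟨n i i k, fun q => le_rfl⟩))

end Sl

lemma G_lap {f : E3 → ℝ} (hf : CS f) (x : E3) : G (lap f) x = P1 f x - f x := by
  have h : lap f = fun y => ∑ i, pd (pd f i) i y := rfl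
  rw [h, G_sum fun i _ => (hf.dpd i).dpd i, ← lap_G hf, lap]
  refine Finset.sum_congr rfl fun i _ => ?_
  rw [← pd_G (hf.dpd i), ← pd_G hf]

lemma pd_G_smooth {f : E3 → ℝ} (hf : CS f) (i : Fin 3) : IB (pd (G f) i) := by
  rw [pd_G hf]; exact (hf.dpd i).G_IB

namespace Sl
variable {φ : E3 → ℝ}

/-- The divergence of the localized velocity. -/
def dv (s : Sl) (φ : E3 → ℝ) (x : E3) : ℝ := ∑ j, s.w (pd φ j) j x

lemma dv_CS (s : Sl) (hφ : CS φ) : CS (s.dv φ) := by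
  have h : CS fun x => ∑ j, s.w (pd φ j) j x := CS.sum fun j _ => s.w_CS (hφ.dpd j) j
  exact h

lemma sum_pd_w (s : Sl) (hφ : CS φ) (x : E3) : ∑ j, pd (s.w φ j) j x = s.dv φ x := by
  simp only [s.pd_w hφ, Finset.sum_add_distrib, ← Finset.mul_sum, s.div, mul_zero, add_zero]
  rfl

lemma nm_dv (hφ : CS φ) {q : ℝ} (hq1 : 1 ≤ q) (hq3 : q < 3) :
    Pol (fun s : Sl => nm q (s.dv φ)) fun _ => 1 :=
  Pol.mono_left (fun s => nm_sum_le hq1 _ fun j _ => (s.w_CS (hφ.dpd j) j).continuous.measurable)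
    (Pol.sum _ fun j _ => nm_w (hφ.dpd j) j hq1 hq3)

/-- The remainder in the localized Biot–Savart law. -/
def rm (s : Sl) (φ : E3 → ℝ) (k : Fin 3) (x : E3) : ℝ :=
  P1 (s.w φ k) x - G (pd (s.dv φ) k) x - ∑ j, G (pd (s.cm φ j k) j) x

lemma rm_IB (s : Sl) (hφ : CS φ) (k : Fin 3) : IB (s.rm φ k) := by
  have h : CS fun x => ∑ j, pd (s.cm φ j k) j x := CS.sum fun j _ => (s.cm_CS hφ j k).dpd j
  have e := G_sum (s := Finset.univ) fun j _ => (s.cm_CS hφ j k).dpd j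
  have h' := h.G_IB
  rw [e] at h'
  exact ((s.w_CS hφ k).P1_IB.sub ((s.dv_CS hφ).dpd k).G_IB).sub h'

lemma sum_pd_G_vf (s : Sl) (hφ : CS φ) (k : Fin 3) (x : E3) :
    ∑ j, pd (G (s.vf φ j k)) j x = s.rm φ k x - s.w φ k x := by
  have e1 : ∀ j, pd (s.vf φ j k) j =
      fun x => pd (pd (s.w φ k) j) j x - pd (pd (s.w φ j) k) j x - pd (s.cm φ j k) j x := fun j => by
    rw [s.vf_eq hφ]
    funext x
    have d1 := ((s.w_CS hφ k).dpd j).differentiable x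
    have d2 := ((s.w_CS hφ j).dpd k).differentiable x
    have d12 : DifferentiableAt ℝ (fun x => pd (s.w φ k) j x - pd (s.w φ j) k x) x := d1.sub d2
    rw [pd_sub d12 ((s.cm_CS hφ j k).differentiable x), pd_sub d1 d2]
  have e2 : (fun x => ∑ j, pd (s.vf φ j k) j x) = fun x =>
      lap (s.w φ k) x - pd (s.dv φ) k x - ∑ j, pd (s.cm φ j k) j x := by
    funext x
    have : pd (s.dv φ) k x = ∑ j, pd (pd (s.w φ j) k) j x := by
      rw [← funext fun x => s.sum_pd_w hφ x,
        pd_sum fun j _ => ((s.w_CS hφ j).dpd j).differentiable x]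
      exact Finset.sum_congr rfl fun j _ => congrFun (pd_comm (s.w_CS hφ j).1 _ _) x
    rw [this]
    simp only [e1, Finset.sum_sub_distrib]
    rfl
  have e3 : ∑ j, pd (G (s.vf φ j k)) j x = G (fun x => ∑ j, pd (s.vf φ j k) j x) x := by
    rw [G_sum fun j _ => (s.vf_CS hφ j k).dpd j]
    exact Finset.sum_congr rfl fun j _ => by rw [pd_G (s.vf_CS hφ j k)]
  have c3 : CS fun x => ∑ j, pd (s.cm φ j k) j x := CS.sum fun j _ => (s.cm_CS hφ j k).dpd j
  have c1 := (s.w_CS hφ k).lap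
  have c2 := (s.dv_CS hφ).dpd k
  rw [e3, e2, G_sub (c1.sub c2) c3, G_sub c1 c2, G_sum fun j _ => (s.cm_CS hφ j k).dpd j]
  simp only []
  rw [G_lap (s.w_CS hφ k), rm]
  ring

lemma nm_rm (hφ : CS φ) (k : Fin 3) : Pol (fun s : Sl => nm 8 (s.rm φ k)) fun _ => 1 := by
  obtain ⟨C, hC, H⟩ := young_G (p := 8 / 3) (r := 8) (by norm_num) (by norm_num) (by norm_num)
  refine Pol.mono_left (Y := fun s : Sl => C * nm (8 / 3) (s.w φ k) + C * nm (8 / 3) (s.dv φ) +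
    ∑ j, C * nm (8 / 3) (s.cm φ j k)) (fun s => ?_) ?_
  · have m1 : Measurable (P1 (s.w φ k)) := (s.w_CS hφ k).P1_IB.measurable
    have m2 : Measurable (G (pd (s.dv φ) k)) := ((s.dv_CS hφ).dpd k).G_IB.measurable
    have m3 : ∀ j, Measurable (G (pd (s.cm φ j k) j)) := fun j =>
      ((s.cm_CS hφ j k).dpd j).G_IB.measurable
    have m12 : Measurable fun x => P1 (s.w φ k) x - G (pd (s.dv φ) k) x := m1.sub m2
    have m3' : Measurable fun x => ∑ j, G (pd (s.cm φ j k) j) x :=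
      Finset.measurable_fun_sum _ fun j _ => m3 j
    refine (nm_sub_le (by norm_num) m12 m3').trans (add_le_add ((nm_sub_le (by norm_num) m1 m2).trans
      (add_le_add (H _ (s.w_CS hφ k)).2.1 ((H _ (s.dv_CS hφ)).2.2 k))) ?_)
    exact (nm_sum_le (by norm_num) _ fun j _ => m3 j).trans
      (Finset.sum_le_sum fun j _ => (H _ (s.cm_CS hφ j k)).2.2 j)
  · exact Pol.add (Pol.add (Pol.const_mul hC (nm_w hφ k (by norm_num) (by norm_num)))
      (Pol.const_mul hC (nm_dv hφ (by norm_num) (by norm_num))))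
      (Pol.sum _ fun j _ => Pol.const_mul hC (nm_cm hφ j k (by norm_num) (by norm_num)))

lemma W4_G_vf (hφ : CS φ) (j k : Fin 3) :
    Pol (fun s : Sl => W4 (G (s.vf φ j k))) fun s => s.F φ ^ (1 / 2 : ℝ) := by
  obtain ⟨C, hC, H⟩ := young_G (p := 2) (r := 4) (by norm_num) (by norm_num) (by norm_num)
  have h := (nm_vf φ j k).const_mul hC
  refine Pol.add (h.mono_left fun s => (H _ (s.vf_CS hφ j k)).1) (Pol.sum _ fun i _ =>
    h.mono_left fun s => ?_)
  rw [pd_G (s.vf_CS hφ j k)]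
  exact (H _ (s.vf_CS hφ j k)).2.2 i

/-- The right-hand side of the vorticity equation. -/
def R (s : Sl) (j k : Fin 3) (x : E3) : ℝ :=
  lap (s.Om j k) x - (pd (s.M k) j x - pd (s.M j) k x)

lemma sum_R (s : Sl) (hφ : CS φ) :
    ∑ j, ∑ k, ∫ x, s.R j k x * (φ x * G (s.vf φ j k) x) =
      (∑ j, ∑ k, ∫ x, lap (s.Om j k) x * (φ x * G (s.vf φ j k) x)) +
      2 * ((∑ j, ∑ k, ∫ x, s.M k x * (pd φ j x * G (s.vf φ j k) x)) +
        ∑ k, ∫ x, s.M k x * (φ x * s.rm φ k x)) := by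
  have cB : ∀ j k, CS fun x => φ x * G (s.vf φ j k) x := fun j k => by
    simpa only [mul_comm] using CS.mul (s.vf_CS hφ j k).G_IB.smooth hφ
  have cB' : ∀ j k l, CS fun x => pd φ l x * G (s.vf φ j k) x := fun j k l => by
    simpa only [mul_comm] using CS.mul (s.vf_CS hφ j k).G_IB.smooth (hφ.dpd l)
  have cB'' : ∀ j k l, CS fun x => φ x * pd (G (s.vf φ j k)) l x := fun j k l => by
    simpa only [mul_comm] using CS.mul (pd_G_smooth (s.vf_CS hφ j k) l).smooth hφ
  have hneg : ∀ j k, G (s.vf φ k j) = fun x => - G (s.vf φ j k) x := fun j k => by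
    rw [← G_neg]
    congr 1
    funext x
    rw [vf, s.Om_neg, vf]; ring
  have hlap : ∀ j k, ContDiff ℝ (⊤ : ℕ∞) (lap (s.Om j k)) := fun j k => by
    have h : ContDiff ℝ (⊤ : ℕ∞) fun x => ∑ i, pd (pd (s.Om j k) i) i x :=
      ContDiff.sum fun i _ => contDiff_pd (contDiff_pd (s.Om_smooth j k) i) i
    exact h
  let T := fun j k => ∫ x, s.M k x * pd (fun x => φ x * G (s.vf φ j k) x) j x
  have e1 : ∀ j k, ∫ x, s.R j k x * (φ x * G (s.vf φ j k) x) =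
      (∫ x, lap (s.Om j k) x * (φ x * G (s.vf φ j k) x)) + (T j k + T k j) := by
    intro j k
    have i1 : Integrable fun x => lap (s.Om j k) x * (φ x * G (s.vf φ j k) x) :=
      (CS.mul (hlap j k) (cB j k)).integrable
    have i2 : Integrable fun x => pd (s.M k) j x * (φ x * G (s.vf φ j k) x) :=
      (CS.mul (contDiff_pd (s.M_smooth k) j) (cB j k)).integrable
    have i3 : Integrable fun x => pd (s.M j) k x * (φ x * G (s.vf φ j k) x) :=
      (CS.mul (contDiff_pd (s.M_smooth j) k) (cB j k)).integrable
    have i23 : Integrable fun x => pd (s.M k) j x * (φ x * G (s.vf φ j k) x) -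
      pd (s.M j) k x * (φ x * G (s.vf φ j k) x) := i2.sub i3
    simp only [R, sub_mul]
    rw [integral_sub i1 i23, integral_sub i2 i3]
    have a1 := CS.integral_mul_pd j (s.M_smooth k) (cB j k)
    have a2 := CS.integral_mul_pd k (s.M_smooth j) (cB j k)
    have a3 : T k j = - ∫ x, s.M j x * pd (fun x => φ x * G (s.vf φ j k) x) k x := by
      simp only [T]
      rw [hneg j k]
      have : (fun x => φ x * -G (s.vf φ j k) x) = fun x => - (φ x * G (s.vf φ j k) x) := by
        funext x; ring
      rw [this, ← integral_neg]
      refine integral_congr_ae (ae_of_all _ fun x => ?_)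
      simp only []
      rw [pd_neg]; ring
    rw [a3]
    linarith
  have e2 : ∀ j k, T j k = (∫ x, s.M k x * (pd φ j x * G (s.vf φ j k) x)) +
      ∫ x, s.M k x * (φ x * pd (G (s.vf φ j k)) j x) := by
    intro j k
    rw [← integral_add (CS.mul (s.M_smooth k) (cB' j k j)).integrable
      (CS.mul (s.M_smooth k) (cB'' j k j)).integrable]
    refine integral_congr_ae (ae_of_all _ fun x => ?_)
    simp only []
    rw [pd_mul (hφ.differentiable x)
      ((s.vf_CS hφ j k).G_IB.smooth.differentiable (by simp) x)]
    ring
  have e3 : ∑ j, ∑ k, ∫ x, s.M k x * (φ x * pd (G (s.vf φ j k)) j x) =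
      ∑ k, ∫ x, s.M k x * (φ x * s.rm φ k x) := by
    have i1 : ∀ j k, Integrable fun x => s.M k x * (φ x * pd (G (s.vf φ j k)) j x) := fun j k =>
      (CS.mul (s.M_smooth k) (cB'' j k j)).integrable
    have i2 : ∀ k, Integrable fun x => s.M k x * (φ x * s.rm φ k x) := fun k => by
      have : CS fun x => φ x * s.rm φ k x := by
        simpa only [mul_comm] using CS.mul (s.rm_IB hφ k).smooth hφ
      exact (CS.mul (s.M_smooth k) this).integrable
    rw [← integral_finsetSum _ fun k _ => i2 k, Finset.sum_comm]
    rw [Finset.sum_congr rfl fun k _ => (integral_finsetSum _ fun j _ => i1 j k).symm,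
      ← integral_finsetSum _ fun k _ => integrable_finsetSum _ fun j _ => i1 j k]
    refine integral_congr_ae (ae_of_all _ fun x => ?_)
    simp only [← Finset.mul_sum, s.sum_pd_G_vf hφ]
    have h0 := s.M_dot x
    have : ∀ k, s.M k x * (φ x * (s.rm φ k x - s.w φ k x)) =
        s.M k x * (φ x * s.rm φ k x) - φ x * φ x * (s.M k x * s.v k x) := fun k => by
      unfold w; ring
    simp only [this, Finset.sum_sub_distrib, ← Finset.mul_sum, h0, mul_zero, sub_zero]
  simp only [e1, Finset.sum_add_distrib]
  rw [Finset.sum_comm (f := fun j k => T k j), ← two_mul]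
  simp only [e2, Finset.sum_add_distrib, e3]

lemma integral_M_rm (hφ : CS φ) (k : Fin 3) :
    Pol (fun s : Sl => ‖∫ x, s.M k x * (φ x * s.rm φ k x)‖ₑ) fun s => s.F φ ^ (1 / 2 : ℝ) := by
  obtain ⟨η, hη, -, hφη, -⟩ := exists_cut_mul hφ
  refine Pol.mono_left (Y := fun s : Sl =>
    ∑ i, nm (8 / 3) (s.w η i) * nm 8 (s.rm φ k) * nm 2 (s.vf φ i k)) (fun s => ?_)
    (Pol.sum _ fun i _ => ((nm_w hη i (by norm_num) (by norm_num)).mul_one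
      (nm_rm hφ k)).one_mul (nm_vf φ i k))
  have e : ∀ x, s.M k x * (φ x * s.rm φ k x) = ∑ i, s.w η i x * s.rm φ k x * s.vf φ i k x := by
    intro x
    rw [M, Finset.sum_mul]
    refine Finset.sum_congr rfl fun i _ => ?_
    unfold w vf
    linear_combination s.v i x * s.Om i k x * s.rm φ k x * hφη x
  have hi : ∀ i, Integrable fun x => s.w η i x * s.rm φ k x * s.vf φ i k x := fun i =>
    (CS.mul ((s.w_CS hη i).1.mul (s.rm_IB hφ k).smooth) (s.vf_CS hφ i k)).integrable
  simp only [e]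
  rw [integral_finsetSum _ fun i _ => hi i]
  refine (enorm_sum_le _ _).trans (Finset.sum_le_sum fun i _ => ?_)
  exact enorm_integral_mul_three_le (s.w_CS hη i).continuous.measurable (s.rm_IB hφ k).measurable
    (s.vf_CS hφ i k).continuous.measurable (by norm_num) (by norm_num) (by norm_num) (by norm_num)

lemma energy_static (hφ : CS φ) :
    Pol (fun s : Sl => ‖(∑ j, ∑ k, ∫ x, s.R j k x * (φ x * G (s.vf φ j k) x)) +
      ∑ j, ∑ k, ∫ x, s.vf φ j k x * s.vf φ j k x‖ₑ) fun s => 1 + s.F φ ^ (1 / 2 : ℝ) := by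
  choose n hn using fun j k => integral_M_mul_le (hφ.dpd j) k
  refine Pol.mono_left (Y := fun s : Sl => (∑ j, ∑ k,
    ‖(∫ x, lap (s.Om j k) x * (φ x * G (s.vf φ j k) x)) +
      ∫ x, s.vf φ j k x * s.vf φ j k x‖ₑ) +
    ‖(2 : ℝ)‖ₑ * ((∑ j, ∑ k, Wt.a s ^ n j k * W4 (G (s.vf φ j k))) +
      ∑ k, ‖∫ x, s.M k x * (φ x * s.rm φ k x)‖ₑ)) (fun s => ?_) ?_
  · rw [s.sum_R hφ, add_right_comm]
    refine (enorm_add_le _ _).trans (add_le_add ?_ ?_)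
    · simp only [← Finset.sum_add_distrib]
      exact (enorm_sum_le _ _).trans (Finset.sum_le_sum fun j _ => enorm_sum_le _ _)
    · rw [enorm_mul]
      gcongr
      refine (enorm_add_le _ _).trans (add_le_add ?_ (enorm_sum_le _ _))
      exact (enorm_sum_le _ _).trans (Finset.sum_le_sum fun j _ => (enorm_sum_le _ _).trans
        (Finset.sum_le_sum fun k _ => hn j k s _ (s.vf_CS hφ j k).G_IB.smooth))
  · refine Pol.add (Pol.sum _ fun j _ => Pol.sum _ fun k _ => viscous hφ j k) ?_
    refine Pol.mono_right (Pol.const_mul (by simp) (Pol.add (Pol.sum _ fun j _ =>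
      Pol.sum _ fun k _ => ?_) (Pol.sum _ fun k _ => integral_M_rm hφ k))) fun s => le_add_self
    exact Pol.trans ⟨n j k, fun s => le_rfl⟩ (W4_G_vf hφ j k)

end Sl

/-- A solution on the unit time interval with a weak `L³` bound. -/
structure Dat where
  /-- The size of the solution. -/
  A : ℝ
  two_le : 2 ≤ A
  /-- The velocity. -/
  u : ℝ → E3 → E3
  /-- The pressure. -/
  pr : ℝ → E3 → ℝ
  sol : IsNSSol u pr (Icc 0 1)
  weak : ∀ t ∈ Icc (0:ℝ) 1, wnorm3 (u t) ≤ ENNReal.ofReal A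

instance : Wt Dat where
  a s := ENNReal.ofReal s.A
  two_le s := by simpa using ENNReal.ofReal_le_ofReal s.two_le

lemma measure_le_of_wnorm3 {u : E3 → E3} {A : ℝ} (hA : 0 ≤ A) (h : wnorm3 u ≤ ENNReal.ofReal A)
    {l : ℝ} (hl : 0 < l) : volume {x | l ≤ ‖u x‖} ≤ ENNReal.ofReal (A ^ 3 * l ^ (-3 : ℝ)) := by
  have h1 : ENNReal.ofReal l * volume {x | l ≤ ‖u x‖} ^ (1 / 3 : ℝ) ≤ ENNReal.ofReal A :=
    (le_iSup₂ (f := fun (l : ℝ) (_ : 0 < l) =>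
      ENNReal.ofReal l * (volume {x : E3 | l ≤ ‖u x‖}) ^ (1 / (3:ℝ))) l hl).trans h
  have h2 : volume {x | l ≤ ‖u x‖} ^ (1 / 3 : ℝ) ≤ ENNReal.ofReal (A / l) := by
    rw [ENNReal.ofReal_div_of_pos hl, ENNReal.le_div_iff_mul_le (Or.inl (by simpa using hl))
      (Or.inl (by simp)), mul_comm]
    exact h1
  have h3 := ENNReal.rpow_le_rpow h2 (by norm_num : (0:ℝ) ≤ 3)
  rw [← ENNReal.rpow_mul, ENNReal.ofReal_rpow_of_nonneg (by positivity) (by norm_num)] at h3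
  norm_num at h3
  refine h3.trans_eq ?_
  rw [div_pow, Real.rpow_neg hl.le]
  norm_num
  rfl

namespace Dat

/-- The components of the velocity. -/
def v (d : Dat) (i : Fin 3) (t : ℝ) (x : E3) : ℝ := d.u t x i

lemma v_JS (d : Dat) (i : Fin 3) : JS (d.v i) := by
  have h : ContDiff ℝ (⊤ : ℕ∞) fun q : ℝ × E3 => d.u q.1 q.2 i :=
    (EuclideanSpace.proj i : E3 →L[ℝ] ℝ).contDiff.comp d.sol.1
  exact h

/-- A time slice of a solution. -/
def sl (q : Dat × Icc (0:ℝ) 1) : Sl where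
  A := q.1.A
  two_le := q.1.two_le
  v i := q.1.v i q.2
  smooth i := (q.1.v_JS i).slice _
  div x := q.1.sol.2.2.2 q.2 q.2.2 x
  weak i l hl := by
    refine le_trans (measure_mono fun x hx => ?_)
      (measure_le_of_wnorm3 (by linarith [q.1.two_le]) (q.1.weak q.2 q.2.2) hl)
    have h1 : |q.1.u q.2 x i| ≤ ‖q.1.u q.2 x‖ := PiLp.norm_apply_le (q.1.u q.2 x) i
    exact le_trans (show l ≤ |q.1.u q.2 x i| from hx) h1

/-- The components of the vorticity. -/
def Om (d : Dat) (j k : Fin 3) (t : ℝ) (x : E3) : ℝ := pd (d.v k t) j x - pd (d.v j t) k x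

lemma Om_JS (d : Dat) (j k : Fin 3) : JS (d.Om j k) := ((d.v_JS k).dpd j).sub ((d.v_JS j).dpd k)

/-- The nonlinearity in rotational form. -/
def M (d : Dat) (k : Fin 3) (t : ℝ) (x : E3) : ℝ := ∑ i, d.v i t x * d.Om i k t x

lemma M_JS (d : Dat) (k : Fin 3) : JS (d.M k) := JS.sum fun i _ => (d.v_JS i).mul (d.Om_JS i k)

lemma dt_v (d : Dat) : ∃ P : ℝ → E3 → ℝ, JS P ∧ ∀ t ∈ Icc (0:ℝ) 1, ∀ k,
    dt (d.v k) t = fun x => lap (d.v k t) x - d.M k t x - pd (P t) k x := by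
  have hq : JS fun t x => ∑ i, d.v i t x * d.v i t x := JS.sum fun i _ => (d.v_JS i).mul (d.v_JS i)
  refine ⟨fun t x => d.pr t x + (1 / 2) * ∑ i, d.v i t x * d.v i t x,
    JS.add d.sol.2.1 ((JS.const (contDiff_const (c := (1/2:ℝ)))).mul hq), fun t ht k => ?_⟩
  funext x
  have h := d.sol.2.2.1 t ht x k
  have hd : ∀ i, DifferentiableAt ℝ (d.v i t) x := fun i =>
    ((d.v_JS i).slice t).differentiable (by simp) x
  have hp : DifferentiableAt ℝ (d.pr t) x :=
    (JS.slice (F := d.pr) d.sol.2.1 t).differentiable (by simp) x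
  have hq' : DifferentiableAt ℝ (fun x => ∑ i, d.v i t x * d.v i t x) x :=
    (hq.slice t).differentiable (by simp) x
  have hd2 : ∀ i, DifferentiableAt ℝ (fun x => d.v i t x * d.v i t x) x := fun i =>
    (hd i).mul (hd i)
  rw [pd_add hp (hq'.const_mul _), pd_const_mul _ _ hq', pd_sum fun i _ => hd2 i]
  have e : ∀ i, pd (fun y => d.v i t y * d.v i t y) k x = 2 * (d.v i t x * pd (d.v i t) k x) :=
    fun i => by rw [pd_mul (hd i) (hd i)]; ring
  simp only [e, ← Finset.mul_sum]
  have e2 : d.M k t x = (∑ i, d.v i t x * pd (d.v k t) i x) - ∑ i, d.v i t x * pd (d.v i t) k x := by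
    simp only [M, Om, mul_sub, Finset.sum_sub_distrib]
  rw [e2]
  have h' : dt (d.v k) t x - lap (d.v k t) x + (∑ i, d.v i t x * pd (d.v k t) i x) +
    pd (d.pr t) k x = 0 := h
  linarith

lemma dt_Om (d : Dat) {t : ℝ} (ht : t ∈ Icc (0:ℝ) 1) (j k : Fin 3) (x : E3) :
    dt (d.Om j k) t x = lap (d.Om j k t) x - (pd (d.M k t) j x - pd (d.M j t) k x) := by
  obtain ⟨P, hP, h⟩ := d.dt_v
  have hs : ∀ i, ContDiff ℝ (⊤ : ℕ∞) (d.v i t) := fun i => (d.v_JS i).slice t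
  have hlap : ∀ i, ContDiff ℝ (⊤ : ℕ∞) (lap (d.v i t)) := fun i => by
    have h : ContDiff ℝ (⊤ : ℕ∞) fun x => ∑ l, pd (pd (d.v i t) l) l x :=
      ContDiff.sum fun l _ => contDiff_pd (contDiff_pd (hs i) l) l
    exact h
  have e0 : dt (d.Om j k) t x = pd (dt (d.v k) t) j x - pd (dt (d.v j) t) k x := by
    rw [(d.v_JS k).pd_dt_comm, (d.v_JS j).pd_dt_comm]
    exact ((((d.v_JS k).dpd j).hasDerivAt t x).sub (((d.v_JS j).dpd k).hasDerivAt t x)).deriv.trans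
      (by rw [((d.v_JS k).dpd j).dt_eq, ((d.v_JS j).dpd k).dt_eq])
  have e1 : ∀ k j, pd (dt (d.v k) t) j x =
      pd (lap (d.v k t)) j x - pd (d.M k t) j x - pd (pd (P t) k) j x := fun k j => by
    have d1 : DifferentiableAt ℝ (lap (d.v k t)) x := (hlap k).differentiable (by simp) x
    have d2 : DifferentiableAt ℝ (d.M k t) x := ((d.M_JS k).slice t).differentiable (by simp) x
    have d3 : DifferentiableAt ℝ (pd (P t) k) x :=
      (contDiff_pd (hP.slice t) k).differentiable (by simp) x
    have d12 : DifferentiableAt ℝ (fun x => lap (d.v k t) x - d.M k t x) x := d1.sub d2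
    rw [h t ht k, pd_sub d12 d3, pd_sub d1 d2]
  have e2 : ∀ k j, pd (lap (d.v k t)) j x = ∑ l, pd (pd (pd (d.v k t) j) l) l x := fun k j => by
    have : lap (d.v k t) = fun x => ∑ l, pd (pd (d.v k t) l) l x := rfl
    rw [this, pd_sum fun l _ =>
      (contDiff_pd (contDiff_pd (hs k) l) l).differentiable (by simp) x]
    refine Finset.sum_congr rfl fun l _ => ?_
    rw [pd_comm (contDiff_pd (hs k) l) l j, pd_comm (hs k) l j]
  have e3 : lap (d.Om j k t) x =
      (∑ l, pd (pd (pd (d.v k t) j) l) l x) - ∑ l, pd (pd (pd (d.v j t) k) l) l x := by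
    have d1 : ∀ l, pd (d.Om j k t) l = fun x => pd (pd (d.v k t) j) l x - pd (pd (d.v j t) k) l x :=
      fun l => funext fun x => pd_sub ((contDiff_pd (hs k) j).differentiable (by simp) x)
        ((contDiff_pd (hs j) k).differentiable (by simp) x) l
    rw [lap, ← Finset.sum_sub_distrib]
    refine Finset.sum_congr rfl fun l _ => ?_
    rw [d1 l, pd_sub ((contDiff_pd (contDiff_pd (hs k) j) l).differentiable (by simp) x)
      ((contDiff_pd (contDiff_pd (hs j) k) l).differentiable (by simp) x)]
  rw [e0, e1, e1, e2, e2, e3, pd_comm (hP.slice t) j k]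
  ring

end Dat

/-- A compact set containing all spatial supports. -/
lemma TF.exists_compact {F : ℝ → E3 → ℝ} (hF : TF F) :
    ∃ K : Set E3, IsCompact K ∧ ∀ t, ∀ x ∉ K, F t x = 0 := by
  refine ⟨_, hF.2.isCompact.image continuous_snd, fun t x hx => ?_⟩
  by_contra h
  exact hx ⟨(t, x), subset_tsupport _ h, rfl⟩

lemma integrable_bound {K : Set E3} (hK : IsCompact K) (C : ℝ) :
    Integrable (K.indicator fun _ => C) :=
  (integrable_indicator_iff hK.measurableSet).2 (integrableOn_const hK.measure_lt_top.ne)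

lemma TF.continuous_integral_mul {F H : ℝ → E3 → ℝ} (hF : TF F) (hH : TF H) :
    Continuous fun t => ∫ x, F t x * H t x := by
  obtain ⟨K, hK, hK0⟩ := hF.exists_compact
  have hT := TF.mul hF.1 hH
  obtain ⟨C, hC0, hC⟩ := hT.bdd
  refine continuous_of_dominated (bound := K.indicator fun _ => C)
    (fun t => (hT.slice t).continuous.aestronglyMeasurable) (fun t => ae_of_all _ fun x => ?_)
    (integrable_bound hK C) (ae_of_all _ fun x => ?_)
  · by_cases hx : x ∈ K
    · simpa [hx] using hC t x
    · simp [hx, hK0 t x hx]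
  · exact (ContDiff.continuous (𝕜 := ℝ) hT.1).comp (Continuous.prodMk_left x)

lemma TF.hasDerivAt_energy {F : ℝ → E3 → ℝ} (hF : TF F) (t : ℝ) :
    HasDerivAt (fun t => ∫ x, F t x * G (F t) x) (2 * ∫ x, _root_.dt F t x * G (F t) x) t := by
  obtain ⟨K, hK, hK0⟩ := hF.exists_compact
  obtain ⟨C, hC0, hC⟩ := hF.bdd
  obtain ⟨C', hC0', hC'⟩ := hF.dt.bdd
  have hw := GK_weight gk_GP (a := 0) (by norm_num)
  have hB : ∃ D, 0 ≤ D ∧ ∀ t x, |G (F t) x| ≤ D := by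
    refine ⟨_, ?_, fun t x => Av_abs_le hw (fun x => hC t x) x⟩
    exact (abs_nonneg _).trans (Av_abs_le (h := fun a : ℝ × E3 => √a.1 • a.2) hw
      (fun x => hC 0 x) 0)
  have hB' : ∃ D, 0 ≤ D ∧ ∀ t x, |G (_root_.dt F t) x| ≤ D := by
    refine ⟨_, ?_, fun t x => Av_abs_le hw (fun x => hC' t x) x⟩
    exact (abs_nonneg _).trans (Av_abs_le (h := fun a : ℝ × E3 => √a.1 • a.2) hw
      (fun x => hC' 0 x) 0)
  obtain ⟨D, hD0, hD⟩ := hB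
  obtain ⟨D', hD0', hD'⟩ := hB'
  have hdt0 : ∀ t, ∀ x ∉ K, _root_.dt F t x = 0 := fun t x hx => by
    have : (fun s => F s x) = fun _ => 0 := funext fun s => hK0 s x hx
    simp [_root_.dt, this]
  have key := hasDerivAt_integral_of_dominated_loc_of_deriv_le (μ := (volume : Measure E3))
    (F := fun t x => F t x * G (F t) x)
    (F' := fun t x => _root_.dt F t x * G (F t) x + F t x * G (_root_.dt F t) x)
    (s := univ) (x₀ := t) (bound := K.indicator fun _ => C' * D + C * D') univ_mem
    (Eventually.of_forall fun t => ((hF.slice t).IB.mul_integrable (hF.slice t).G_IB).1)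
    ((hF.slice t).IB.mul_integrable (hF.slice t).G_IB)
    ((((hF.dt.slice t).IB.mul_integrable (hF.slice t).G_IB).add
      ((hF.slice t).IB.mul_integrable (hF.dt.slice t).G_IB)).1)
    (ae_of_all _ fun x s _ => ?_) (integrable_bound hK _) (ae_of_all _ fun x s _ => ?_)
  · have h := key.2
    rw [integral_add ((hF.dt.slice t).IB.mul_integrable (hF.slice t).G_IB)
      ((hF.slice t).IB.mul_integrable (hF.dt.slice t).G_IB),
      integral_mul_G (hF.slice t) (hF.dt.slice t)] at h
    refine h.congr_deriv ?_
    rw [two_mul]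
    simp only [mul_comm]
  · by_cases hx : x ∈ K
    · simp only [hx, indicator_of_mem, Real.norm_eq_abs]
      refine (abs_add_le _ _).trans ?_
      rw [abs_mul, abs_mul]
      exact add_le_add (mul_le_mul (hC' s x) (hD s x) (abs_nonneg _) hC0')
        (mul_le_mul (hC s x) (hD' s x) (abs_nonneg _) hC0)
    · simp [hx, hK0 s x hx, hdt0 s x hx]
  · have h1 := hF.1.hasDerivAt s x
    rw [← hF.1.dt_eq] at h1
    exact h1.mul (Av_hasDerivAt_time hw measurable_sqrt_smul' hF s x)

lemma ofReal_pow_mul_bound {X : ℝ} {A : ℝ} (hA : 2 ≤ A) {n : ℕ}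
    (h : ‖X‖ₑ ≤ ENNReal.ofReal A ^ n * 1) : |X| ≤ A ^ n := by
  rw [mul_one, Real.enorm_eq_ofReal_abs, ← ENNReal.ofReal_pow (by linarith)] at h
  exact (ENNReal.ofReal_le_ofReal_iff (by positivity)).1 h

lemma energy_ode {e e' F : ℝ → ℝ} {A : ℝ} {n m : ℕ} (hA : 2 ≤ A)
    (hd : ∀ t, HasDerivAt e (e' t) t) (hF : Continuous F) (hF0 : ∀ t, 0 ≤ F t)
    (he : ∀ t ∈ Icc (0:ℝ) 1, |e t| ≤ A ^ n)
    (he' : ∀ t ∈ Icc (0:ℝ) 1, |e' t + F t| ≤ A ^ m * (1 + √(F t))) :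
    ∫ t in (0:ℝ)..1, F t ≤ 4 * A ^ n + 4 * A ^ (2 * m) := by
  have h := intervalIntegral.sub_le_integral_of_hasDeriv_right_of_le (a := 0) (b := 1) (g := e)
    (g' := e') (φ := fun t => 2 * A ^ (2 * m) - 1 / 2 * F t) zero_le_one
    (fun t _ => (hd t).continuousAt.continuousWithinAt) (fun t _ => (hd t).hasDerivWithinAt)
    (Continuous.integrableOn_Icc (by fun_prop)) (fun t ht => ?_)
  · rw [intervalIntegral.integral_sub (by simp) ((by fun_prop : Continuous fun t =>
      1 / 2 * F t).intervalIntegrable _ _), intervalIntegral.integral_const,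
      intervalIntegral.integral_const_mul] at h
    have h0 := abs_le.1 (he 0 (by simp))
    have h1 := abs_le.1 (he 1 (by simp))
    simp only [sub_zero, smul_eq_mul] at h
    linarith
  · have h1 := (abs_le.1 (he' t ⟨ht.1.le, ht.2.le⟩)).2
    have h2 := Real.sq_sqrt (hF0 t)
    have h3 : 1 ≤ A ^ m := one_le_pow₀ (by linarith)
    have h4 : A ^ (2 * m) = (A ^ m) ^ 2 := by rw [mul_comm, pow_mul]
    rw [h4]
    nlinarith [sq_nonneg (A ^ m - √(F t))]

namespace Dat
variable {φ : E3 → ℝ}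

/-- The localized vorticity. -/
def vf (d : Dat) (φ : E3 → ℝ) (j k : Fin 3) (t : ℝ) (x : E3) : ℝ := φ x * d.Om j k t x

lemma vf_JS (d : Dat) (hφ : CS φ) (j k : Fin 3) : JS (d.vf φ j k) :=
  (JS.const hφ.1).mul (d.Om_JS j k)

lemma vf_TF (d : Dat) (hφ : CS φ) (j k : Fin 3) : TF fun t x => tcut t * d.vf φ j k t x :=
  TF.of_CS (d.vf_JS hφ j k) hφ.2.isCompact fun t x hx => by
    simp [vf, image_eq_zero_of_notMem_tsupport hx]

lemma dt_vf_TF (d : Dat) {t : ℝ} (ht : t ∈ Icc (0:ℝ) 1) (q : Sl)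
    (hq : q = sl (d, ⟨t, ht⟩)) (j k : Fin 3) (x : E3) :
    dt (fun t x => tcut t * d.vf φ j k t x) t x = φ x * q.R j k x := by
  have h1 : (fun s => tcut s * d.vf φ j k s x) =ᶠ[𝓝 t] fun s => φ x * d.Om j k s x := by
    have := tcut_eventually (t := t) (by rw [abs_of_nonneg ht.1]; linarith [ht.2])
    exact this.mono fun s hs => by simp only [hs, vf, one_mul]
  have h2 : dt (fun t x => tcut t * d.vf φ j k t x) t x = φ x * dt (d.Om j k) t x := by
    rw [dt, h1.deriv_eq]
    have := ((d.Om_JS j k).hasDerivAt t x).const_mul (φ x)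
    rw [this.deriv, (d.Om_JS j k).dt_eq]
  rw [h2, d.dt_Om ht, hq]
  rfl

lemma energy (hφ : CS φ) : Pol (fun d : Dat =>
    ENNReal.ofReal (∫ t in (0:ℝ)..1, ∑ j, ∑ k, ∫ x,
      (tcut t * d.vf φ j k t x) * (tcut t * d.vf φ j k t x))) fun _ => 1 := by
  have hE : Pol (fun s : Sl => ‖1 / 2 * ∑ j, ∑ k, ∫ x, s.vf φ j k x * G (s.vf φ j k) x‖ₑ)
      fun _ => 1 := by
    choose n hn using fun j k => Sl.integral_vf_mul_le hφ j k
    refine Pol.mono_left (Y := fun s : Sl => ‖(1 / 2 : ℝ)‖ₑ * ∑ j, ∑ k,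
      Wt.a s ^ n j k * H1 (G (s.vf φ j k))) (fun s => ?_) ?_
    · rw [enorm_mul]
      gcongr
      refine (enorm_sum_le _ _).trans (Finset.sum_le_sum fun j _ => (enorm_sum_le _ _).trans
        (Finset.sum_le_sum fun k _ => hn j k s _ (s.vf_CS hφ j k).G_IB.smooth))
    · exact Pol.const_mul (by simp) (Pol.sum _ fun j _ => Pol.sum _ fun k _ =>
        Pol.trans ⟨n j k, fun s => le_rfl⟩ (Sl.H1_G_vf hφ j k))
  obtain ⟨n, hn⟩ := hE
  obtain ⟨m, hm⟩ := Sl.energy_static hφ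
  refine Pol.mono_left (Y := fun d : Dat => 4 * Wt.a d ^ n + 4 * Wt.a d ^ (2 * m)) (fun d => ?_) ?_
  · have hA := d.two_le
    have hT := fun j k => d.vf_TF hφ j k
    have hslice : ∀ t (ht : t ∈ Icc (0:ℝ) 1) j k,
        (fun x => tcut t * d.vf φ j k t x) = (sl (d, ⟨t, ht⟩)).vf φ j k := fun t ht j k => by
      funext x
      rw [tcut_one (by rw [abs_of_nonneg ht.1]; linarith [ht.2]), one_mul]
      rfl
    have key := energy_ode (e := fun t => 1 / 2 * ∑ j, ∑ k, ∫ x,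
        (tcut t * d.vf φ j k t x) * G (fun x => tcut t * d.vf φ j k t x) x)
      (e' := fun t => ∑ j, ∑ k, ∫ x, dt (fun t x => tcut t * d.vf φ j k t x) t x *
        G (fun x => tcut t * d.vf φ j k t x) x)
      (F := fun t => ∑ j, ∑ k, ∫ x, (tcut t * d.vf φ j k t x) * (tcut t * d.vf φ j k t x))
      (n := n) (m := m) hA ?_ ?_ ?_ ?_ ?_
    · refine (ENNReal.ofReal_le_ofReal key).trans_eq ?_
      rw [ENNReal.ofReal_add (by positivity) (by positivity), ENNReal.ofReal_mul (by norm_num),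
        ENNReal.ofReal_mul (by norm_num), ENNReal.ofReal_pow (by linarith),
        ENNReal.ofReal_pow (by linarith)]
      norm_num
      rfl
    · intro t
      have h := (HasDerivAt.fun_sum (u := Finset.univ) fun j _ => HasDerivAt.fun_sum
        (u := Finset.univ) fun k _ => (hT j k).hasDerivAt_energy t).const_mul (1 / 2 : ℝ)
      refine h.congr_deriv ?_
      simp only [← Finset.mul_sum]
      ring
    · exact continuous_finsetSum _ fun j _ => continuous_finsetSum _ fun k _ =>
        (hT j k).continuous_integral_mul (hT j k)
    · exact fun t => Finset.sum_nonneg fun j _ => Finset.sum_nonneg fun k _ =>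
        integral_nonneg fun x => mul_self_nonneg _
    · intro t ht
      have h := hn (sl (d, ⟨t, ht⟩))
      simp only [← hslice] at h
      exact ofReal_pow_mul_bound hA h
    · intro t ht
      have h := hm (sl (d, ⟨t, ht⟩))
      have hF : (sl (d, ⟨t, ht⟩)).F φ = ENNReal.ofReal (∑ j, ∑ k, ∫ x,
          (tcut t * d.vf φ j k t x) * (tcut t * d.vf φ j k t x)) := by
        rw [ENNReal.ofReal_sum_of_nonneg fun j _ => Finset.sum_nonneg fun k _ =>
          integral_nonneg fun x => mul_self_nonneg _]
        refine Finset.sum_congr rfl fun j _ => ?_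
        rw [ENNReal.ofReal_sum_of_nonneg fun k _ => integral_nonneg fun x => mul_self_nonneg _]
        refine Finset.sum_congr rfl fun k _ => ?_
        rw [← hslice t ht j k, ((hT j k).slice t).IB.Np_two]
      simp only [hF] at h
      simp only [dt_vf_TF d ht _ rfl, ← hslice t ht] at h ⊢
      have e : ∀ j k, ∫ x, φ x * (sl (d, ⟨t, ht⟩)).R j k x *
          G (fun x => tcut t * d.vf φ j k t x) x = ∫ x, (sl (d, ⟨t, ht⟩)).R j k x *
          (φ x * G (fun x => tcut t * d.vf φ j k t x) x) := fun j k => by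
        refine integral_congr_ae (ae_of_all _ fun x => ?_)
        simp only []
        ring
      simp only [e]
      have hF0 : 0 ≤ ∑ j, ∑ k, ∫ x, (tcut t * d.vf φ j k t x) * (tcut t * d.vf φ j k t x) :=
        Finset.sum_nonneg fun j _ => Finset.sum_nonneg fun k _ =>
          integral_nonneg fun x => mul_self_nonneg _
      rw [ENNReal.ofReal_rpow_of_nonneg hF0 (by norm_num), ← Real.sqrt_eq_rpow,
        ← ENNReal.ofReal_one, ← ENNReal.ofReal_add (by norm_num) (by positivity)] at h
      have h' : Wt.a (sl (d, ⟨t, ht⟩)) = ENNReal.ofReal d.A := rfl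
      rw [h', ← ENNReal.ofReal_pow (by linarith), ← ENNReal.ofReal_mul (by positivity),
        Real.enorm_eq_ofReal_abs] at h
      exact (ENNReal.ofReal_le_ofReal_iff (by positivity)).1 h
  · have hp : ∀ n : ℕ, Pol (fun d : Dat => Wt.a d ^ n) fun _ => 1 := fun n =>
      ⟨n, fun d => by simp⟩
    exact Pol.add (Pol.const_mul (by simp) (hp n)) (Pol.const_mul (by simp) (hp _))

lemma energy_vf (hφ : CS φ) (j k : Fin 3) : Pol (fun d : Dat =>
    ∫⁻ t in Icc (0:ℝ) 1, Np 2 (d.vf φ j k t)) fun _ => 1 := by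
  refine Pol.mono_left (fun d => ?_) (energy hφ)
  have hT := fun j k => d.vf_TF hφ j k
  rw [intervalIntegral.integral_of_le zero_le_one, ← integral_Icc_eq_integral_Ioc,
    ofReal_integral_eq_lintegral_ofReal]
  · refine setLIntegral_mono' measurableSet_Icc fun t ht => ?_
    have h1 : d.vf φ j k t = fun x => tcut t * d.vf φ j k t x := by
      funext x
      rw [tcut_one (by rw [abs_of_nonneg ht.1]; linarith [ht.2]), one_mul]
    rw [h1, ((hT j k).slice t).IB.Np_two]
    refine ENNReal.ofReal_le_ofReal ?_
    have h0 : ∀ j k, 0 ≤ ∫ x, (tcut t * d.vf φ j k t x) * (tcut t * d.vf φ j k t x) := fun j k =>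
      integral_nonneg fun x => mul_self_nonneg _
    exact (Finset.single_le_sum (f := fun k => ∫ x, (tcut t * d.vf φ j k t x) *
      (tcut t * d.vf φ j k t x)) (fun k _ => h0 j k) (Finset.mem_univ k)).trans
      (Finset.single_le_sum (f := fun j => ∑ k, ∫ x, (tcut t * d.vf φ j k t x) *
      (tcut t * d.vf φ j k t x)) (fun j _ => Finset.sum_nonneg fun k _ => h0 j k)
      (Finset.mem_univ j))
  · exact Continuous.integrableOn_Icc (continuous_finsetSum _ fun j _ =>
      continuous_finsetSum _ fun k _ => (hT j k).continuous_integral_mul (hT j k))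
  · exact ae_of_all _ fun t => Finset.sum_nonneg fun j _ => Finset.sum_nonneg fun k _ =>
      integral_nonneg fun x => mul_self_nonneg _

end Dat

lemma lintegral_four_le_of_weak {f : E3 → ℝ} {W : ℝ} (hW : 0 ≤ W) (hf : Measurable f)
    (hf0 : ∀ x, 0 ≤ f x)
    (hweak : ∀ l, 0 < l → volume {x | l ≤ f x} ≤ ENNReal.ofReal (W * l ^ (-3 : ℝ))) :
    ∫⁻ x, ENNReal.ofReal (f x ^ (4:ℝ)) ≤ (4 * ENNReal.ofReal W + 1) *
      (1 + ∫⁻ x, ENNReal.ofReal (f x ^ (6:ℝ))) ^ (1 / 3 : ℝ) := by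
  set X := ∫⁻ x, ENNReal.ofReal (f x ^ (6:ℝ)) with hX
  by_cases hXt : X = ∞
  · rw [hXt]
    simp [ENNReal.top_rpow_of_pos]
  set Λ : ℝ := (1 + X.toReal) ^ (1 / 3 : ℝ) with hΛ
  have hX0 : 0 ≤ X.toReal := ENNReal.toReal_nonneg
  have hΛ0 : 0 < Λ := by positivity
  have hΛ3 : Λ ^ 3 = 1 + X.toReal := by
    rw [hΛ, ← Real.rpow_natCast, ← Real.rpow_mul (by positivity)]; norm_num
  have eΛ : (1 + X) ^ (1 / 3 : ℝ) = ENNReal.ofReal Λ := by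
    rw [hΛ, ← ENNReal.ofReal_rpow_of_nonneg (by positivity) (by norm_num),
      ENNReal.ofReal_add zero_le_one hX0, ENNReal.ofReal_toReal hXt, ENNReal.ofReal_one]
  have hm : Measurable fun x => min (f x) Λ := hf.min measurable_const
  have hm0 : ∀ x, 0 ≤ min (f x) Λ := fun x => le_min (hf0 x) hΛ0.le
  have h1 : ∫⁻ x, ENNReal.ofReal ((min (f x) Λ) ^ (4:ℝ)) ≤
      4 * ENNReal.ofReal W * ENNReal.ofReal Λ := by
    rw [lintegral_rpow_eq_lintegral_meas_le_mul volume (ae_of_all _ hm0) hm.aemeasurable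
      (by norm_num), mul_assoc]
    have h4 : ENNReal.ofReal 4 = 4 := by simp
    rw [h4]
    gcongr
    have : ∀ t ∈ Ioi (0:ℝ), volume {x | t ≤ min (f x) Λ} * ENNReal.ofReal (t ^ ((4:ℝ) - 1)) ≤
        (Ioc 0 Λ).indicator (fun _ => ENNReal.ofReal W) t := by
      intro t ht
      have ht : 0 < t := ht
      by_cases htΛ : t ≤ Λ
      · rw [indicator_of_mem (show t ∈ Ioc 0 Λ from ⟨ht, htΛ⟩)]
        calc _ ≤ ENNReal.ofReal (W * t ^ (-3:ℝ)) * ENNReal.ofReal (t ^ ((4:ℝ) - 1)) := by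
              gcongr
              refine (measure_mono fun x hx => ?_).trans (hweak t ht)
              exact le_trans (show t ≤ min (f x) Λ from hx) (min_le_left _ _)
          _ = _ := by
              rw [← ENNReal.ofReal_mul (by positivity), mul_assoc, ← Real.rpow_add ht]
              norm_num
      · have : {x | t ≤ min (f x) Λ} = ∅ := by
          ext x
          simp only [mem_ofPred_eq, mem_empty_iff_false, iff_false, not_le]
          exact lt_of_le_of_lt (min_le_right _ _) (not_le.1 htΛ)
        rw [this]
        simp
    calc _ ≤ ∫⁻ t in Ioi (0:ℝ), (Ioc 0 Λ).indicator (fun _ => ENNReal.ofReal W) t :=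
          setLIntegral_mono' measurableSet_Ioi this
      _ ≤ ∫⁻ t, (Ioc 0 Λ).indicator (fun _ => ENNReal.ofReal W) t := setLIntegral_le_lintegral _ _
      _ = _ := by
          rw [lintegral_indicator measurableSet_Ioc]
          simp
  have h2 : ∀ x, ENNReal.ofReal (f x ^ (4:ℝ)) ≤ ENNReal.ofReal ((min (f x) Λ) ^ (4:ℝ)) +
      ENNReal.ofReal (Λ⁻¹ ^ 2) * ENNReal.ofReal (f x ^ (6:ℝ)) := by
    intro x
    rw [← ENNReal.ofReal_mul (by positivity), ← ENNReal.ofReal_add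
      (Real.rpow_nonneg (hm0 x) _) (by have := hf0 x; positivity)]
    refine ENNReal.ofReal_le_ofReal ?_
    have h0 := hf0 x
    rcases le_total (f x) Λ with h | h
    · rw [min_eq_left h]
      have : 0 ≤ Λ⁻¹ ^ 2 * f x ^ (6:ℝ) := by positivity
      linarith
    · rw [min_eq_right h]
      have h5 : f x ^ (4:ℝ) ≤ Λ⁻¹ ^ 2 * f x ^ (6:ℝ) := by
        have e4 : f x ^ (4:ℝ) = f x ^ 4 := by exact_mod_cast Real.rpow_natCast (f x) 4
        have e6 : f x ^ (6:ℝ) = f x ^ 6 := by exact_mod_cast Real.rpow_natCast (f x) 6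
        rw [e4, e6, inv_pow, inv_mul_eq_div, le_div_iff₀ (by positivity)]
        calc f x ^ 4 * Λ ^ 2 ≤ f x ^ 4 * f x ^ 2 := by gcongr
          _ = _ := by ring
      have : 0 ≤ Λ ^ (4:ℝ) := by positivity
      linarith
  calc _ ≤ ∫⁻ x, (ENNReal.ofReal ((min (f x) Λ) ^ (4:ℝ)) +
        ENNReal.ofReal (Λ⁻¹ ^ 2) * ENNReal.ofReal (f x ^ (6:ℝ))) := lintegral_mono h2
    _ = (∫⁻ x, ENNReal.ofReal ((min (f x) Λ) ^ (4:ℝ))) + ENNReal.ofReal (Λ⁻¹ ^ 2) * X := by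
        rw [lintegral_add_left (by fun_prop), lintegral_const_mul' _ _ (by finiteness)]
    _ ≤ 4 * ENNReal.ofReal W * ENNReal.ofReal Λ + ENNReal.ofReal Λ := by
        gcongr
        rw [← ENNReal.ofReal_toReal hXt, ← ENNReal.ofReal_mul (by positivity)]
        refine ENNReal.ofReal_le_ofReal ?_
        rw [inv_pow, inv_mul_eq_div, div_le_iff₀ (by positivity)]
        have : Λ * Λ ^ 2 = 1 + X.toReal := by rw [← hΛ3]; ring
        linarith
    _ = _ := by rw [eΛ]; ring

lemma Np_six_le : ∃ C : ℝ≥0∞, C ≠ ∞ ∧ ∀ g : E3 → ℝ, CS g →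
    Np 6 g ≤ C * (∑ i, Np 2 (pd g i)) ^ 3 := by
  set K : ℝ≥0∞ := (SNormLESNormFDerivOfEqConst ℝ (volume : Measure E3) ((2:ℝ≥0):ℝ) : ℝ≥0∞)
  refine ⟨K ^ (6:ℝ) * (3 ^ (3:ℝ)), by finiteness, fun g hg => ?_⟩
  have h := eLpNorm_le_eLpNorm_fderiv_of_eq (μ := (volume : Measure E3)) (u := g)
    (p := 2) (p' := 6) (hg.1.of_le (by exact_mod_cast le_top)) hg.2 (by norm_num) (by simp)
    (by norm_num)
  have e6 : eLpNorm g 6 volume = Np 6 g ^ (1 / (6:ℝ)) := by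
    rw [eLpNorm_eq_lintegral_rpow_enorm_toReal (by norm_num) (by norm_num)]
    simp [Np]
  have e2 : eLpNorm (fderiv ℝ g) 2 volume =
      (∫⁻ x, ‖fderiv ℝ g x‖ₑ ^ (2:ℝ)) ^ (1 / (2:ℝ)) := by
    rw [eLpNorm_eq_lintegral_rpow_enorm_toReal (by norm_num) (by norm_num)]
    simp
  have c6 : ((6:ℝ≥0) : ℝ≥0∞) = 6 := by norm_num
  have c2 : ((2:ℝ≥0) : ℝ≥0∞) = 2 := by norm_num
  rw [c6, c2, e6, e2] at h
  have h3 : ∫⁻ x, ‖fderiv ℝ g x‖ₑ ^ (2:ℝ) ≤ 3 * ∑ i, Np 2 (pd g i) := by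
    unfold Np
    rw [← lintegral_finsetSum _ fun i _ => ((hg.dpd i).continuous.measurable.enorm.pow_const _),
      ← lintegral_const_mul' _ _ (by finiteness)]
    refine lintegral_mono fun x => ?_
    have h4 : ‖fderiv ℝ g x‖ₑ ≤ ∑ i, ‖pd g i x‖ₑ := by
      rw [fderiv_eq_sum_pd g x]
      refine (enorm_sum_le (Finset.univ : Finset (Fin 3)) (fun i => pd g i x • (EuclideanSpace.proj i : E3 →L[ℝ] ℝ))).trans (Finset.sum_le_sum fun i _ => ?_)
      rw [enorm_smul]
      refine (mul_le_mul' le_rfl ?_).trans_eq (mul_one _)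
      rw [← ofReal_norm]
      refine ENNReal.ofReal_le_one.2 (ContinuousLinearMap.opNorm_le_bound _ zero_le_one fun y => ?_)
      rw [one_mul]
      exact PiLp.norm_apply_le y i
    refine (ENNReal.rpow_le_rpow h4 (by norm_num)).trans ?_
    have h5 := ENNReal.rpow_sum_le_const_mul_sum_rpow (Finset.univ : Finset (Fin 3))
      (fun i => ‖pd g i x‖ₑ) (p := 2) (by norm_num)
    refine h5.trans_eq ?_
    norm_num
  calc Np 6 g = (Np 6 g ^ (1 / (6:ℝ))) ^ (6:ℝ) := by rw [← ENNReal.rpow_mul]; norm_num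
    _ ≤ (K * (3 * ∑ i, Np 2 (pd g i)) ^ (1 / (2:ℝ))) ^ (6:ℝ) := by
        gcongr
        exact h.trans (by gcongr)
    _ = K ^ (6:ℝ) * (3 ^ (3:ℝ)) * (∑ i, Np 2 (pd g i)) ^ 3 := by
        rw [ENNReal.mul_rpow_of_nonneg _ _ (by norm_num), ← ENNReal.rpow_mul, mul_assoc,
          ← ENNReal.rpow_natCast]
        norm_num only
        rw [ENNReal.mul_rpow_of_nonneg _ _ (by norm_num)]

lemma integral_div_curl {g : Fin 3 → E3 → ℝ} (hg : ∀ i, CS (g i)) :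
    ∑ j, ∑ k, ∫ x, pd (g k) j x * pd (g k) j x =
      (∑ j, ∑ k, ∫ x, (pd (g k) j x - pd (g j) k x) * (pd (g k) j x - pd (g j) k x)) / 2 +
      ∫ x, (∑ j, pd (g j) j x) * ∑ j, pd (g j) j x := by
  have hI : ∀ i j k l, Integrable fun x => pd (g i) j x * pd (g k) l x := fun i j k l =>
    (CS.mul (contDiff_pd (hg i).1 j) ((hg k).dpd l)).integrable
  have hs : ∀ j k, ∫ x, pd (g k) j x * pd (g j) k x = ∫ x, pd (g k) k x * pd (g j) j x := by
    intro j k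
    have h1 := CS.integral_mul_pd k (contDiff_pd (hg k).1 j) (hg j)
    have h2 := CS.integral_mul_pd j (contDiff_pd (hg k).1 k) (hg j)
    rw [h1, h2, pd_comm (hg k).1 j k]
  have e1 : ∀ j k, ∫ x, (pd (g k) j x - pd (g j) k x) * (pd (g k) j x - pd (g j) k x) =
      (∫ x, pd (g k) j x * pd (g k) j x) + (∫ x, pd (g j) k x * pd (g j) k x) -
        2 * ∫ x, pd (g k) k x * pd (g j) j x := by
    intro j k
    have hA : Integrable fun x => pd (g k) j x * pd (g k) j x + pd (g j) k x * pd (g j) k x :=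
      (hI _ _ _ _).add (hI _ _ _ _)
    have hB : Integrable fun x => 2 * (pd (g k) j x * pd (g j) k x) := (hI _ _ _ _).const_mul 2
    rw [← hs, ← integral_const_mul, ← integral_add (hI _ _ _ _) (hI _ _ _ _), ← integral_sub hA hB]
    refine integral_congr_ae (ae_of_all _ fun x => ?_)
    simp only []
    ring
  have e2 : ∫ x, (∑ j, pd (g j) j x) * ∑ j, pd (g j) j x =
      ∑ j, ∑ k, ∫ x, pd (g k) k x * pd (g j) j x := by
    simp only [Finset.sum_mul_sum]
    rw [integral_finsetSum _ fun j _ => integrable_finsetSum _ fun k _ => hI _ _ _ _]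
    rw [Finset.sum_comm]
    refine Finset.sum_congr rfl fun k _ => ?_
    rw [integral_finsetSum _ fun j _ => hI _ _ _ _]
  have e3 : ∑ j, ∑ k, ∫ x, pd (g j) k x * pd (g j) k x =
      ∑ j, ∑ k, ∫ x, pd (g k) j x * pd (g k) j x := Finset.sum_comm
  simp only [e1, Finset.sum_sub_distrib, Finset.sum_add_distrib, ← Finset.mul_sum, e2]
  rw [e3]
  ring

namespace Sl
variable {φ : E3 → ℝ}

lemma Np_pd_w (hφ : CS φ) (k j : Fin 3) :
    Pol (fun s : Sl => Np 2 (pd (s.w φ k) j)) fun s => 1 + s.F φ := by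
  refine Pol.mono_left (Y := fun s : Sl => (∑ j, ∑ k, 2 ^ ((2:ℝ) - 1) * (Np 2 (s.vf φ j k) +
    nm 2 (s.cm φ j k) * nm 2 (s.cm φ j k))) + nm 2 (s.dv φ) * nm 2 (s.dv φ)) (fun s => ?_) ?_
  · have hw := s.w_CS hφ
    have hE : ∀ j k, Np 2 (fun x => pd (s.w φ k) j x - pd (s.w φ j) k x) ≤ 2 ^ ((2:ℝ) - 1) *
        (Np 2 (s.vf φ j k) + nm 2 (s.cm φ j k) * nm 2 (s.cm φ j k)) := by
      intro j k
      rw [nm_two_sq]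
      have : (fun x => pd (s.w φ k) j x - pd (s.w φ j) k x) =
          fun x => s.vf φ j k x + s.cm φ j k x := by
        rw [s.vf_eq hφ]; funext x; ring
      rw [this]
      exact Np_add_le (by norm_num) (s.vf_CS hφ j k).continuous.measurable
    have hD : ∀ j k, CS fun x => pd (s.w φ k) j x - pd (s.w φ j) k x := fun j k =>
      ((hw k).dpd j).sub ((hw j).dpd k)
    have h0 : ∀ j k, 0 ≤ ∫ x, pd (s.w φ k) j x * pd (s.w φ k) j x := fun j k =>
      integral_nonneg fun x => mul_self_nonneg _
    have h1 : ∀ j k, 0 ≤ ∫ x, (pd (s.w φ k) j x - pd (s.w φ j) k x) *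
        (pd (s.w φ k) j x - pd (s.w φ j) k x) := fun j k =>
      integral_nonneg fun x => mul_self_nonneg _
    have h2 : 0 ≤ ∫ x, s.dv φ x * s.dv φ x := integral_nonneg fun x => mul_self_nonneg _
    calc Np 2 (pd (s.w φ k) j)
        = ENNReal.ofReal (∫ x, pd (s.w φ k) j x * pd (s.w φ k) j x) :=
          ((hw k).dpd j).IB.Np_two
      _ ≤ ENNReal.ofReal ((∑ j, ∑ k, ∫ x, (pd (s.w φ k) j x - pd (s.w φ j) k x) *
          (pd (s.w φ k) j x - pd (s.w φ j) k x)) + ∫ x, s.dv φ x * s.dv φ x) := by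
          refine ENNReal.ofReal_le_ofReal ?_
          refine ((Finset.single_le_sum (f := fun k => ∫ x, pd (s.w φ k) j x * pd (s.w φ k) j x)
            (fun k _ => h0 j k) (Finset.mem_univ k)).trans (Finset.single_le_sum
            (f := fun j => ∑ k, ∫ x, pd (s.w φ k) j x * pd (s.w φ k) j x)
            (fun j _ => Finset.sum_nonneg fun k _ => h0 j k) (Finset.mem_univ j))).trans ?_
          rw [integral_div_curl hw]
          simp only [s.sum_pd_w hφ]
          have : 0 ≤ ∑ j, ∑ k, ∫ x, (pd (s.w φ k) j x - pd (s.w φ j) k x) *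
            (pd (s.w φ k) j x - pd (s.w φ j) k x) :=
            Finset.sum_nonneg fun j _ => Finset.sum_nonneg fun k _ => h1 j k
          linarith
      _ = (∑ j, ∑ k, Np 2 (fun x => pd (s.w φ k) j x - pd (s.w φ j) k x)) + Np 2 (s.dv φ) := by
          rw [ENNReal.ofReal_add (Finset.sum_nonneg fun j _ => Finset.sum_nonneg fun k _ => h1 j k)
            h2, (s.dv_CS hφ).IB.Np_two,
            ENNReal.ofReal_sum_of_nonneg fun j _ => Finset.sum_nonneg fun k _ => h1 j k]
          congr 1
          refine Finset.sum_congr rfl fun j _ => ?_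
          rw [ENNReal.ofReal_sum_of_nonneg fun k _ => h1 j k]
          exact Finset.sum_congr rfl fun k _ => (hD j k).IB.Np_two.symm
      _ ≤ _ := by
          rw [nm_two_sq (s.dv φ)]
          gcongr
          exact hE _ _
  · refine Pol.add (Pol.sum _ fun j _ => Pol.sum _ fun k _ => Pol.const_mul (by finiteness)
      (Pol.add ?_ ?_)) ?_
    · exact Pol.of_le fun s => (s.Np_vf_le φ j k).trans le_add_self
    · exact ((nm_cm hφ j k (by norm_num) (by norm_num)).mul_one
        (nm_cm hφ j k (by norm_num) (by norm_num))).mono_right fun s => le_self_add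
    · exact ((nm_dv hφ (by norm_num) (by norm_num)).mul_one
        (nm_dv hφ (by norm_num) (by norm_num))).mono_right fun s => le_self_add

lemma Np_four_w (hφ : CS φ) (k : Fin 3) :
    Pol (fun s : Sl => Np 4 (s.w φ k)) fun s => 1 + s.F φ := by
  obtain ⟨M, hM⟩ := hφ.bdd
  obtain ⟨C, hC, h6⟩ := Np_six_le
  set B : ℝ := max M 1
  have hB1 : 1 ≤ B := le_max_right _ _
  have hB0 : 0 < B := by linarith
  refine Pol.mono_left (Y := fun s : Sl => (4 * (Wt.a s ^ 3 * ENNReal.ofReal (B ^ 3)) + 1) *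
    (1 + C * (∑ i, Np 2 (pd (s.w φ k) i)) ^ 3) ^ (1 / 3 : ℝ)) (fun s => ?_) ?_
  · have hA : 0 ≤ s.A := by linarith [s.two_le]
    have hm : Measurable fun x => |s.w φ k x| := (s.w_CS hφ k).continuous.abs.measurable
    have h := lintegral_four_le_of_weak (W := s.A ^ 3 * B ^ 3) (by positivity) hm
      (fun x => abs_nonneg _) fun l hl => by
        refine ((measure_mono fun x hx => ?_).trans (s.weak k (l / B) (by positivity))).trans ?_
        · change l / B ≤ |s.v k x|
          rw [div_le_iff₀ hB0]
          have hx : l ≤ |φ x * s.v k x| := hx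
          rw [abs_mul] at hx
          nlinarith [(hM x).trans (le_max_left M 1), abs_nonneg (s.v k x)]
        · refine ENNReal.ofReal_le_ofReal (le_of_eq ?_)
          rw [Real.div_rpow hl.le hB0.le, Real.rpow_neg hB0.le, Real.rpow_neg hl.le]
          have : B ^ (3:ℝ) = B ^ 3 := by exact_mod_cast Real.rpow_natCast B 3
          rw [this]
          field_simp
    have e : ∀ q : ℝ, 0 ≤ q → ∫⁻ x, ENNReal.ofReal (|s.w φ k x| ^ q) = Np q (s.w φ k) :=
      fun q hq => lintegral_congr fun x => (enorm_rpow_eq _ _ hq).symm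
    rw [e 4 (by norm_num), e 6 (by norm_num), ENNReal.ofReal_mul (by positivity),
      ENNReal.ofReal_pow hA] at h
    refine h.trans ?_
    have : ENNReal.ofReal s.A = Wt.a s := rfl
    rw [this]
    gcongr
    exact h6 _ (s.w_CS hφ k)
  · refine Pol.one_mul ?_ ?_
    · refine Pol.add (Pol.const_mul (by finiteness) (Pol.mul_const (by finiteness) ?_)) (Pol.refl _)
      exact ⟨3, fun s => by simp⟩
    · have h1 : Pol (fun s : Sl => ∑ i, Np 2 (pd (s.w φ k) i)) fun s => 1 + s.F φ :=
        Pol.sum _ fun i _ => Np_pd_w hφ k i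
      have h2 := h1.rpow (r := 3) (by norm_num)
      have h3 : Pol (fun s : Sl => 1 + C * (∑ i, Np 2 (pd (s.w φ k) i)) ^ 3)
          fun s => (1 + s.F φ) ^ (3:ℝ) := by
        refine Pol.add (Pol.of_le fun s => ?_) (Pol.const_mul hC ?_)
        · exact ENNReal.one_le_rpow le_self_add (by norm_num)
        · refine Pol.mono_left (fun s => le_of_eq ?_) h2
          exact (ENNReal.rpow_natCast _ 3).symm
      refine (h3.rpow (r := 1 / 3) (by norm_num)).mono_right fun s => le_of_eq ?_
      rw [← ENNReal.rpow_mul]; norm_num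

end Sl

namespace Dat
variable {φ : E3 → ℝ}

/-- A localized component of the velocity. -/
def w (d : Dat) (φ : E3 → ℝ) (k : Fin 3) (t : ℝ) (x : E3) : ℝ := φ x * d.v k t x

lemma lintegral_static (hφ : CS φ) {X : Dat → ℝ → ℝ≥0∞} {Z : Sl → ℝ≥0∞}
    (hZ : Pol Z fun s => 1 + s.F φ) (h : ∀ d t (ht : t ∈ Icc (0:ℝ) 1), X d t ≤ Z (sl (d, ⟨t, ht⟩))) :
    Pol (fun d => ∫⁻ t in Icc (0:ℝ) 1, X d t) fun _ => 1 := by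
  obtain ⟨n, hn⟩ := hZ
  have hm : ∀ (d : Dat) j k, Measurable fun t => Np 2 (d.vf φ j k t) := fun d j k =>
    ((d.vf_JS hφ j k).measurable.enorm.pow_const 2).lintegral_prod_right'
  refine Pol.mono_left (Y := fun d : Dat => Wt.a d ^ n * (1 + ∑ j, ∑ k,
    ∫⁻ t in Icc (0:ℝ) 1, Np 2 (d.vf φ j k t))) (fun d => ?_) ?_
  · have ha : Wt.a d = ENNReal.ofReal d.A := rfl
    have e : ∫⁻ t in Icc (0:ℝ) 1, (1 + ∑ j, ∑ k, Np 2 (d.vf φ j k t)) = 1 + ∑ j, ∑ k,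
        ∫⁻ t in Icc (0:ℝ) 1, Np 2 (d.vf φ j k t) := by
      rw [lintegral_add_left measurable_const, lintegral_finsetSum _ fun j _ =>
        Finset.measurable_fun_sum _ fun k _ => hm d j k]
      simp [lintegral_finsetSum _ fun k _ => hm d _ k]
    rw [← e, ← lintegral_const_mul' _ _ (by rw [ha]; finiteness)]
    exact setLIntegral_mono' measurableSet_Icc fun t ht => (h d t ht).trans (hn (sl (d, ⟨t, ht⟩)))
  · refine Pol.one_mul ⟨n, fun d => by simp⟩ (Pol.add (Pol.refl _) ?_)
    exact Pol.sum _ fun j _ => Pol.sum _ fun k _ => energy_vf hφ j k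

lemma energy_pd_w (hφ : CS φ) (k j : Fin 3) :
    Pol (fun d : Dat => ∫⁻ t in Icc (0:ℝ) 1, Np 2 (pd (d.w φ k t) j)) fun _ => 1 :=
  lintegral_static hφ (Sl.Np_pd_w hφ k j) fun _ _ _ => le_rfl

lemma energy_four_w (hφ : CS φ) (k : Fin 3) :
    Pol (fun d : Dat => ∫⁻ t in Icc (0:ℝ) 1, Np 4 (d.w φ k t)) fun _ => 1 :=
  lintegral_static hφ (Sl.Np_four_w hφ k) fun _ _ _ => le_rfl

end Dat

/-- Space-time measure on `[0,1] × ℝ³`. -/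
def stm : Measure (ℝ × E3) := (volume.restrict (Icc 0 1)).prod volume

instance : SFinite stm := by unfold stm; infer_instance

/-- Space-time integral of a `p`-th power. -/
def NP (p : ℝ) (F : ℝ → E3 → ℝ≥0∞) : ℝ≥0∞ := ∫⁻ q, F q.1 q.2 ^ p ∂stm

section
variable {F H : ℝ → E3 → ℝ≥0∞} {p : ℝ}

lemma ae_stm : ∀ᵐ q ∂stm, q.1 ∈ Icc (0:ℝ) 1 := by
  have h : ∀ᵐ t ∂(volume.restrict (Icc (0:ℝ) 1)), t ∈ Icc (0:ℝ) 1 :=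
    ae_restrict_mem measurableSet_Icc
  exact Measure.quasiMeasurePreserving_fst.ae h

lemma NP_mono (hp : 0 ≤ p) (h : ∀ t ∈ Icc (0:ℝ) 1, ∀ x, F t x ≤ H t x) : NP p F ≤ NP p H := by
  refine lintegral_mono_ae ?_
  filter_upwards [ae_stm] with q hq
  exact ENNReal.rpow_le_rpow (h _ hq _) hp

lemma NP_eq (hF : Measurable (Function.uncurry F)) :
    NP p F = ∫⁻ t in Icc (0:ℝ) 1, ∫⁻ x, F t x ^ p := by
  unfold NP stm
  rw [lintegral_prod]
  exact (hF.pow_const p).aemeasurable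

lemma NP_add_le (hp : 1 ≤ p) (hF : Measurable (Function.uncurry F)) :
    NP p (fun t x => F t x + H t x) ≤ 2 ^ (p - 1) * (NP p F + NP p H) := by
  unfold NP
  have h1 : Measurable fun q : ℝ × E3 => F q.1 q.2 ^ p := hF.pow_const p
  rw [← lintegral_add_left h1, ← lintegral_const_mul' _ _
    (ENNReal.rpow_ne_top_of_nonneg (by linarith) (by norm_num))]
  exact lintegral_mono fun q => ENNReal.rpow_add_le_mul_rpow_add_rpow _ _ hp

lemma NP_zero (hp : 0 < p) : NP p (fun _ _ => 0) = 0 := by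
  unfold NP
  simp [ENNReal.zero_rpow_of_pos hp]

lemma NP_const_mul (c : ℝ≥0∞) (hc : c ≠ ∞) (hp : 0 ≤ p) :
    NP p (fun t x => c * F t x) = c ^ p * NP p F := by
  unfold NP
  simp_rw [ENNReal.mul_rpow_of_nonneg _ _ hp]
  rw [lintegral_const_mul' _ _ (ENNReal.rpow_ne_top_of_nonneg hp hc)]

lemma NP_mul_le (hF : Measurable (Function.uncurry F)) (hH : Measurable (Function.uncurry H))
    {q₁ q₂ α β : ℝ} (hα : 0 ≤ α) (hβ : 0 ≤ β) (hab : α + β = 1) (h1 : q₁ * α = p)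
    (h2 : q₂ * β = p) (hp : 0 ≤ p) :
    NP p (fun t x => F t x * H t x) ≤ NP q₁ F ^ α * NP q₂ H ^ β := by
  have h := ENNReal.lintegral_mul_norm_pow_le (μ := stm)
    (f := fun q : ℝ × E3 => F q.1 q.2 ^ q₁) (g := fun q : ℝ × E3 => H q.1 q.2 ^ q₂)
    (hF.pow_const q₁).aemeasurable (hH.pow_const q₂).aemeasurable hα hβ hab
  refine le_trans (le_of_eq ?_) h
  unfold NP
  refine lintegral_congr fun q => ?_
  rw [← ENNReal.rpow_mul, ← ENNReal.rpow_mul, h1, h2, ENNReal.mul_rpow_of_nonneg _ _ hp]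

lemma NP_interp (hF : Measurable (Function.uncurry F))
    {q₁ q₂ α β : ℝ} (hα : 0 ≤ α) (hβ : 0 ≤ β) (hab : α + β = 1) (hq1 : 0 ≤ q₁) (hq2 : 0 ≤ q₂)
    (h : q₁ * α + q₂ * β = p) :
    NP p F ≤ NP q₁ F ^ α * NP q₂ F ^ β := by
  have h' := ENNReal.lintegral_mul_norm_pow_le (μ := stm)
    (f := fun q : ℝ × E3 => F q.1 q.2 ^ q₁) (g := fun q : ℝ × E3 => F q.1 q.2 ^ q₂)
    (hF.pow_const q₁).aemeasurable (hF.pow_const q₂).aemeasurable hα hβ hab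
  refine le_trans (le_of_eq ?_) h'
  unfold NP
  refine lintegral_congr fun q => ?_
  rw [← ENNReal.rpow_mul, ← ENNReal.rpow_mul,
    ← ENNReal.rpow_add_of_nonneg _ _ (by positivity) (by positivity), h]

lemma NP_trans (hF : Measurable (Function.uncurry F)) (y : E3) :
    NP p (fun t x => F t (x - y)) = NP p F := by
  have h : Measurable (Function.uncurry fun t x => F t (x - y)) :=
    hF.comp (by fun_prop : Measurable fun q : ℝ × E3 => (q.1, q.2 - y))
  rw [NP_eq h, NP_eq hF]
  refine lintegral_congr fun t => ?_
  exact lintegral_sub_right_eq_self (fun x => F t x ^ p) y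

lemma NP_shift (hp : 0 < p) (hF : Measurable (Function.uncurry F)) (h0 : ∀ t < 0, ∀ x, F t x = 0)
    {r : ℝ} (hr : 0 ≤ r) : NP p (fun t x => F (t - r) x) ≤ NP p F := by
  have h : Measurable (Function.uncurry fun t x => F (t - r) x) :=
    hF.comp (by fun_prop : Measurable fun q : ℝ × E3 => (q.1 - r, q.2))
  rw [NP_eq h, NP_eq hF, ← lintegral_indicator measurableSet_Icc,
    ← lintegral_indicator measurableSet_Icc]
  rw [← lintegral_sub_right_eq_self (fun t => (Icc (0:ℝ) 1).indicator
    (fun t => ∫⁻ x, F t x ^ p) t) r]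
  refine lintegral_mono fun t => ?_
  by_cases ht : t ∈ Icc (0:ℝ) 1
  · rw [indicator_of_mem ht]
    by_cases ht' : t - r ∈ Icc (0:ℝ) 1
    · rw [indicator_of_mem ht']
    · have : t - r < 0 := by
        by_contra h1
        exact ht' ⟨not_lt.1 h1, by linarith [ht.2]⟩
      simp [h0 _ this, ENNReal.zero_rpow_of_pos hp]
  · rw [indicator_of_notMem ht]; exact bot_le

lemma NP_sum_le {κ : Type*} (s : Finset κ) (hp : 1 ≤ p) : ∃ C : ℝ≥0∞, C ≠ ∞ ∧
    ∀ F : κ → ℝ → E3 → ℝ≥0∞, (∀ k ∈ s, Measurable (Function.uncurry (F k))) →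
      NP p (fun t x => ∑ k ∈ s, F k t x) ≤ C * ∑ k ∈ s, NP p (F k) := by
  classical
  induction s using Finset.induction_on with
  | empty => exact ⟨0, by simp, fun F _ => by simp [NP_zero (by linarith : 0 < p)]⟩
  | insert k s hk ih =>
    obtain ⟨C, hC, h⟩ := ih
    refine ⟨2 ^ (p - 1) * (1 + C), ENNReal.mul_ne_top
      (ENNReal.rpow_ne_top_of_nonneg (by linarith) (by norm_num)) (by simp [hC]), fun F hF => ?_⟩
    simp only [Finset.sum_insert hk]
    refine (NP_add_le hp (hF k (by simp))).trans ?_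
    rw [mul_assoc]
    gcongr
    calc NP p (F k) + NP p (fun t x => ∑ k ∈ s, F k t x) ≤
        NP p (F k) + C * ∑ k ∈ s, NP p (F k) := by
          gcongr; exact h F fun l hl => hF l (by simp [hl])
      _ ≤ (1 + C) * (NP p (F k) + ∑ k ∈ s, NP p (F k)) := by
          rw [add_mul, one_mul, mul_add C]
          exact add_le_add le_self_add le_add_self
end

lemma JS.enorm_measurable {F : ℝ → E3 → ℝ} (hF : JS F) :
    Measurable (Function.uncurry fun t x => ‖F t x‖ₑ) := hF.measurable.enorm

/-- Spatial increment. -/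
def inc (y : E3) (F : ℝ → E3 → ℝ) (t : ℝ) (x : E3) : ℝ := F t (x - y) - F t x

lemma JS.comp_sub {F : ℝ → E3 → ℝ} (hF : JS F) (y : E3) : JS fun t x => F t (x - y) := by
  have h : ContDiff ℝ (⊤:ℕ∞) fun q : ℝ × E3 => (q.1, q.2 - y) := by fun_prop
  exact ContDiff.comp hF h

lemma JS.inc {F : ℝ → E3 → ℝ} (hF : JS F) (y : E3) : JS (inc y F) := (hF.comp_sub y).sub hF

lemma abs_inc_le {g : E3 → ℝ} (hg : ContDiff ℝ (⊤:ℕ∞) g) (x y : E3) :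
    ‖g (x - y) - g x‖ₑ ≤ ‖y‖ₑ * ∫⁻ r in Icc (0:ℝ) 1, ∑ i, ‖pd g i (x - r • y)‖ₑ := by
  have hd : ∀ r : ℝ, HasDerivAt (fun r : ℝ => g (x - r • y)) (fderiv ℝ g (x - r • y) (-y)) r := by
    intro r
    have h1 : HasDerivAt (fun r : ℝ => x - r • y) (-y) r := by
      simpa using ((hasDerivAt_id r).smul_const y).const_sub x
    exact ((hg.differentiable (by simp) _).hasFDerivAt).comp_hasDerivAt r h1
  have hc : Continuous fun r : ℝ => fderiv ℝ g (x - r • y) (-y) := by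
    have := hg.continuous_fderiv (by simp)
    fun_prop
  have h2 := intervalIntegral.integral_eq_sub_of_hasDerivAt (a := 0) (b := 1)
    (fun r _ => hd r) (hc.intervalIntegrable _ _)
  simp only [one_smul, zero_smul, sub_zero] at h2
  rw [← h2, intervalIntegral.integral_of_le zero_le_one, ← integral_Icc_eq_integral_Ioc]
  refine (enorm_integral_le_lintegral_enorm _).trans ?_
  rw [← lintegral_const_mul' _ _ enorm_ne_top]
  refine lintegral_mono fun r => ?_
  rw [fderiv_eq_sum_pd]
  simp only [sum_apply, smul_apply, smul_eq_mul,
    PiLp.proj_apply]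
  refine (enorm_sum_le Finset.univ _).trans ?_
  rw [Finset.mul_sum]
  refine Finset.sum_le_sum fun i _ => ?_
  rw [enorm_mul, mul_comm]
  gcongr
  rw [PiLp.neg_apply, enorm_neg]
  rw [← ofReal_norm, ← ofReal_norm]
  exact ENNReal.ofReal_le_ofReal (PiLp.norm_apply_le y i)

lemma NP_inc_le_of_slice {p : ℝ} (hp : 1 ≤ p) : ∃ C : ℝ≥0∞, C ≠ ∞ ∧ ∀ F : ℝ → E3 → ℝ,
    (∀ t, ContDiff ℝ (⊤:ℕ∞) (F t)) →
    (∀ i, Measurable (Function.uncurry fun t x => ‖pd (F t) i x‖ₑ)) → ∀ y,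
    NP p (fun t x => ‖inc y F t x‖ₑ) ≤
      ENNReal.ofReal (‖y‖ ^ p) * (C * ∑ i, NP p (fun t x => ‖pd (F t) i x‖ₑ)) := by
  obtain ⟨C, hC, h⟩ := NP_sum_le (p := p) (Finset.univ : Finset (Fin 3)) hp
  refine ⟨C, hC, fun F hF hm y => ?_⟩
  have h1 : NP p (fun t x => ‖inc y F t x‖ₑ) ≤
      NP p (fun t x => ‖y‖ₑ * ∫⁻ r in Icc (0:ℝ) 1, ∑ i, ‖pd (F t) i (x - r • y)‖ₑ) :=
    NP_mono (by linarith) fun t _ x => abs_inc_le (hF t) x y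
  refine h1.trans ?_
  rw [NP_const_mul _ enorm_ne_top (by linarith), ← ofReal_norm,
    ENNReal.ofReal_rpow_of_nonneg (norm_nonneg _) (by linarith)]
  gcongr
  have hms : Measurable (Function.uncurry fun t x => ∑ i, ‖pd (F t) i x‖ₑ) := by
    have : Measurable fun q : ℝ × E3 => ∑ i, ‖pd (F q.1) i q.2‖ₑ :=
      Finset.measurable_fun_sum _ fun i _ => hm i
    exact this
  have hm2 : Measurable fun z : ℝ × ℝ × E3 => ∑ i, ‖pd (F z.2.1) i (z.2.2 - z.1 • y)‖ₑ := by
    have h3 : Measurable fun z : ℝ × ℝ × E3 => (z.2.1, z.2.2 - z.1 • y) := by fun_prop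
    exact Finset.measurable_fun_sum _ fun i _ => (hm i).comp h3
  have h2 := lintegral_rpow_lintegral_le (volume.restrict (Icc (0:ℝ) 1)) stm
    (w := fun _ => 1) (F := fun r (q : ℝ × E3) => ∑ i, ‖pd (F q.1) i (q.2 - r • y)‖ₑ)
    measurable_const hm2 hp
    (N := NP p (fun t x => ∑ i, ‖pd (F t) i x‖ₑ)) (fun r => (NP_trans hms (r • y)).le)
  have h4 : ∫⁻ _ in Icc (0:ℝ) 1, (1:ℝ≥0∞) = 1 := by simp
  rw [h4, ENNReal.one_rpow, one_mul] at h2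
  simp only [one_mul] at h2
  exact h2.trans (h _ fun i _ => hm i)

lemma NP_inc_le {p : ℝ} (hp : 1 ≤ p) : ∃ C : ℝ≥0∞, C ≠ ∞ ∧ ∀ F : ℝ → E3 → ℝ, JS F → ∀ y,
    NP p (fun t x => ‖inc y F t x‖ₑ) ≤
      ENNReal.ofReal (‖y‖ ^ p) * (C * ∑ i, NP p (fun t x => ‖pd (F t) i x‖ₑ)) := by
  obtain ⟨C, hC, h⟩ := NP_inc_le_of_slice hp
  exact ⟨C, hC, fun F hF y => h F hF.slice (fun i => (hF.dpd i).enorm_measurable) y⟩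

/-- Increments are bounded by twice the function. -/
lemma NP_inc_le_two {p : ℝ} (hp : 1 ≤ p) {F : ℝ → E3 → ℝ}
    (hF : Measurable (Function.uncurry fun t x => ‖F t x‖ₑ)) (y : E3) :
    NP p (fun t x => ‖inc y F t x‖ₑ) ≤ 2 ^ p * NP p fun t x => ‖F t x‖ₑ := by
  have hm : Measurable (Function.uncurry fun t x => ‖F t (x - y)‖ₑ) :=
    hF.comp (by fun_prop : Measurable fun q : ℝ × E3 => (q.1, q.2 - y))
  have h1 : NP p (fun t x => ‖inc y F t x‖ₑ) ≤ NP p (fun t x => ‖F t (x - y)‖ₑ + ‖F t x‖ₑ) :=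
    NP_mono (by linarith) fun t _ x => enorm_sub_le
  refine h1.trans ((NP_add_le hp hm).trans ?_)
  rw [NP_trans hF y, ← two_mul, ← mul_assoc]
  refine le_of_eq ?_
  congr 1
  nth_rewrite 2 [← ENNReal.rpow_one 2]
  rw [← ENNReal.rpow_add _ _ (by norm_num) (by norm_num)]
  congr 1; ring

/-- Time-shifted kernel average. -/
def KS (ψ : E3 → ℝ) (σ : ℝ) (H : ℝ → E3 → ℝ) (s t : ℝ) (x : E3) : ℝ := Ker ψ s (H (t - σ * s)) x

/-- Time-integrated absolute kernel averages. -/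
def TK (ψ : E3 → ℝ) (σ c : ℝ) (H : ℝ → E3 → ℝ) (t : ℝ) (x : E3) : ℝ≥0∞ :=
  ∫⁻ s in Ioc (0:ℝ) 1, ENNReal.ofReal (s ^ (-c)) * ‖KS ψ σ H s t x‖ₑ

/-- Vanishing before time zero. -/
def VN (H : ℝ → E3 → ℝ) : Prop := ∀ t < 0, ∀ x, H t x = 0

section
variable {ψ : E3 → ℝ} {H : ℝ → E3 → ℝ} {σ c p : ℝ}

lemma KS_measurable₃ (hψ : GP ψ) (hH : JS H) :
    Measurable fun q : ℝ × ℝ × E3 => ‖KS ψ σ H q.1 q.2.1 q.2.2‖ₑ := by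
  refine Measurable.enorm ?_
  have h : Measurable fun q : (ℝ × ℝ × E3) × E3 =>
      ψ q.2 * H (q.1.2.1 - σ * q.1.1) (q.1.2.2 - √q.1.1 • q.2) := by
    have h1 : Measurable fun q : (ℝ × ℝ × E3) × E3 =>
      (q.1.2.1 - σ * q.1.1, q.1.2.2 - √q.1.1 • q.2) := by fun_prop
    exact (hψ.continuous.measurable.comp measurable_snd).mul (hH.measurable.comp h1)
  exact (h.stronglyMeasurable.integral_prod_right' (ν := volume)).measurable

lemma KS_measurable (hψ : GP ψ) (hH : JS H) (s : ℝ) :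
    Measurable (Function.uncurry fun t x => ‖KS ψ σ H s t x‖ₑ) :=
  (KS_measurable₃ hψ hH).comp (by fun_prop : Measurable fun q : ℝ × E3 => (s, q))

lemma TK_measurable (hψ : GP ψ) (hH : JS H) :
    Measurable (Function.uncurry (TK ψ σ c H)) := by
  have h : Measurable fun q : (ℝ × E3) × ℝ =>
      ENNReal.ofReal (q.2 ^ (-c)) * ‖KS ψ σ H q.2 q.1.1 q.1.2‖ₑ := by
    have h1 : Measurable fun q : (ℝ × E3) × ℝ => (q.2, q.1) := by fun_prop
    have h2 : Measurable fun s : ℝ => ENNReal.ofReal (s ^ (-c)) :=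
      (measurable_id.pow_const (-c)).ennreal_ofReal
    exact (h2.comp measurable_snd).mul ((KS_measurable₃ hψ hH).comp h1)
  exact h.lintegral_prod_right'

lemma NP_TK_le (hψ : GP ψ) (hH : JS H) (hp : 1 ≤ p) {b : ℝ} {N : ℝ≥0∞}
    (h : ∀ s ∈ Ioc (0:ℝ) 1, NP p (fun t x => ‖KS ψ σ H s t x‖ₑ) ≤
      ENNReal.ofReal (s ^ ((c - b) * p)) * N) :
    NP p (TK ψ σ c H) ≤ (∫⁻ s in Ioc (0:ℝ) 1, ENNReal.ofReal (s ^ (-b))) ^ p * N := by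
  have h2 : Measurable fun s : ℝ => ENNReal.ofReal (s ^ (-c)) :=
    (measurable_id.pow_const (-c)).ennreal_ofReal
  refine minkowski_time (ν := stm)
    (F := fun s (q : ℝ × E3) => ENNReal.ofReal (s ^ (-c)) * ‖KS ψ σ H s q.1 q.2‖ₑ)
    ((h2.comp measurable_fst).mul (KS_measurable₃ hψ hH)) hp fun s hs => ?_
  have h3 := NP_const_mul (p := p) (F := fun t x => ‖KS ψ σ H s t x‖ₑ)
    (ENNReal.ofReal (s ^ (-c))) ENNReal.ofReal_ne_top (by linarith)
  unfold NP at h3 h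
  rw [h3]
  refine (mul_le_mul' le_rfl (h s hs)).trans ?_
  rw [← mul_assoc]
  gcongr
  rw [ENNReal.ofReal_rpow_of_nonneg (Real.rpow_nonneg hs.1.le _) (by linarith),
    ← ENNReal.ofReal_mul (by positivity [hs.1]), ← Real.rpow_mul hs.1.le,
    ← Real.rpow_add hs.1]
  refine le_of_eq ?_
  congr 2; ring

lemma VN.inc (hH : VN H) (y : E3) : VN (inc y H) := fun t ht x => by simp [_root_.inc, hH t ht]

lemma NP_KS_le (hψ : GP ψ) (hp : 1 ≤ p) : ∃ C : ℝ≥0∞, C ≠ ∞ ∧ ∀ H, TF H → VN H → ∀ σ, 0 ≤ σ →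
    ∀ s, 0 ≤ s → NP p (fun t x => ‖KS ψ σ H s t x‖ₑ) ≤ C * NP p fun t x => ‖H t x‖ₑ := by
  obtain ⟨C, hC, h⟩ := Np_Ker_le hψ hp
  refine ⟨C, hC.ne, fun H hH h0 σ hσ s hs => ?_⟩
  have hm := hH.1.enorm_measurable
  have hm1 : Measurable (Function.uncurry fun t x => ‖H (t - σ * s) x‖ₑ) :=
    hm.comp (by fun_prop : Measurable fun q : ℝ × E3 => (q.1 - σ * s, q.2))
  have h1 := NP_shift (F := fun t x => ‖H t x‖ₑ) (p := p) (by linarith) hm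
    (fun t ht x => by simp [h0 t ht]) (mul_nonneg hσ hs)
  refine le_trans ?_ (mul_le_mul' le_rfl h1)
  rw [NP_eq (KS_measurable hψ hH.1 s), NP_eq hm1, ← lintegral_const_mul' _ _ hC.ne]
  exact lintegral_mono fun t => h _ (hH.slice _) s

lemma NP_KS_le_of_inc (hψ : GP ψ) (hψ0 : ∫ z, ψ z = 0) (hp : 1 ≤ p) {e : ℝ} (he : 0 ≤ e)
    (he1 : e ≤ 1) :
    ∃ C : ℝ≥0∞, C ≠ ∞ ∧ ∀ H, TF H → VN H → ∀ N : ℝ≥0∞,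
    (∀ y, NP p (fun t x => ‖inc y H t x‖ₑ) ≤ N * ENNReal.ofReal (‖y‖ ^ (e * p))) →
    ∀ σ, 0 ≤ σ → ∀ s, 0 < s →
    NP p (fun t x => ‖KS ψ σ H s t x‖ₑ) ≤ C * (ENNReal.ofReal (s ^ (e * p / 2)) * N) := by
  refine ⟨(∫⁻ z, ENNReal.ofReal ((1 + ‖z‖) ^ 1) * ‖ψ z‖ₑ) ^ p,
    ENNReal.rpow_ne_top_of_nonneg (by linarith) (hψ.lintegral_moment 1).ne,
    fun H hH h0 N hN σ hσ s hs => ?_⟩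
  have hw : Measurable fun z : E3 => ENNReal.ofReal ((1 + ‖z‖) ^ 1) * ‖ψ z‖ₑ := by
    have := hψ.continuous.measurable
    fun_prop
  have hF : Measurable fun r : E3 × ℝ × E3 => ENNReal.ofReal ((1 + ‖r.1‖)⁻¹) *
      ‖inc (√s • r.1) H (r.2.1 - σ * s) r.2.2‖ₑ := by
    have h1 : Measurable fun r : E3 × ℝ × E3 => (r.2.1 - σ * s, r.2.2 - √s • r.1) := by fun_prop
    have h2 : Measurable fun r : E3 × ℝ × E3 => (r.2.1 - σ * s, r.2.2) := by fun_prop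
    have h3 : Measurable fun r : E3 × ℝ × E3 => inc (√s • r.1) H (r.2.1 - σ * s) r.2.2 :=
      (hH.1.measurable.comp h1).sub (hH.1.measurable.comp h2)
    have h4 : Measurable fun r : E3 × ℝ × E3 => ENNReal.ofReal ((1 + ‖r.1‖)⁻¹) := by fun_prop
    exact h4.mul h3.enorm
  have key := lintegral_rpow_lintegral_le volume stm hw
    (F := fun z (q : ℝ × E3) => ENNReal.ofReal ((1 + ‖z‖)⁻¹) *
      ‖inc (√s • z) H (q.1 - σ * s) q.2‖ₑ) hF hp
    (N := ENNReal.ofReal (s ^ (e * p / 2)) * N) ?_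
  · have key' : NP p (fun t x => ∫⁻ z, ENNReal.ofReal ((1 + ‖z‖) ^ 1) * ‖ψ z‖ₑ *
        (ENNReal.ofReal ((1 + ‖z‖)⁻¹) * ‖inc (√s • z) H (t - σ * s) x‖ₑ)) ≤ _ := key
    refine le_trans (NP_mono (by linarith) fun t _ x => ?_) key'
    obtain ⟨C, hC⟩ := (hH.slice (t - σ * s)).bdd
    have hI := Av_integrable_integrand hψ.integrable (measurable_sqrt_smul s)
      (hH.slice (t - σ * s)).continuous hC x
    have h1 : KS ψ σ H s t x = ∫ z, ψ z * inc (√s • z) H (t - σ * s) x := by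
      have h2 : ∫ z, ψ z * inc (√s • z) H (t - σ * s) x =
          (∫ z, ψ z * H (t - σ * s) (x - √s • z)) - ∫ z, ψ z * H (t - σ * s) x := by
        rw [← integral_sub hI (hψ.integrable.mul_const _)]
        congr 1; ext z; simp only [inc]; ring
      rw [h2, integral_mul_const, hψ0, zero_mul, sub_zero]
      rfl
    rw [h1]
    refine (enorm_integral_le_lintegral_enorm _).trans (lintegral_mono fun z => ?_)
    simp only
    rw [enorm_mul, pow_one]
    have h3 : ENNReal.ofReal (1 + ‖z‖) * ENNReal.ofReal ((1 + ‖z‖)⁻¹) = 1 := by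
      rw [← ENNReal.ofReal_mul (by positivity), mul_inv_cancel₀ (by positivity), ENNReal.ofReal_one]
    calc ‖ψ z‖ₑ * ‖inc (√s • z) H (t - σ * s) x‖ₑ
        = (ENNReal.ofReal (1 + ‖z‖) * ENNReal.ofReal ((1 + ‖z‖)⁻¹)) *
          (‖ψ z‖ₑ * ‖inc (√s • z) H (t - σ * s) x‖ₑ) := by rw [h3, one_mul]
      _ ≤ _ := le_of_eq (by ring)
  · intro z
    have hJ := hH.1.inc (√s • z)
    have h1 := NP_shift (F := fun t x => ‖inc (√s • z) H t x‖ₑ) (p := p) (by linarith)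
      hJ.enorm_measurable (fun t ht x => by simp [h0.inc _ t ht]) (mul_nonneg hσ hs.le)
    have h2 := NP_const_mul (p := p) (F := fun t x => ‖inc (√s • z) H (t - σ * s) x‖ₑ)
      (ENNReal.ofReal ((1 + ‖z‖)⁻¹)) ENNReal.ofReal_ne_top (by linarith)
    unfold NP at h2
    rw [h2]
    refine (mul_le_mul' le_rfl (h1.trans (hN _))).trans ?_
    rw [mul_comm N, ← mul_assoc]
    gcongr
    rw [ENNReal.ofReal_rpow_of_nonneg (by positivity) (by linarith),
      ← ENNReal.ofReal_mul (by positivity)]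
    refine ENNReal.ofReal_le_ofReal ?_
    rw [norm_smul, Real.norm_of_nonneg (Real.sqrt_nonneg s),
      Real.mul_rpow (Real.sqrt_nonneg s) (norm_nonneg z), Real.sqrt_eq_rpow, ← Real.rpow_mul hs.le,
      show 1 / 2 * (e * p) = e * p / 2 by ring, mul_left_comm]
    refine mul_le_of_le_one_right (by positivity) ?_
    rw [Real.inv_rpow (by positivity), inv_mul_le_one₀ (by positivity)]
    calc ‖z‖ ^ (e * p) ≤ (1 + ‖z‖) ^ (e * p) := by
          apply Real.rpow_le_rpow (norm_nonneg _) (by linarith) (by nlinarith)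
      _ ≤ (1 + ‖z‖) ^ p := by
          apply Real.rpow_le_rpow_of_exponent_le (by linarith [norm_nonneg z]) (by nlinarith)

lemma KS_inc (hψ : GP ψ) (hH : TF H) (s t : ℝ) (x y : E3) :
    KS ψ σ (inc y H) s t x = inc y (KS ψ σ H s) t x := by
  obtain ⟨C, hC⟩ := (hH.slice (t - σ * s)).bdd
  have hI := Av_integrable_integrand hψ.integrable (measurable_sqrt_smul s)
    (hH.slice (t - σ * s)).continuous hC
  unfold KS inc Ker Av
  rw [← integral_sub (hI _) (hI _)]
  congr 1; ext z
  rw [sub_right_comm]; ring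
end

lemma NP_TK_inc_le {ψ : E3 → ℝ} (hψ : GP ψ) {p a c e σ : ℝ} (hp : 1 ≤ p) (ha0 : 0 ≤ a) (ha1 : a ≤ 1)
    (hc : c + (a - e) / 2 < 1) :
    ∃ C : ℝ≥0∞, C ≠ ∞ ∧ ∀ H, TF H → ∀ N : ℝ≥0∞,
    (∀ s ∈ Ioc (0:ℝ) 1, NP p (fun t x => ‖KS ψ σ H s t x‖ₑ) ≤
      ENNReal.ofReal (s ^ (e * p / 2)) * N) →
    (∀ l, ∀ s ∈ Ioc (0:ℝ) 1, NP p (fun t x => ‖KS (pd ψ l) σ H s t x‖ₑ) ≤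
      ENNReal.ofReal (s ^ (e * p / 2)) * N) →
    ∀ y, NP p (TK ψ σ c (inc y H)) ≤ C * (N * ENNReal.ofReal (‖y‖ ^ (a * p))) := by
  obtain ⟨C₁, hC₁, h1⟩ := NP_inc_le_of_slice hp
  set K : ℝ≥0∞ := 2 ^ p + C₁ * 3 with hKdef
  have hK : K ≠ ∞ := by
    refine ENNReal.add_ne_top.2 ⟨ENNReal.rpow_ne_top_of_nonneg (by linarith) (by norm_num), ?_⟩
    exact ENNReal.mul_ne_top hC₁ (by norm_num)
  have hb := lintegral_rpow_neg_lt_top hc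
  refine ⟨(∫⁻ s in Ioc (0:ℝ) 1, ENNReal.ofReal (s ^ (-(c + (a - e) / 2)))) ^ p * K,
    ENNReal.mul_ne_top (ENNReal.rpow_ne_top_of_nonneg (by linarith) hb.ne) hK,
    fun H hH N hA hB y => ?_⟩
  rw [mul_assoc]
  refine NP_TK_le hψ (hH.1.inc y) hp fun s hs => ?_
  have hs0 : 0 < s := hs.1
  simp only [KS_inc hψ hH]
  set X := NP p (fun t x => ‖inc y (KS ψ σ H s) t x‖ₑ) with hX
  set E := ENNReal.ofReal (s ^ (e * p / 2)) * N with hE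
  have hpd : ∀ i t x, pd (KS ψ σ H s t) i x = (√s)⁻¹ * KS (pd ψ i) σ H s t x := by
    intro i t x
    have e1 : pd (KS ψ σ H s t) i = Ker ψ s (pd (H (t - σ * s)) i) :=
      Ker_pd_comm hψ s (hH.slice _) i
    rw [e1]
    unfold KS
    rw [← Ker_pd hψ hs0 (hH.slice _) i x, inv_mul_cancel_left₀ (Real.sqrt_pos.2 hs0).ne']
  have hXA : X ≤ K * E := by
    refine (NP_inc_le_two hp (KS_measurable hψ hH.1 s) y).trans ?_
    exact mul_le_mul' le_self_add (hA s hs)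
  have hXB : X ≤ K * E * ENNReal.ofReal (‖y‖ ^ p * s ^ (-p / 2)) := by
    refine (h1 (KS ψ σ H s) (fun t => Ker_contDiff hψ s (hH.slice _)) (fun i => ?_) y).trans ?_
    · simp only [hpd]
      have hm : Measurable (Function.uncurry fun t x => ‖(√s)⁻¹‖ₑ * ‖KS (pd ψ i) σ H s t x‖ₑ) :=
        (KS_measurable (hψ.dpd i) hH.1 s).const_mul _
      simpa only [enorm_mul] using hm
    · have h2 : ∀ i, NP p (fun t x => ‖pd (KS ψ σ H s t) i x‖ₑ) ≤
          ENNReal.ofReal (s ^ (-p / 2)) * E := by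
        intro i
        simp only [hpd, enorm_mul]
        rw [NP_const_mul _ enorm_ne_top (by linarith)]
        refine mul_le_mul' (le_of_eq ?_) (hB i s hs)
        rw [Real.enorm_of_nonneg (by positivity),
          ENNReal.ofReal_rpow_of_nonneg (by positivity) (by linarith), Real.sqrt_eq_rpow,
          ← Real.rpow_neg hs0.le, ← Real.rpow_mul hs0.le]
        congr 2; ring
      have h3 : ∑ i, NP p (fun t x => ‖pd (KS ψ σ H s t) i x‖ₑ) ≤
          3 * (ENNReal.ofReal (s ^ (-p / 2)) * E) := by
        refine (Finset.sum_le_card_nsmul _ _ _ fun i _ => h2 i).trans (le_of_eq ?_)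
        simp
      calc _ ≤ ENNReal.ofReal (‖y‖ ^ p) * (C₁ * (3 * (ENNReal.ofReal (s ^ (-p / 2)) * E))) := by
            gcongr
        _ = (C₁ * 3) * E * (ENNReal.ofReal (‖y‖ ^ p) * ENNReal.ofReal (s ^ (-p / 2))) := by ring
        _ ≤ _ := by
            rw [ENNReal.ofReal_mul (by positivity)]
            gcongr
            exact le_add_self
  have hsplit : ∀ Z : ℝ≥0∞, Z ^ (1 - a) * Z ^ a = Z := fun Z => by
    rw [← ENNReal.rpow_add_of_nonneg _ _ (by linarith) ha0]; simp
  calc X = X ^ (1 - a) * X ^ a := (hsplit X).symm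
    _ ≤ (K * E) ^ (1 - a) * (K * E * ENNReal.ofReal (‖y‖ ^ p * s ^ (-p / 2))) ^ a := by
        gcongr
    _ = K * E * ENNReal.ofReal (‖y‖ ^ p * s ^ (-p / 2)) ^ a := by
        rw [ENNReal.mul_rpow_of_nonneg _ _ ha0, ← mul_assoc, hsplit]
    _ = _ := by
        rw [ENNReal.ofReal_rpow_of_nonneg (by positivity) ha0,
          Real.mul_rpow (by positivity) (by positivity), ← Real.rpow_mul (norm_nonneg y),
          ← Real.rpow_mul hs0.le, ENNReal.ofReal_mul (by positivity), hE,
          show (c - (c + (a - e) / 2)) * p = e * p / 2 + -p / 2 * a by ring, Real.rpow_add hs0,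
          ENNReal.ofReal_mul (by positivity), mul_comm p a]
        ring

section
variable {ι : Type*} [Wt ι]

/-- Polynomially bounded space-time integrals. -/
def Bd (p : ℝ) (F : ι → ℝ → E3 → ℝ) : Prop :=
  Pol (fun i => NP p fun t x => ‖F i t x‖ₑ) fun _ => 1

/-- Polynomially bounded Hölder-type seminorms in space-time `L^p`. -/
def Hol (p b : ℝ) (F : ι → ℝ → E3 → ℝ) : Prop :=
  Pol (fun q : ι × E3 => NP p fun t x => ‖inc q.2 (F q.1) t x‖ₑ)
    fun q => ENNReal.ofReal (‖q.2‖ ^ b)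

variable {H : ι → ℝ → E3 → ℝ} {ψ : E3 → ℝ} {p a c e σ : ℝ}

lemma Hol_TK_of_Bd (hψ : GP ψ) (hp : 1 ≤ p) (ha0 : 0 ≤ a) (ha1 : a ≤ 1) (hc : c + a / 2 < 1)
    (hσ : 0 ≤ σ) (hH : ∀ i, TF (H i)) (h0 : ∀ i, VN (H i)) (hB : Bd p H) :
    Pol (fun q : ι × E3 => NP p (TK ψ σ c (inc q.2 (H q.1))))
      fun q => ENNReal.ofReal (‖q.2‖ ^ (a * p)) := by
  obtain ⟨C, hC, h⟩ := NP_TK_inc_le hψ (σ := σ) (e := 0) hp ha0 ha1 (by simpa using hc)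
  obtain ⟨C₀, hC₀, g₀⟩ := NP_KS_le hψ hp
  choose C₁ hC₁ g₁ using fun l => NP_KS_le (hψ.dpd l) hp
  have hK : C₀ + ∑ l, C₁ l ≠ ∞ :=
    ENNReal.add_ne_top.2 ⟨hC₀, (ENNReal.sum_lt_top.2 fun l _ => (hC₁ l).lt_top).ne⟩
  have hN : Pol (fun q : ι × E3 => C * (((C₀ + ∑ l, C₁ l) *
      NP p (fun t x => ‖H q.1 t x‖ₑ)) * ENNReal.ofReal (‖q.2‖ ^ (a * p))))
      fun q => ENNReal.ofReal (‖q.2‖ ^ (a * p)) :=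
    (Pol.one_mul (((hB.const_mul hK).comp (fun q : ι × E3 => q.1) fun _ => rfl)) (Pol.refl _)).const_mul hC
  refine Pol.mono_left (fun q => ?_) hN
  refine h (H q.1) (hH _) _ (fun s hs => ?_) (fun l s hs => ?_) q.2
  · simp only [zero_mul, zero_div, Real.rpow_zero, ENNReal.ofReal_one, one_mul]
    refine (g₀ _ (hH _) (h0 _) σ hσ s hs.1.le).trans ?_
    gcongr
    exact le_self_add
  · simp only [zero_mul, zero_div, Real.rpow_zero, ENNReal.ofReal_one, one_mul]
    refine (g₁ l _ (hH _) (h0 _) σ hσ s hs.1.le).trans ?_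
    gcongr
    exact (Finset.single_le_sum (f := C₁) (fun _ _ => bot_le) (Finset.mem_univ l)).trans le_add_self

lemma Hol_TK_of_Hol (hψ : GP ψ) (hψ0 : ∫ z, ψ z = 0) (hp : 1 ≤ p) (ha0 : 0 ≤ a) (ha1 : a ≤ 1)
    (he0 : 0 ≤ e) (he1 : e ≤ 1) (hc : c + (a - e) / 2 < 1)
    (hσ : 0 ≤ σ) (hH : ∀ i, TF (H i)) (h0 : ∀ i, VN (H i)) (hB : Hol p (e * p) H) :
    Pol (fun q : ι × E3 => NP p (TK ψ σ c (inc q.2 (H q.1))))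
      fun q => ENNReal.ofReal (‖q.2‖ ^ (a * p)) := by
  obtain ⟨C, hC, h⟩ := NP_TK_inc_le hψ (σ := σ) (e := e) hp ha0 ha1 hc
  obtain ⟨C₀, hC₀, g₀⟩ := NP_KS_le_of_inc hψ hψ0 hp he0 he1
  choose C₁ hC₁ g₁ using fun l => NP_KS_le_of_inc (hψ.dpd l) (hψ.integral_pd l) hp he0 he1
  have hK : C₀ + ∑ l, C₁ l ≠ ∞ :=
    ENNReal.add_ne_top.2 ⟨hC₀, (ENNReal.sum_lt_top.2 fun l _ => (hC₁ l).lt_top).ne⟩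
  obtain ⟨n, hn⟩ := hB
  have hn1 : Pol (fun i : ι => Wt.a i ^ n) fun _ => 1 := ⟨n, fun i => by simp⟩
  have hN : Pol (fun q : ι × E3 => C * (((C₀ + ∑ l, C₁ l) *
      Wt.a q.1 ^ n) * ENNReal.ofReal (‖q.2‖ ^ (a * p))))
      fun q => ENNReal.ofReal (‖q.2‖ ^ (a * p)) :=
    (Pol.one_mul (((hn1.const_mul hK).comp (fun q : ι × E3 => q.1) fun _ => rfl)) (Pol.refl _)).const_mul hC
  refine Pol.mono_left (fun q => ?_) hN
  refine h (H q.1) (hH _) _ (fun s hs => ?_) (fun l s hs => ?_) q.2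
  · refine (g₀ _ (hH _) (h0 _) (Wt.a q.1 ^ n) (fun y => hn (q.1, y)) σ hσ s hs.1).trans ?_
    rw [mul_left_comm]
    gcongr
    · exact le_self_add
  · refine (g₁ l _ (hH _) (h0 _) (Wt.a q.1 ^ n) (fun y => hn (q.1, y)) σ hσ s hs.1).trans ?_
    rw [mul_left_comm]
    gcongr
    · exact (Finset.single_le_sum (f := C₁) (fun _ _ => bot_le) (Finset.mem_univ l)).trans
        le_add_self

lemma Bd_TK_of_Hol (hψ : GP ψ) (hψ0 : ∫ z, ψ z = 0) (hp : 1 ≤ p)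
    (he0 : 0 ≤ e) (he1 : e ≤ 1) (hc : c - e / 2 < 1)
    (hσ : 0 ≤ σ) (hH : ∀ i, TF (H i)) (h0 : ∀ i, VN (H i)) (hB : Hol p (e * p) H) :
    Pol (fun i => NP p (TK ψ σ c (H i))) fun _ => 1 := by
  obtain ⟨C₀, hC₀, g₀⟩ := NP_KS_le_of_inc hψ hψ0 hp he0 he1
  obtain ⟨n, hn⟩ := hB
  have hn1 : Pol (fun i : ι => Wt.a i ^ n) fun _ => 1 := ⟨n, fun i => by simp⟩
  have hb := lintegral_rpow_neg_lt_top hc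
  refine Pol.mono_left (fun i => ?_) ((hn1.const_mul hC₀).const_mul
    (ENNReal.rpow_ne_top_of_nonneg (by linarith : 0 ≤ p) hb.ne))
  refine NP_TK_le hψ (hH i).1 hp fun s hs => ?_
  refine (g₀ _ (hH _) (h0 _) (Wt.a i ^ n) (fun y => hn (i, y)) σ hσ s hs.1).trans (le_of_eq ?_)
  rw [mul_left_comm]
  congr 3; ring_nf
end

lemma TF.inc {F : ℝ → E3 → ℝ} (hF : TF F) (y : E3) : TF (inc y F) := by
  have h : TF fun t x => F t (x - y) :=
    ⟨hF.1.comp_sub y, hF.2.comp_homeomorph ((Homeomorph.refl ℝ).prodCongr (Homeomorph.subRight y))⟩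
  exact h.sub hF

lemma pd_comp_sub (g : E3 → ℝ) (i : Fin 3) (x y : E3) :
    pd (fun x => g (x - y)) i x = pd g i (x - y) := by
  unfold pd
  rw [fderiv_comp_sub]

lemma pd_inc {F : ℝ → E3 → ℝ} (hF : JS F) (i : Fin 3) (t : ℝ) (x y : E3) :
    pd (inc y F t) i x = inc y (fun t => pd (F t) i) t x := by
  have h1 : DifferentiableAt ℝ (fun x => F t (x - y)) x :=
    ((hF.comp_sub y).slice t).differentiable (by simp) x
  have h2 : DifferentiableAt ℝ (F t) x := (hF.slice t).differentiable (by simp) x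
  have h3 := pd_sub h1 h2 i
  rw [pd_comp_sub] at h3
  exact h3

lemma dt_inc {F : ℝ → E3 → ℝ} (hF : JS F) (t : ℝ) (x y : E3) :
    dt (inc y F) t x = inc y (dt F) t x := by
  have h1 : HasDerivAt (fun s => F s (x - y)) _ t := hF.hasDerivAt t (x - y)
  have h2 : HasDerivAt (fun s => F s x) _ t := hF.hasDerivAt t x
  have h3 := (h1.sub h2).deriv
  have h4 := h1.deriv
  have h5 := h2.deriv
  unfold inc dt
  rw [h4, h5]
  exact h3

lemma lap_inc {F : ℝ → E3 → ℝ} (hF : JS F) (t : ℝ) (x y : E3) :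
    lap (inc y F t) x = inc y (fun t => lap (F t)) t x := by
  have h : ∀ i, pd (inc y F t) i = inc y (fun t => pd (F t) i) t := fun i =>
    funext fun x => pd_inc hF i t x y
  have h2 : ∀ i, pd (pd (inc y F t) i) i x = inc y (fun t => pd (pd (F t) i) i) t x := fun i => by
    rw [h, pd_inc (hF.dpd i)]
  change ∑ i, pd (pd (inc y F t) i) i x = _
  simp only [h2, inc, Finset.sum_sub_distrib]
  rfl

lemma lap_pd {f : E3 → ℝ} (hf : ContDiff ℝ (⊤:ℕ∞) f) (i : Fin 3) :
    lap (pd f i) = pd (lap f) i := by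
  funext x
  have h : ∀ j, DifferentiableAt ℝ (pd (pd f j) j) x := fun j =>
    (contDiff_pd (contDiff_pd hf j) j).differentiable (by simp) x
  have h1 : pd (lap f) i x = ∑ j, pd (pd (pd f j) j) i x := pd_sum (fun j _ => h j) i
  rw [h1]
  refine Finset.sum_congr rfl fun j _ => ?_
  change pd (pd (pd f i) j) j x = _
  rw [pd_comm hf i j, pd_comm (contDiff_pd hf j) i j]

/-- A test function solving an inhomogeneous heat equation with a source partly in divergence
form, and vanishing for nonpositive times. -/
structure Heat (f : ℝ → E3 → ℝ) (H : Fin 3 → ℝ → E3 → ℝ) (H₀ : ℝ → E3 → ℝ) : Prop where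
  tf : TF f
  tfH : ∀ l, TF (H l)
  tfH₀ : TF H₀
  f_zero : ∀ t ≤ 0, ∀ x, f t x = 0
  eq : ∀ t ≤ 1, ∀ x, dt f t x - lap (f t) x = (∑ l, pd (H l t) l x) + H₀ t x

namespace Heat
variable {f : ℝ → E3 → ℝ} {H : Fin 3 → ℝ → E3 → ℝ} {H₀ : ℝ → E3 → ℝ}

lemma inc (h : Heat f H H₀) (y : E3) : Heat (inc y f) (fun l => inc y (H l)) (inc y H₀) where
  tf := h.tf.inc y
  tfH l := (h.tfH l).inc y
  tfH₀ := h.tfH₀.inc y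
  f_zero t ht x := by simp [_root_.inc, h.f_zero t ht]
  eq t ht x := by
    rw [dt_inc h.tf.1, lap_inc h.tf.1]
    simp only [pd_inc (h.tfH _).1]
    have h1 := h.eq t ht x
    have h2 := h.eq t ht (x - y)
    simp only [_root_.inc, Finset.sum_sub_distrib]
    linarith

lemma dpd (h : Heat f H H₀) (i : Fin 3) :
    Heat (fun t => pd (f t) i) (fun l t => pd (H l t) i) (fun t => pd (H₀ t) i) where
  tf := h.tf.dpd i
  tfH l := (h.tfH l).dpd i
  tfH₀ := h.tfH₀.dpd i
  f_zero t ht x := by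
    have : f t = fun _ => 0 := funext (h.f_zero t ht)
    simp [this, pd]
  eq t ht x := by
    have h1 : (fun x => dt f t x - lap (f t) x) = fun x => (∑ l, pd (H l t) l x) + H₀ t x :=
      funext (h.eq t ht)
    have h2 := congrArg (fun g => pd g i x) h1
    have d1 : DifferentiableAt ℝ (dt f t) x := (h.tf.dt.1.slice t).differentiable (by simp) x
    have d2 : DifferentiableAt ℝ (lap (f t)) x := (h.tf.lap.1.slice t).differentiable (by simp) x
    have d3 : ∀ l, DifferentiableAt ℝ (pd (H l t) l) x := fun l =>
      (((h.tfH l).dpd l).1.slice t).differentiable (by simp) x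
    have d4 : DifferentiableAt ℝ (fun x => ∑ l, pd (H l t) l x) x :=
      DifferentiableAt.fun_sum fun l _ => d3 l
    have d5 : DifferentiableAt ℝ (H₀ t) x := (h.tfH₀.1.slice t).differentiable (by simp) x
    rw [pd_sub d1 d2, pd_add d4 d5, pd_sum fun l _ => d3 l] at h2
    rw [lap_pd (h.tf.1.slice t), ← h2.trans (congrArg₂ (· + ·) (Finset.sum_congr rfl fun l _ =>
      congrFun (pd_comm ((h.tfH l).1.slice t) l i) x) rfl), h.tf.1.pd_dt_comm]

lemma enorm_le (h : Heat f H H₀) {t : ℝ} (ht : t ∈ Icc (0:ℝ) 1) (x : E3) :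
    ‖f t x‖ₑ ≤ (∑ l, TK (pd gk l) 1 (1 / 2) (H l) t x) + TK gk 1 0 H₀ t x := by
  have h0 : f (t - 1) = fun _ => 0 := funext (h.f_zero _ (by linarith [ht.2]))
  have e0 : Ker gk 1 (f (t - 1)) x = 0 := by rw [h0]; simp [Ker, Av]
  rw [duhamel h.tf t x, e0, zero_add, intervalIntegral.integral_of_le zero_le_one]
  refine (enorm_integral_le_lintegral_enorm _).trans ?_
  have hm : ∀ l, Measurable fun s : ℝ =>
      ENNReal.ofReal (s ^ (-(1 / 2) : ℝ)) * ‖KS (pd gk l) 1 (H l) s t x‖ₑ := fun l => by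
    have h2 : Measurable fun s : ℝ => ENNReal.ofReal (s ^ (-(1/2) : ℝ)) :=
      (measurable_id.pow_const _).ennreal_ofReal
    exact h2.mul ((KS_measurable₃ (gk_GP.dpd l) (h.tfH l).1).comp
      (by fun_prop : Measurable fun s : ℝ => (s, t, x)))
  unfold TK
  rw [← lintegral_finsetSum _ fun l _ => hm l, ← lintegral_add_left
    (Finset.measurable_fun_sum _ fun l _ => hm l)]
  refine setLIntegral_mono' measurableSet_Ioc fun s hs => ?_
  have hs0 : 0 < s := hs.1
  have hS : (fun y => dt f (t - s) y - lap (f (t - s)) y) = fun y =>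
      (∑ l, pd (H l (t - s)) l y) + H₀ (t - s) y := funext (h.eq _ (by linarith [ht.2]))
  have hc : ∀ l, CS (pd (H l (t - s)) l) := fun l => ((h.tfH l).dpd l).slice _
  have hcs : CS fun y => ∑ l, pd (H l (t - s)) l y := CS.sum fun l _ => hc l
  have e1 : Ker gk s (fun y => (∑ l, pd (H l (t - s)) l y) + H₀ (t - s) y) x =
      (∑ l, Ker gk s (pd (H l (t - s)) l) x) + Ker gk s (H₀ (t - s)) x := by
    have a1 := Av_add gk_GP.integrable (measurable_sqrt_smul s) hcs (h.tfH₀.slice (t - s)) x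
    have a2 := Av_sum (s := Finset.univ) gk_GP.integrable (measurable_sqrt_smul s) (fun l _ => hc l) x
    unfold Ker
    rw [a1, a2]
  rw [hS, e1]
  refine (enorm_add_le _ _).trans (add_le_add ?_ ?_)
  · refine (enorm_sum_le Finset.univ _).trans (Finset.sum_le_sum fun l _ => ?_)
    have e2 : Ker gk s (pd (H l (t - s)) l) x = s ^ (-(1 / 2) : ℝ) * KS (pd gk l) 1 (H l) s t x := by
      unfold KS
      rw [one_mul, ← Ker_pd gk_GP hs0 ((h.tfH l).slice _) l x, Real.sqrt_eq_rpow, ← mul_assoc,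
        ← Real.rpow_add hs0]
      norm_num
    rw [e2, enorm_mul, Real.enorm_of_nonneg (by positivity)]
  · simp [KS]
end Heat

lemma TK_pd {ψ : E3 → ℝ} (hψ : GP ψ) {σ c : ℝ} {H : ℝ → E3 → ℝ} (hH : TF H) (i : Fin 3) (t : ℝ)
    (x : E3) : TK ψ σ c (fun t => pd (H t) i) t x = TK (pd ψ i) σ (c + 1 / 2) H t x := by
  unfold TK
  refine setLIntegral_congr_fun measurableSet_Ioc fun s hs => ?_
  have hs0 : 0 < s := hs.1
  have e : KS (pd ψ i) σ H s t x = s ^ (1 / 2 : ℝ) * KS ψ σ (fun t => pd (H t) i) s t x := by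
    unfold KS
    rw [← Ker_pd hψ hs0 (hH.slice _) i x, Real.sqrt_eq_rpow]
  rw [e, enorm_mul, ← mul_assoc, Real.enorm_of_nonneg (Real.rpow_nonneg hs0.le (1 / 2)),
    ← ENNReal.ofReal_mul (by positivity), ← Real.rpow_add hs0]
  congr 3; ring

lemma inc_measurable {ι : Type*} {F : ι → ℝ → E3 → ℝ} (hF : ∀ i, JS (F i)) (r : ι × E3) :
    Measurable (Function.uncurry fun t x => ‖inc r.2 (F r.1) t x‖ₑ) :=
  ((hF r.1).inc r.2).enorm_measurable

section
variable {ι : Type*} [Wt ι] {F H a f : ι → ℝ → E3 → ℝ} {p q b : ℝ}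

lemma Bd.mono (hp : 0 ≤ p) (h : ∀ i, ∀ t ∈ Icc (0:ℝ) 1, ∀ x, |F i t x| ≤ |H i t x|) (hH : Bd p H) :
    Bd p F := by
  refine Pol.mono_left (fun i => NP_mono hp fun t ht x => ?_) hH
  rw [Real.enorm_eq_ofReal_abs, Real.enorm_eq_ofReal_abs]
  exact ENNReal.ofReal_le_ofReal (h i t ht x)

lemma Bd.add (hp : 1 ≤ p) (hJ : ∀ i, JS (F i)) (hF : Bd p F) (hH : Bd p H) :
    Bd p fun i t x => F i t x + H i t x := by
  refine Pol.mono_left (fun i => (NP_mono (by linarith) fun t _ x => enorm_add_le _ _).trans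
    (NP_add_le hp (hJ i).enorm_measurable)) ?_
  exact (Pol.add hF hH).const_mul (ENNReal.rpow_ne_top_of_nonneg (by linarith) (by norm_num))

lemma Bd.const_mul (hp : 0 ≤ p) (c : ℝ) (hF : Bd p F) : Bd p fun i t x => c * F i t x := by
  have h : ∀ i, NP p (fun t x => ‖c * F i t x‖ₑ) = ‖c‖ₑ ^ p * NP p fun t x => ‖F i t x‖ₑ := fun i => by
    simp only [enorm_mul]
    exact NP_const_mul _ enorm_ne_top hp
  unfold Bd
  simp only [h]
  exact Pol.const_mul (ENNReal.rpow_ne_top_of_nonneg hp enorm_ne_top) hF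

lemma Bd.sum {κ : Type*} (s : Finset κ) {F : κ → ι → ℝ → E3 → ℝ} (hp : 1 ≤ p)
    (hJ : ∀ k i, JS (F k i)) (hF : ∀ k ∈ s, Bd p (F k)) : Bd p fun i t x => ∑ k ∈ s, F k i t x := by
  obtain ⟨C, hC, h⟩ := NP_sum_le s hp
  refine Pol.mono_left (fun i => (NP_mono (by linarith) fun t _ x => enorm_sum_le s _).trans
    (h _ fun k _ => (hJ k i).enorm_measurable)) ?_
  exact (Pol.sum s hF).const_mul hC

lemma Bd.mul (hF : ∀ i, JS (F i)) (hH : ∀ i, JS (H i)) {q₁ q₂ : ℝ} (hp : 0 < p) (h1 : 0 < q₁)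
    (h2 : 0 < q₂) (h : p / q₁ + p / q₂ = 1) (hFb : Bd q₁ F) (hHb : Bd q₂ H) :
    Bd p fun i t x => F i t x * H i t x := by
  have h' := (hFb.rpow_one (by positivity : 0 ≤ p / q₁)).mul (hHb.rpow_one (by positivity : 0 ≤ p / q₂))
  simp only [mul_one] at h'
  refine Pol.mono_left (fun i => ?_) h'
  simp only [enorm_mul]
  exact NP_mul_le (hF i).enorm_measurable (hH i).enorm_measurable (by positivity) (by positivity) h
    (by field_simp) (by field_simp) hp.le

lemma CS.NP_ne_top {g : E3 → ℝ} (hg : CS g) (hp : 0 < p) :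
    NP p (fun _ x => ‖g x‖ₑ) ≠ ∞ := by
  rw [NP_eq (JS.const hg.1).enorm_measurable]
  have h : ∫⁻ x, ‖g x‖ₑ ^ p < ∞ := by
    have h1 : MemLp g (ENNReal.ofReal p) volume := hg.1.continuous.memLp_of_hasCompactSupport hg.2
    have h2 := h1.2
    rw [eLpNorm_lt_top_iff_lintegral_rpow_enorm_lt_top (by simpa using hp) (by simp)] at h2
    simpa [ENNReal.toReal_ofReal hp.le] using h2
  simp [h.ne]

lemma Bd.static {g : E3 → ℝ} (hg : CS g) (hp : 0 < p) : Bd p (fun (_ : ι) (_ : ℝ) => g) :=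
  Pol.const (hg.NP_ne_top hp)

lemma Bd.mono_exp {η : E3 → ℝ} (hη : CS η) (hF : ∀ i, JS (F i)) (hp : 0 < p) (hpq : p ≤ q)
    (h : ∀ i t x, η x * F i t x = F i t x) (hB : Bd q F) : Bd p F := by
  rcases hpq.eq_or_lt with rfl | hlt
  · exact hB
  have hq : 0 < q := hp.trans hlt
  have hr : 0 < 1 - p / q := by rw [sub_pos, div_lt_one hq]; exact hlt
  have := Bd.mul (F := fun (_ : ι) (_ : ℝ) => η) (H := F) (p := p) (q₁ := p / (1 - p / q)) (q₂ := q)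
    (fun _ => JS.const hη.1) hF hp (by positivity) hq (by field_simp; ring)
    (Bd.static hη (by positivity)) hB
  simpa only [h] using this

lemma Bd.hol (hp : 1 ≤ p) (hF : ∀ i, JS (F i)) (h : Bd p F) : Hol p 0 F := by
  have h1 : Pol (fun r : ι × E3 => 2 ^ p * NP p fun t x => ‖F r.1 t x‖ₑ) fun _ => 1 :=
    Pol.comp (fun r : ι × E3 => r.1) (fun _ => rfl)
      (Pol.const_mul (ENNReal.rpow_ne_top_of_nonneg (by linarith) (by norm_num)) h)
  unfold Hol
  simp only [Real.rpow_zero, ENNReal.ofReal_one]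
  exact Pol.mono_left (fun r => NP_inc_le_two hp (hF r.1).enorm_measurable r.2) h1

lemma Hol.of_grad (hp : 1 ≤ p) (hF : ∀ i, JS (F i)) (h : ∀ l, Bd p fun i t => pd (F i t) l) :
    Hol p p F := by
  obtain ⟨C, hC, h1⟩ := NP_inc_le hp
  have h2 : Pol (fun r : ι × E3 => C * ∑ l, NP p fun t x => ‖pd (F r.1 t) l x‖ₑ) fun _ => 1 :=
    Pol.comp (fun r : ι × E3 => r.1) (fun _ => rfl)
      ((Pol.sum Finset.univ fun l _ => h l).const_mul hC)
  refine Pol.mono_left (fun r => h1 (F r.1) (hF _) r.2) ?_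
  exact Pol.mul_one (Pol.refl _) h2

lemma Hol.interp_exp {p₀ p₁ b₀ b₁ α β : ℝ} (hF : ∀ i, JS (F i)) (hα : 0 ≤ α) (hβ : 0 ≤ β)
    (hab : α + β = 1) (hp₀ : 0 ≤ p₀) (hp₁ : 0 ≤ p₁) (hb₀ : 0 ≤ b₀) (hb₁ : 0 ≤ b₁)
    (h₀ : Hol p₀ b₀ F) (h₁ : Hol p₁ b₁ F)
    (hp : p₀ * α + p₁ * β = p) (hb : b₀ * α + b₁ * β = b) : Hol p b F := by
  refine Pol.mono_left (fun r => NP_interp (inc_measurable hF r) hα hβ hab hp₀ hp₁ hp)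
    (((h₀.rpow hα).mul (h₁.rpow hβ)).mono_right fun r => le_of_eq ?_)
  rw [ENNReal.ofReal_rpow_of_nonneg (by positivity) hα,
    ENNReal.ofReal_rpow_of_nonneg (by positivity) hβ, ← ENNReal.ofReal_mul (by positivity),
    ← Real.rpow_mul (norm_nonneg _), ← Real.rpow_mul (norm_nonneg _),
    ← Real.rpow_add_of_nonneg (norm_nonneg _) (by positivity) (by positivity), hb]

lemma Hol.add (hp : 1 ≤ p) (hJ : ∀ i, JS (F i)) (hF : Hol p b F) (hH : Hol p b H) :
    Hol p b fun i t x => F i t x + H i t x := by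
  have h : ∀ (r : ι × E3) t x, inc r.2 (fun t x => F r.1 t x + H r.1 t x) t x =
      inc r.2 (F r.1) t x + inc r.2 (H r.1) t x := fun r t x => by simp only [inc]; ring
  refine Pol.mono_left (fun r => ?_) ((Pol.add hF hH).const_mul
    (ENNReal.rpow_ne_top_of_nonneg (by linarith : 0 ≤ p - 1) (by norm_num : (2:ℝ≥0∞) ≠ ∞)))
  simp only [h]
  exact (NP_mono (by linarith) fun t _ x => enorm_add_le _ _).trans
    (NP_add_le hp (inc_measurable hJ r))

lemma Hol.const_mul (hp : 0 ≤ p) (c : ℝ) (hF : Hol p b F) : Hol p b fun i t x => c * F i t x := by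
  have h : ∀ r : ι × E3, NP p (fun t x => ‖inc r.2 (fun t x => c * F r.1 t x) t x‖ₑ) =
      ‖c‖ₑ ^ p * NP p fun t x => ‖inc r.2 (F r.1) t x‖ₑ := fun r => by
    rw [← NP_const_mul _ enorm_ne_top hp]
    simp only [inc, ← mul_sub, enorm_mul]
  unfold Hol
  simp only [h]
  exact Pol.const_mul (ENNReal.rpow_ne_top_of_nonneg hp enorm_ne_top) hF

lemma Hol.sum {κ : Type*} (s : Finset κ) {F : κ → ι → ℝ → E3 → ℝ} (hp : 1 ≤ p)
    (hJ : ∀ k i, JS (F k i)) (hF : ∀ k ∈ s, Hol p b (F k)) :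
    Hol p b fun i t x => ∑ k ∈ s, F k i t x := by
  obtain ⟨C, hC, h⟩ := NP_sum_le s hp
  refine Pol.mono_left (fun r => ?_) ((Pol.sum s hF).const_mul hC)
  have h' : ∀ t x, inc r.2 (fun t x => ∑ k ∈ s, F k r.1 t x) t x =
      ∑ k ∈ s, inc r.2 (F k r.1) t x := fun t x => by simp only [inc, Finset.sum_sub_distrib]
  simp only [h']
  exact (NP_mono (by linarith) fun t _ x => enorm_sum_le s _).trans
    (h (fun k t x => ‖inc r.2 (F k r.1) t x‖ₑ) fun k _ => inc_measurable (hJ k) r)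

/-- Fractional regularity of products. -/
lemma Hol.mul (hp1 : 1 ≤ p) (hp2 : p < 4 / 3) (ha : ∀ i, JS (a i)) (hf : ∀ i, JS (f i))
    (ha4 : Bd 4 a) (ha2 : Bd 2 a) (hda : ∀ l, Bd 2 fun i t => pd (a i t) l) (hf2 : Bd 2 f)
    (hHf : Hol (4 / 3) (2 / 3) f) : Hol p ((4 - 3 * p) / 2) fun i t x => a i t x * f i t x := by
  have n1 : 0 < 4 - p := by linarith
  have n2 : 0 < 2 - p := by linarith
  have n3 : 0 < 4 - 3 * p := by linarith
  have n0 : 0 < p := by linarith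
  have k1 : Hol (4 * p / (4 - p)) (2 * (4 - 3 * p) / (4 - p)) f := by
    refine Hol.interp_exp (α := 3 * (4 - 3 * p) / (4 - p)) (β := 8 * (p - 1) / (4 - p)) hf
      (by positivity) (div_nonneg (by linarith) n1.le) ?_ (by norm_num) (by norm_num)
      (by norm_num) le_rfl hHf (hf2.hol (by norm_num) hf) ?_ ?_
    · rw [← add_div, div_eq_one_iff_eq n1.ne']; ring
    · field_simp; ring
    · field_simp; ring
  have k2 : Hol 2 1 a :=
    Hol.interp_exp (α := 1 / 2) (β := 1 / 2) ha (by norm_num) (by norm_num) (by norm_num)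
      (by norm_num) (by norm_num) le_rfl (by norm_num) (ha2.hol (by norm_num) ha)
      (Hol.of_grad (by norm_num) ha hda) (by norm_num) (by norm_num)
  have k3 : Hol (2 * p / (2 - p)) ((4 - 3 * p) / (2 - p)) a := by
    refine Hol.interp_exp (α := (4 - 3 * p) / (2 - p)) (β := 2 * (p - 1) / (2 - p)) ha
      (by positivity) (div_nonneg (by linarith) n2.le) ?_ (by norm_num) (by norm_num)
      (by norm_num) le_rfl k2 (ha4.hol (by norm_num) ha) ?_ ?_
    · rw [← add_div, div_eq_one_iff_eq n2.ne']; ring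
    · field_simp; ring
    · field_simp; ring
  have c1 : Pol (fun r : ι × E3 => NP 4 (fun t x => ‖a r.1 t x‖ₑ) ^ (p / 4)) fun _ => 1 :=
    Pol.comp (fun r : ι × E3 => r.1) (fun _ => rfl) (Pol.rpow_one (by positivity) ha4)
  have c2 : Pol (fun r : ι × E3 => NP 2 (fun t x => ‖f r.1 t x‖ₑ) ^ (p / 2)) fun _ => 1 :=
    Pol.comp (fun r : ι × E3 => r.1) (fun _ => rfl) (Pol.rpow_one (by positivity) hf2)
  have t1 : Pol (fun r : ι × E3 => NP 4 (fun t x => ‖a r.1 t x‖ₑ) ^ (p / 4) *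
      NP (4 * p / (4 - p)) (fun t x => ‖inc r.2 (f r.1) t x‖ₑ) ^ ((4 - p) / 4))
      fun r => ENNReal.ofReal (‖r.2‖ ^ ((4 - 3 * p) / 2)) := by
    refine (Pol.one_mul c1 (k1.rpow (by positivity))).mono_right fun r => le_of_eq ?_
    rw [ENNReal.ofReal_rpow_of_nonneg (by positivity) (by positivity),
      ← Real.rpow_mul (norm_nonneg _)]
    congr 2; field_simp; ring
  have t2 : Pol (fun r : ι × E3 => NP (2 * p / (2 - p)) (fun t x => ‖inc r.2 (a r.1) t x‖ₑ) ^
      ((2 - p) / 2) * NP 2 (fun t x => ‖f r.1 t x‖ₑ) ^ (p / 2))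
      fun r => ENNReal.ofReal (‖r.2‖ ^ ((4 - 3 * p) / 2)) := by
    refine (Pol.mul_one (k3.rpow (by positivity)) c2).mono_right fun r => le_of_eq ?_
    rw [ENNReal.ofReal_rpow_of_nonneg (by positivity) (by positivity),
      ← Real.rpow_mul (norm_nonneg _)]
    congr 2; field_simp
  refine Pol.mono_left (fun r => ?_) ((Pol.add t1 t2).const_mul
    (ENNReal.rpow_ne_top_of_nonneg (by linarith : 0 ≤ p - 1) (by norm_num : (2:ℝ≥0∞) ≠ ∞)))
  have ms : Measurable (Function.uncurry fun t x => ‖a r.1 t (x - r.2)‖ₑ) :=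
    ((ha r.1).comp_sub r.2).enorm_measurable
  have m1 := inc_measurable hf r
  have m2 := inc_measurable ha r
  have hm : Measurable (Function.uncurry fun t x =>
      ‖a r.1 t (x - r.2)‖ₑ * ‖inc r.2 (f r.1) t x‖ₑ) := ms.mul m1
  have e1 : ∀ t x, ‖inc r.2 (fun t x => a r.1 t x * f r.1 t x) t x‖ₑ ≤
      ‖a r.1 t (x - r.2)‖ₑ * ‖inc r.2 (f r.1) t x‖ₑ + ‖inc r.2 (a r.1) t x‖ₑ * ‖f r.1 t x‖ₑ := by
    intro t x
    rw [← enorm_mul, ← enorm_mul]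
    refine le_trans (le_of_eq ?_) (enorm_add_le _ _)
    congr 1; simp only [inc]; ring
  refine (NP_mono n0.le fun t _ x => e1 t x).trans ((NP_add_le hp1 hm).trans ?_)
  gcongr
  · have h := NP_mul_le (p := p) (q₁ := 4) (q₂ := 4 * p / (4 - p)) (α := p / 4) (β := (4 - p) / 4)
      ms m1 (by positivity) (by positivity) (by ring) (by ring) (by field_simp) n0.le
    rwa [NP_trans (ha r.1).enorm_measurable r.2] at h
  · exact NP_mul_le (p := p) (q₁ := 2 * p / (2 - p)) (q₂ := 2) (α := (2 - p) / 2) (β := p / 2)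
      m2 (hf r.1).enorm_measurable (by positivity) (by positivity) (by ring) (by field_simp)
      (by ring) n0.le
end

section
variable {ι : Type*} [Wt ι] {f H₀ : ι → ℝ → E3 → ℝ} {H : Fin 3 → ι → ℝ → E3 → ℝ} {p b : ℝ}

/-- Transfer of Hölder bounds through the Duhamel formula. -/
lemma Hol.of_heat (hp : 1 ≤ p) (hh : ∀ i, Heat (f i) (fun l => H l i) (H₀ i))
    (h1 : ∀ l, Pol (fun r : ι × E3 => NP p (TK (pd gk l) 1 (1 / 2) (inc r.2 (H l r.1))))
      fun r => ENNReal.ofReal (‖r.2‖ ^ b))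
    (h0 : Pol (fun r : ι × E3 => NP p (TK gk 1 0 (inc r.2 (H₀ r.1))))
      fun r => ENNReal.ofReal (‖r.2‖ ^ b)) : Hol p b f := by
  obtain ⟨C, hC, hs⟩ := NP_sum_le (p := p) (Finset.univ : Finset (Fin 3)) hp
  have h2 := (Pol.add ((Pol.sum Finset.univ fun l _ => h1 l).const_mul hC) h0).const_mul
    (ENNReal.rpow_ne_top_of_nonneg (by linarith : 0 ≤ p - 1) (by norm_num : (2:ℝ≥0∞) ≠ ∞))
  refine Pol.mono_left (fun r => ?_) h2
  have m : ∀ l, Measurable (Function.uncurry (TK (pd gk l) 1 (1 / 2) (inc r.2 (H l r.1)))) :=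
    fun l => TK_measurable (gk_GP.dpd l) (((hh r.1).tfH l).1.inc r.2)
  have ms : Measurable (Function.uncurry fun t x =>
      ∑ l, TK (pd gk l) 1 (1 / 2) (inc r.2 (H l r.1)) t x) := by
    have := Finset.measurable_fun_sum Finset.univ fun l _ => m l
    exact this
  refine (NP_mono (by linarith) fun t ht x => ((hh r.1).inc r.2).enorm_le ht x).trans
    ((NP_add_le hp ms).trans ?_)
  gcongr
  exact hs _ fun l _ => m l

/-- Transfer of Hölder bounds through the Duhamel formula for the gradient. -/
lemma Hol.of_heat_pd (hp : 1 ≤ p) (hh : ∀ i, Heat (f i) (fun l => H l i) (H₀ i)) (m : Fin 3)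
    (h1 : ∀ l, Pol (fun r : ι × E3 => NP p (TK (pd (pd gk l) m) 1 1 (inc r.2 (H l r.1))))
      fun r => ENNReal.ofReal (‖r.2‖ ^ b))
    (h0 : Pol (fun r : ι × E3 => NP p (TK (pd gk m) 1 (1 / 2) (inc r.2 (H₀ r.1))))
      fun r => ENNReal.ofReal (‖r.2‖ ^ b)) : Hol p b fun i t => pd (f i t) m := by
  have e : ∀ {ψ : E3 → ℝ} (_ : GP ψ) (c : ℝ) {F : ℝ → E3 → ℝ} (_ : TF F) (y : E3),
      TK ψ 1 c (inc y fun t => pd (F t) m) = TK (pd ψ m) 1 (c + 1 / 2) (inc y F) := by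
    intro ψ hψ c F hF y
    have e1 : (inc y fun t => pd (F t) m) = fun t => pd (inc y F t) m := by
      funext t x; exact (pd_inc hF.1 m t x y).symm
    funext t x
    rw [e1, TK_pd hψ (hF.inc y)]
  refine Hol.of_heat hp (fun i => (hh i).dpd m) (fun l => ?_) ?_
  · have e2 : ∀ r : ι × E3, TK (pd gk l) 1 (1 / 2) (inc r.2 fun t => pd (H l r.1 t) m) =
        TK (pd (pd gk l) m) 1 1 (inc r.2 (H l r.1)) := fun r => by
      rw [e (gk_GP.dpd l) _ ((hh r.1).tfH l)]; norm_num
    simp only [e2]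
    exact h1 l
  · have e2 : ∀ r : ι × E3, TK gk 1 0 (inc r.2 fun t => pd (H₀ r.1 t) m) =
        TK (pd gk m) 1 (1 / 2) (inc r.2 (H₀ r.1)) := fun r => by
      rw [e gk_GP _ (hh r.1).tfH₀]; norm_num
    simp only [e2]
    exact h0
end

/-- Smooth compactly supported functions of time vanishing before time `1 / 4`. -/
structure TC (τ : ℝ → ℝ) : Prop where
  smooth : ContDiff ℝ (⊤ : ℕ∞) τ
  supp : HasCompactSupport τ
  zero : ∀ t < 1 / 4, τ t = 0

lemma TC.deriv {τ : ℝ → ℝ} (h : TC τ) : TC (deriv τ) where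
  smooth := (contDiff_infty_iff_deriv.1 h.smooth).2
  supp := h.supp.deriv
  zero t ht := by
    have h1 : τ =ᶠ[𝓝 t] fun _ => 0 := (eventually_lt_nhds ht).mono fun s hs => h.zero s hs
    rw [h1.deriv_eq]; simp

lemma TC.bdd {τ : ℝ → ℝ} (h : TC τ) : ∃ C, 0 ≤ C ∧ ∀ t, |τ t| ≤ C := by
  obtain ⟨C, hC⟩ := h.supp.exists_bound_of_continuous h.smooth.continuous
  exact ⟨C, (norm_nonneg _).trans (hC 0), hC⟩

/-- The time cutoff, equal to one on the second half of the unit interval. -/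
def ct : ContDiffBump (1 : ℝ) := ⟨1 / 2, 3 / 4, by norm_num, by norm_num⟩

lemma ct_TC : TC (ct : ℝ → ℝ) where
  smooth := ct.contDiff
  supp := ct.hasCompactSupport
  zero t ht := ct.zero_of_le_dist (by
    change (3:ℝ) / 4 ≤ dist t 1
    rw [Real.dist_eq, abs_of_neg (by linarith)]; linarith)

lemma ct_one {t : ℝ} (ht : t ∈ Icc (1 / 2 : ℝ) 1) : ct t = 1 :=
  ct.one_of_mem_closedBall (by
    change dist t 1 ≤ 1 / 2
    rw [Real.dist_eq, abs_of_nonpos (by linarith [ht.2])]; linarith [ht.1])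

/-- Localization in space and time. -/
def lz (τ : ℝ → ℝ) (φ : E3 → ℝ) (g : ℝ → E3 → ℝ) (t : ℝ) (x : E3) : ℝ := τ t * (φ x * g t x)

section
variable {τ : ℝ → ℝ} {φ : E3 → ℝ} {g : ℝ → E3 → ℝ}

lemma lz_TF (hτ : TC τ) (hφ : CS φ) (hg : JS g) : TF (lz τ φ g) := by
  have h1 : JS (lz τ φ g) :=
    JS.mul (F := fun t _ => τ t) (hτ.smooth.comp contDiff_fst) ((JS.const hφ.1).mul hg)
  refine ⟨h1, HasCompactSupport.intro (hτ.supp.isCompact.prod hφ.2.isCompact) fun q hq => ?_⟩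
  unfold lz
  by_cases h : q.1 ∈ tsupport τ
  · rw [image_eq_zero_of_notMem_tsupport (f := φ) fun h2 => hq ⟨h, h2⟩]; simp
  · rw [image_eq_zero_of_notMem_tsupport h]; simp

lemma lz_zero (hτ : TC τ) {t : ℝ} (ht : t < 1 / 4) (x : E3) : lz τ φ g t x = 0 := by
  simp [lz, hτ.zero t ht]

lemma pd_lz (hφ : CS φ) (hg : JS g) (t : ℝ) (i : Fin 3) (x : E3) :
    pd (lz τ φ g t) i x = τ t * (pd φ i x * g t x + φ x * pd (g t) i x) := by
  have d1 : DifferentiableAt ℝ φ x := hφ.differentiable x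
  have d2 : DifferentiableAt ℝ (g t) x := (hg.slice t).differentiable (by simp) x
  have d3 : DifferentiableAt ℝ (fun x => φ x * g t x) x := d1.mul d2
  have h := pd_const_mul (τ t) i d3
  rw [pd_mul d1 d2] at h
  exact h

lemma lap_lz (hφ : CS φ) (hg : JS g) (t : ℝ) (x : E3) :
    lap (lz τ φ g t) x = τ t * (lap φ x * g t x + 2 * ∑ l, pd φ l x * pd (g t) l x +
      φ x * lap (g t) x) := by
  rw [← lap_mul hφ.1 (hg.slice t)]
  have h0 : ContDiff ℝ (⊤ : ℕ∞) fun x => φ x * g t x := hφ.1.mul (hg.slice t)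
  have h1 : ∀ i, pd (lz τ φ g t) i = fun y => τ t * pd (fun x => φ x * g t x) i y := fun i =>
    funext fun y => pd_const_mul (τ t) i (h0.differentiable (by simp) y)
  have h2 : ∀ i, pd (pd (lz τ φ g t) i) i x = τ t * pd (pd (fun x => φ x * g t x) i) i x :=
    fun i => by
      rw [h1 i]
      exact pd_const_mul (τ t) i ((contDiff_pd h0 i).differentiable (by simp) x)
  change ∑ i, pd (pd (lz τ φ g t) i) i x = τ t * ∑ i, pd (pd (fun x => φ x * g t x) i) i x
  simp only [h2, Finset.mul_sum]

lemma dt_lz (hτ : TC τ) (hg : JS g) (t : ℝ) (x : E3) :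
    dt (lz τ φ g) t x = deriv τ t * (φ x * g t x) + τ t * (φ x * dt g t x) := by
  have h1 : HasDerivAt τ (deriv τ t) t := (hτ.smooth.differentiable (by simp) t).hasDerivAt
  have h2 : HasDerivAt (fun s => g s x) (dt g t x) t := by
    have := hg.hasDerivAt t x
    rwa [← hg.dt_eq] at this
  exact (h1.mul (h2.const_mul (φ x))).deriv
end

namespace Dat

/-- The localized vorticity. -/
def f (d : Dat) (φ : E3 → ℝ) (j k : Fin 3) : ℝ → E3 → ℝ := lz ct φ (d.Om j k)

/-- The divergence-form part of the source for the localized vorticity. -/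
def H (d : Dat) (φ : E3 → ℝ) (j k l : Fin 3) (t : ℝ) (x : E3) : ℝ :=
  (-2) * lz ct (pd φ l) (d.Om j k) t x + ((if l = j then (-1) else 0) * lz ct φ (d.M k) t x +
    (if l = k then 1 else 0) * lz ct φ (d.M j) t x)

/-- The remaining part of the source for the localized vorticity. -/
def H₀ (d : Dat) (φ : E3 → ℝ) (j k : Fin 3) (t : ℝ) (x : E3) : ℝ :=
  (lz (deriv ct) φ (d.Om j k) t x + lz ct (lap φ) (d.Om j k) t x) +
    (lz ct (pd φ j) (d.M k) t x + (-1) * lz ct (pd φ k) (d.M j) t x)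

variable {φ : E3 → ℝ}

lemma TF_const_mul {F : ℝ → E3 → ℝ} (c : ℝ) (hF : TF F) : TF fun t x => c * F t x :=
  TF.mul (JS.const (g := fun _ => c) contDiff_const) hF

lemma H_TF (d : Dat) (hφ : CS φ) (j k l : Fin 3) : TF (d.H φ j k l) :=
  (TF_const_mul _ (lz_TF ct_TC (hφ.dpd l) (d.Om_JS j k))).add
    ((TF_const_mul _ (lz_TF ct_TC hφ (d.M_JS k))).add (TF_const_mul _ (lz_TF ct_TC hφ (d.M_JS j))))

lemma H₀_TF (d : Dat) (hφ : CS φ) (j k : Fin 3) : TF (d.H₀ φ j k) :=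
  ((lz_TF ct_TC.deriv hφ (d.Om_JS j k)).add (lz_TF ct_TC hφ.lap (d.Om_JS j k))).add
    ((lz_TF ct_TC (hφ.dpd j) (d.M_JS k)).add
      (TF_const_mul _ (lz_TF ct_TC (hφ.dpd k) (d.M_JS j))))

lemma heat (d : Dat) (hφ : CS φ) (j k : Fin 3) :
    Heat (d.f φ j k) (d.H φ j k) (d.H₀ φ j k) where
  tf := lz_TF ct_TC hφ (d.Om_JS j k)
  tfH l := d.H_TF hφ j k l
  tfH₀ := d.H₀_TF hφ j k
  f_zero t ht x := lz_zero ct_TC (by linarith) x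
  eq t ht x := by
    have hd : ∀ {τ : ℝ → ℝ} {χ : E3 → ℝ} {g : ℝ → E3 → ℝ}, TC τ → CS χ → JS g →
        DifferentiableAt ℝ (lz τ χ g t) x := fun h1 h2 h3 =>
      ((lz_TF h1 h2 h3).1.slice t).differentiable (by simp) x
    have e1 : ∀ l, pd (d.H φ j k l t) l x =
        (-2) * pd (lz ct (pd φ l) (d.Om j k) t) l x +
          ((if l = j then (-1) else 0) * pd (lz ct φ (d.M k) t) l x +
          (if l = k then 1 else 0) * pd (lz ct φ (d.M j) t) l x) := fun l => by
      have d1 := hd ct_TC (hφ.dpd l) (d.Om_JS j k)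
      have d2 := hd ct_TC hφ (d.M_JS k)
      have d3 := hd ct_TC hφ (d.M_JS j)
      have d1' : DifferentiableAt ℝ (fun x => (-2) * lz ct (pd φ l) (d.Om j k) t x) x :=
        d1.const_mul _
      have d2' : DifferentiableAt ℝ
        (fun x => (if l = j then (-1) else 0) * lz ct φ (d.M k) t x) x := d2.const_mul _
      have d3' : DifferentiableAt ℝ
        (fun x => (if l = k then 1 else 0) * lz ct φ (d.M j) t x) x := d3.const_mul _
      have d4 : DifferentiableAt ℝ (fun x => (if l = j then (-1) else 0) * lz ct φ (d.M k) t x +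
        (if l = k then 1 else 0) * lz ct φ (d.M j) t x) x := d2'.add d3'
      have h1 := pd_add d1' d4 l
      rw [pd_add d2' d3', pd_const_mul _ _ d1, pd_const_mul _ _ d2, pd_const_mul _ _ d3] at h1
      exact h1
    simp only [e1, pd_lz (hφ.dpd _) (d.Om_JS j k), pd_lz hφ (d.M_JS _)]
    have e2 := dt_lz (φ := φ) ct_TC (d.Om_JS j k) t x
    have e3 := lap_lz (τ := ct) hφ (d.Om_JS j k) t x
    change dt (lz ct φ (d.Om j k)) t x - lap (lz ct φ (d.Om j k) t) x = _
    rw [e2, e3]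
    have e4 : lap φ x = ∑ l, pd (pd φ l) l x := rfl
    have e5 : ct t * (φ x * dt (d.Om j k) t x) = ct t * (φ x * (lap (d.Om j k t) x -
        (pd (d.M k t) j x - pd (d.M j t) k x))) := by
      rcases lt_or_ge t 0 with h | h
      · rw [ct_TC.zero t (by linarith)]; simp
      · rw [d.dt_Om ⟨h, ht⟩]
    rw [e5]
    simp only [Finset.sum_add_distrib, ← Finset.mul_sum, ite_mul, zero_mul, Finset.sum_ite_eq',
      Finset.mem_univ, if_true, H₀, lz, e4, ← Finset.sum_mul]
    ring

end Dat

namespace Dat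
variable {φ η χ : E3 → ℝ} {τ : ℝ → ℝ} {p : ℝ}

lemma w_JS (d : Dat) (hφ : CS φ) (k : Fin 3) : JS (d.w φ k) := (JS.const hφ.1).mul (d.v_JS k)

lemma Bd_vf (hφ : CS φ) (j k : Fin 3) : Bd 2 fun d : Dat => d.vf φ j k := by
  refine Pol.mono_left (fun d => ?_) (energy_vf hφ j k)
  rw [NP_eq (d.vf_JS hφ j k).enorm_measurable]
  rfl

lemma Bd_w (hφ : CS φ) (k : Fin 3) : Bd 4 fun d : Dat => d.w φ k := by
  refine Pol.mono_left (fun d => ?_) (energy_four_w hφ k)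
  rw [NP_eq (d.w_JS hφ k).enorm_measurable]
  rfl

lemma Bd_pd_w (hφ : CS φ) (k j : Fin 3) : Bd 2 fun (d : Dat) t => pd (d.w φ k t) j := by
  refine Pol.mono_left (fun d => ?_) (energy_pd_w hφ k j)
  rw [NP_eq ((d.w_JS hφ k).dpd j).enorm_measurable]
  rfl

lemma cut_mul (h : ∀ x ∈ tsupport φ, η x = 1) (x : E3) : η x * φ x = φ x := by
  by_cases hx : x ∈ tsupport φ
  · rw [h x hx, one_mul]
  · rw [image_eq_zero_of_notMem_tsupport hx, mul_zero]

lemma Bd_w_two (hφ : CS φ) (k : Fin 3) : Bd 2 fun d : Dat => d.w φ k := by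
  obtain ⟨η, hη, -, h1⟩ := exists_cut hφ
  refine Bd.mono_exp hη (fun d => d.w_JS hφ k) (by norm_num) (by norm_num) (fun d t x => ?_)
    (Bd_w hφ k)
  rw [w, ← mul_assoc, cut_mul h1]

lemma Bd_lz_Om (hτ : TC τ) (hχ : CS χ) (j k : Fin 3) : Bd 2 fun d : Dat => lz τ χ (d.Om j k) := by
  obtain ⟨C, hC0, hC⟩ := hτ.bdd
  refine Bd.mono (by norm_num) (fun d t _ x => ?_) (Bd.const_mul (by norm_num) C (Bd_vf hχ j k))
  rw [lz, abs_mul, abs_mul C, abs_of_nonneg hC0]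
  exact mul_le_mul_of_nonneg_right (hC t) (abs_nonneg _)

lemma Bd_lz_Om_of_le (hτ : TC τ) (hχ : CS χ) (j k : Fin 3) (hp : 0 < p) (hp2 : p ≤ 2) :
    Bd p fun d : Dat => lz τ χ (d.Om j k) := by
  obtain ⟨η, hη, -, h1⟩ := exists_cut hχ
  refine Bd.mono_exp hη (fun d => (lz_TF hτ hχ (d.Om_JS j k)).1) hp hp2 (fun d t x => ?_)
    (Bd_lz_Om hτ hχ j k)
  rw [lz, mul_left_comm, ← mul_assoc (η x), cut_mul h1]

lemma lz_M (hη : ∀ x ∈ tsupport χ, η x = 1) (d : Dat) (k : Fin 3) :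
    lz τ χ (d.M k) = fun t x => ∑ i, d.w η i t x * lz τ χ (d.Om i k) t x := by
  funext t x
  simp only [lz, M, w, Finset.mul_sum]
  refine Finset.sum_congr rfl fun i _ => ?_
  linear_combination (-(τ t * d.v i t x * d.Om i k t x)) * cut_mul hη x

lemma Bd_lz_M (hτ : TC τ) (hχ : CS χ) (k : Fin 3) (hp : 0 < p) (hp2 : p ≤ 4 / 3) :
    Bd p fun d : Dat => lz τ χ (d.M k) := by
  obtain ⟨η, hη, -, h1⟩ := exists_cut hχ
  refine Bd.mono_exp hη (fun d => (lz_TF hτ hχ (d.M_JS k)).1) hp hp2 (fun d t x => ?_) ?_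
  · rw [lz, mul_left_comm, ← mul_assoc (η x), cut_mul h1]
  simp only [lz_M h1]
  refine Bd.sum Finset.univ (by norm_num)
    (fun i d => (d.w_JS hη i).mul (lz_TF hτ hχ (d.Om_JS i k)).1) fun i _ => ?_
  exact Bd.mul (fun d => d.w_JS hη i) (fun d => (lz_TF hτ hχ (d.Om_JS i k)).1) (by norm_num)
    (by norm_num) (by norm_num) (by norm_num : (4 / 3 : ℝ) / 4 + 4 / 3 / 2 = 1) (Bd_w hη i)
    (Bd_lz_Om hτ hχ i k)

lemma Bd_H (hφ : CS φ) (j k l : Fin 3) (hp : 1 ≤ p) (hp2 : p ≤ 4 / 3) :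
    Bd p fun d : Dat => d.H φ j k l := by
  have t1 : ∀ d : Dat, TF fun t x => (-2) * lz ct (pd φ l) (d.Om j k) t x := fun d =>
    TF_const_mul _ (lz_TF ct_TC (hφ.dpd l) (d.Om_JS j k))
  have t2 : ∀ d : Dat, TF fun t x => (if l = j then (-1) else 0) * lz ct φ (d.M k) t x := fun d =>
    TF_const_mul _ (lz_TF ct_TC hφ (d.M_JS k))
  have hp0 : 0 < p := by linarith
  exact Bd.add hp (fun d => (t1 d).1)
    (Bd.const_mul hp0.le _ (Bd_lz_Om_of_le ct_TC (hφ.dpd l) j k hp0 (by linarith)))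
    (Bd.add hp (fun d => (t2 d).1) (Bd.const_mul hp0.le _ (Bd_lz_M ct_TC hφ k hp0 hp2))
      (Bd.const_mul hp0.le _ (Bd_lz_M ct_TC hφ j hp0 hp2)))

lemma Bd_H₀ (hφ : CS φ) (j k : Fin 3) (hp : 1 ≤ p) (hp2 : p ≤ 4 / 3) :
    Bd p fun d : Dat => d.H₀ φ j k := by
  have hp0 : 0 < p := by linarith
  have t1 : ∀ d : Dat, TF (lz (deriv ct) φ (d.Om j k)) := fun d =>
    lz_TF ct_TC.deriv hφ (d.Om_JS j k)
  have t2 : ∀ d : Dat, TF (lz ct (lap φ) (d.Om j k)) := fun d => lz_TF ct_TC hφ.lap (d.Om_JS j k)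
  have t3 : ∀ d : Dat, TF (lz ct (pd φ j) (d.M k)) := fun d => lz_TF ct_TC (hφ.dpd j) (d.M_JS k)
  exact Bd.add hp (fun d => ((t1 d).add (t2 d)).1)
    (Bd.add hp (fun d => (t1 d).1) (Bd_lz_Om_of_le ct_TC.deriv hφ j k hp0 (by linarith))
      (Bd_lz_Om_of_le ct_TC hφ.lap j k hp0 (by linarith)))
    (Bd.add hp (fun d => (t3 d).1) (Bd_lz_M ct_TC (hφ.dpd j) k hp0 hp2)
      (Bd.const_mul hp0.le _ (Bd_lz_M ct_TC (hφ.dpd k) j hp0 hp2)))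

lemma H_VN (d : Dat) (φ : E3 → ℝ) (j k l : Fin 3) : VN (d.H φ j k l) := fun t ht x => by
  simp [H, lz_zero ct_TC (by linarith : t < 1 / 4)]

lemma H₀_VN (d : Dat) (φ : E3 → ℝ) (j k : Fin 3) : VN (d.H₀ φ j k) := fun t ht x => by
  simp [H₀, lz_zero ct_TC (by linarith : t < 1 / 4), lz_zero ct_TC.deriv (by linarith : t < 1 / 4)]

lemma Hol_f (hφ : CS φ) (j k : Fin 3) : Hol (4 / 3) (2 / 3) fun d : Dat => d.f φ j k := by
  have e : (1 / 2 : ℝ) * (4 / 3) = 2 / 3 := by norm_num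
  rw [← e]
  refine Hol.of_heat (H := fun l d => d.H φ j k l) (by norm_num) (fun d => d.heat hφ j k)
    (fun l => ?_) ?_
  · have := Hol_TK_of_Bd (H := fun d : Dat => d.H φ j k l) (a := 1 / 2) (c := 1 / 2) (σ := 1) (p := 4 / 3)
      (gk_GP.dpd l) (by norm_num) (by norm_num) (by norm_num) (by norm_num)
      (by norm_num) (fun d => d.H_TF hφ j k l) (fun d => d.H_VN φ j k l)
      (Bd_H hφ j k l (by norm_num) le_rfl)
    exact this
  · have := Hol_TK_of_Bd (H := fun d : Dat => d.H₀ φ j k) (a := 1 / 2) (c := 0) (σ := 1) (p := 4 / 3) gk_GP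
      (by norm_num) (by norm_num) (by norm_num) (by norm_num)
      (by norm_num) (fun d => d.H₀_TF hφ j k) (fun d => d.H₀_VN φ j k)
      (Bd_H₀ hφ j k (by norm_num) le_rfl)
    exact this

lemma Hol_lz_Om (hp : 1 ≤ p) (hp2 : p < 4 / 3) (hχ : CS χ) (j k : Fin 3) :
    Hol p ((4 - 3 * p) / 2) fun d : Dat => lz ct χ (d.Om j k) := by
  obtain ⟨η, hη, -, h1⟩ := exists_cut hχ
  have h := Hol.mul (a := fun (_ : Dat) (_ : ℝ) => η) (f := fun d : Dat => lz ct χ (d.Om j k)) hp hp2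
    (fun _ => JS.const hη.1) (fun d => (lz_TF ct_TC hχ (d.Om_JS j k)).1)
    (Bd.static hη (by norm_num)) (Bd.static hη (by norm_num))
    (fun l => Bd.static (hη.dpd l) (by norm_num)) (Bd_lz_Om ct_TC hχ j k) (Hol_f hχ j k)
  have e : ∀ (d : Dat) t x, η x * lz ct χ (d.Om j k) t x = lz ct χ (d.Om j k) t x := fun d t x => by
    rw [lz, mul_left_comm, ← mul_assoc (η x), cut_mul h1]
  simpa only [e] using h

lemma Hol_lz_M (hp : 1 ≤ p) (hp2 : p < 4 / 3) (hχ : CS χ) (k : Fin 3) :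
    Hol p ((4 - 3 * p) / 2) fun d : Dat => lz ct χ (d.M k) := by
  obtain ⟨η, hη, -, h1⟩ := exists_cut hχ
  simp only [lz_M h1]
  refine Hol.sum Finset.univ hp
    (fun i d => (d.w_JS hη i).mul (lz_TF ct_TC hχ (d.Om_JS i k)).1) fun i _ => ?_
  exact Hol.mul hp hp2 (fun d => d.w_JS hη i) (fun d => (lz_TF ct_TC hχ (d.Om_JS i k)).1)
    (Bd_w hη i) (Bd_w_two hη i) (fun l => Bd_pd_w hη i l) (Bd_lz_Om ct_TC hχ i k) (Hol_f hχ i k)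

lemma Hol_H (hp : 1 ≤ p) (hp2 : p < 4 / 3) (hφ : CS φ) (j k l : Fin 3) :
    Hol p ((4 - 3 * p) / 2) fun d : Dat => d.H φ j k l := by
  have t1 : ∀ d : Dat, TF fun t x => (-2) * lz ct (pd φ l) (d.Om j k) t x := fun d =>
    TF_const_mul _ (lz_TF ct_TC (hφ.dpd l) (d.Om_JS j k))
  have t2 : ∀ d : Dat, TF fun t x => (if l = j then (-1) else 0) * lz ct φ (d.M k) t x := fun d =>
    TF_const_mul _ (lz_TF ct_TC hφ (d.M_JS k))
  have hp0 : 0 < p := by linarith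
  exact Hol.add hp (fun d => (t1 d).1)
    (Hol.const_mul hp0.le _ (Hol_lz_Om hp hp2 (hφ.dpd l) j k))
    (Hol.add hp (fun d => (t2 d).1) (Hol.const_mul hp0.le _ (Hol_lz_M hp hp2 hφ k))
      (Hol.const_mul hp0.le _ (Hol_lz_M hp hp2 hφ j)))

lemma Hol_pd_f (hp : 1 ≤ p) (hp2 : p < 4 / 3) (hφ : CS φ) (j k m : Fin 3) :
    Hol p ((4 - 3 * p) / (4 * p) * p) fun (d : Dat) t => pd (d.f φ j k t) m := by
  have hp0 : 0 < p := by linarith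
  have h0 : 0 < 4 - 3 * p := by linarith
  have a0 : 0 ≤ (4 - 3 * p) / (4 * p) := by positivity
  have a1 : (4 - 3 * p) / (4 * p) ≤ 1 / 4 := by
    rw [div_le_div_iff₀ (by positivity) (by norm_num)]; linarith
  have e2 : (4 - 3 * p) / (2 * p) = 2 * ((4 - 3 * p) / (4 * p)) := by field_simp; ring
  have apos : 0 < (4 - 3 * p) / (4 * p) := by positivity
  refine Hol.of_heat_pd (H := fun l d => d.H φ j k l) hp (fun d => d.heat hφ j k) m (fun l => ?_) ?_
  · have := Hol_TK_of_Hol (H := fun d : Dat => d.H φ j k l) (a := (4 - 3 * p) / (4 * p)) (c := 1) (σ := 1)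
      (p := p) (e := (4 - 3 * p) / (2 * p)) ((gk_GP.dpd l).dpd m)
      ((gk_GP.dpd l).integral_pd m) hp a0 (by linarith) (by positivity) (by linarith) (by linarith)
      (by norm_num) (fun d => d.H_TF hφ j k l) (fun d => d.H_VN φ j k l)
      (by
        have e : (4 - 3 * p) / (2 * p) * p = (4 - 3 * p) / 2 := by field_simp
        rw [e]
        exact Hol_H hp hp2 hφ j k l)
    exact this
  · have := Hol_TK_of_Bd (H := fun d : Dat => d.H₀ φ j k) (a := (4 - 3 * p) / (4 * p)) (c := 1 / 2)
      (σ := 1) (p := p) (gk_GP.dpd m) hp a0 (by linarith) (by linarith)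
      (by norm_num) (fun d => d.H₀_TF hφ j k) (fun d => d.H₀_VN φ j k)
      (Bd_H₀ hφ j k hp hp2.le)
    exact this

/-- Second derivatives of the Newtonian-type potential of the localized vorticity gradient. -/
lemma Bd_TK_pd_f (hp : 1 ≤ p) (hp2 : p < 4 / 3) (hφ : CS φ) (j k m a b : Fin 3) :
    Pol (fun d : Dat => NP p (TK (pd (pd gk a) b) 0 1 fun t => pd (d.f φ j k t) m)) fun _ => 1 := by
  have hp0 : 0 < p := by linarith
  have h0 : 0 < 4 - 3 * p := by linarith
  have apos : 0 < (4 - 3 * p) / (4 * p) := by positivity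
  have a1 : (4 - 3 * p) / (4 * p) ≤ 1 / 4 := by
    rw [div_le_div_iff₀ (by positivity) (by norm_num)]; linarith
  refine Bd_TK_of_Hol (H := fun (d : Dat) t => pd (d.f φ j k t) m) (c := 1)
    (e := (4 - 3 * p) / (4 * p)) ((gk_GP.dpd a).dpd b)
    ((gk_GP.dpd a).integral_pd b) hp apos.le (by linarith) (by linarith) le_rfl
    (fun d => (d.heat hφ j k).tf.dpd m) (fun d t ht x => ?_) (Hol_pd_f hp hp2 hφ j k m)
  have : d.f φ j k t = fun _ => 0 := funext ((d.heat hφ j k).f_zero t ht.le)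
  change pd (d.f φ j k t) m x = 0
  rw [this]; simp [pd]

end Dat

section

variable {g : E3 → ℝ}

lemma Ker_pd_eq {ψ : E3 → ℝ} (hψ : GP ψ) {s : ℝ} (hs : 0 < s) (hg : CS g) (i : Fin 3) (x : E3) :
    Ker ψ s (pd g i) x = s ^ (-(1 / 2) : ℝ) * Ker (pd ψ i) s g x := by
  rw [← Ker_pd hψ hs hg, ← mul_assoc]
  have : s ^ (-(1 / 2) : ℝ) * √s = 1 := by
    rw [Real.sqrt_eq_rpow, ← Real.rpow_add hs]; simp
  rw [this, one_mul]

/-- Second derivatives of the potential as an absolute kernel integral. -/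
lemma enorm_pd_pd_G_le (hg : CS g) (a b : Fin 3) (x : E3) :
    ‖pd (pd (G g) a) b x‖ₑ ≤
      ∫⁻ s in Ioc (0:ℝ) 1, ENNReal.ofReal (s ^ (-1 : ℝ)) * ‖Ker (pd (pd gk a) b) s g x‖ₑ := by
  have e : pd (pd (G g) a) b x =
      ∫ s in Ioc (0:ℝ) 1, s ^ (-1 : ℝ) * Ker (pd (pd gk a) b) s g x := by
    rw [pd_G hg, pd_G (hg.dpd a), pd_comm hg.1, G, GK_pd gk_GP (by norm_num) (hg.dpd b),
      GK_eq (gk_GP.dpd a) (by norm_num) (hg.dpd b)]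
    refine setIntegral_congr_fun measurableSet_Ioc fun s hs => ?_
    rw [Ker_pd_eq (gk_GP.dpd a) hs.1 hg, ← mul_assoc, ← Real.rpow_add hs.1]
    norm_num
  rw [e]
  refine (enorm_integral_le_lintegral_enorm _).trans
    (setLIntegral_mono_ae' measurableSet_Ioc (ae_of_all _ fun s hs => ?_))
  rw [enorm_mul, Real.enorm_of_nonneg (Real.rpow_nonneg hs.1.le _)]

/-- The kernel weighted by the cube of the distance. -/
def cube (ψ : E3 → ℝ) (z : E3) : ℝ := ‖z‖ ^ 3 * ψ z

/-- Kernel averages of functions vanishing near the origin decay as `s → 0`. -/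
lemma enorm_Ker_far {ψ : E3 → ℝ} (h0 : ∀ y, ‖y‖ < 2 → g y = 0) {s : ℝ} (hs : 0 < s) {x : E3}
    (hx : ‖x‖ < 1) :
    ENNReal.ofReal (s ^ (-(3 / 2) : ℝ)) * ‖Ker ψ s g x‖ₑ ≤ LK (cube ψ) s g x := by
  refine (mul_le_mul_right (enorm_Ker_le s x) _).trans ?_
  unfold LK
  rw [← lintegral_const_mul' _ _ ENNReal.ofReal_ne_top]
  refine lintegral_mono fun z => ?_
  by_cases h : ‖x - √s • z‖ < 2
  · simp [h0 _ h]
  have h1 : 1 ≤ √s * ‖z‖ := by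
    have h2 : ‖√s • z‖ = √s * ‖z‖ := by
      rw [norm_smul, Real.norm_of_nonneg (Real.sqrt_nonneg s)]
    have := norm_sub_le x (√s • z)
    linarith
  rw [← mul_assoc]
  refine mul_le_mul_left ?_ _
  rw [cube, enorm_mul, enorm_pow, enorm_norm]
  refine mul_le_mul_left ?_ _
  rw [← ofReal_norm, ← ENNReal.ofReal_pow (norm_nonneg z)]
  refine ENNReal.ofReal_le_ofReal ?_
  have h3 : s ^ (-(3 / 2) : ℝ) * √s ^ 3 = 1 := by
    rw [Real.sqrt_eq_rpow, ← Real.rpow_natCast, ← Real.rpow_mul hs.le, ← Real.rpow_add hs]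
    norm_num
  have h4 : 1 ≤ √s ^ 3 * ‖z‖ ^ 3 := by rw [← mul_pow]; exact one_le_pow₀ h1
  calc s ^ (-(3 / 2) : ℝ) = s ^ (-(3 / 2) : ℝ) * 1 := (mul_one _).symm
    _ ≤ s ^ (-(3 / 2) : ℝ) * (√s ^ 3 * ‖z‖ ^ 3) := by gcongr
    _ = ‖z‖ ^ 3 := by rw [← mul_assoc, h3, one_mul]

lemma cube_lintegral {ψ : E3 → ℝ} (hψ : GP ψ) : ∫⁻ z, ‖cube ψ z‖ₑ < ∞ := by
  refine lt_of_le_of_lt (lintegral_mono fun z => ?_) (hψ.lintegral_moment 3)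
  rw [cube, enorm_mul, enorm_pow, enorm_norm, ← ofReal_norm, ← ENNReal.ofReal_pow (norm_nonneg z)]
  gcongr
  linarith

lemma cube_measurable {ψ : E3 → ℝ} (hψ : GP ψ) : Measurable (cube ψ) :=
  (measurable_norm.pow_const 3).mul hψ.continuous.measurable

/-- Local bounds for second derivatives of the potential of a far-away divergence. -/
lemma far_G {p : ℝ} (hp : 1 ≤ p) (i a b : Fin 3) :
    ∃ C : ℝ≥0∞, C < ∞ ∧ ∀ g, CS g → (∀ y, ‖y‖ < 2 → g y = 0) →
      ∫⁻ x in ball (0 : E3) 1, ‖pd (pd (G (pd g i)) a) b x‖ₑ ^ p ≤ C * Np p g := by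
  have hψ : GP (pd (pd gk a) b) := (gk_GP.dpd a).dpd b
  refine ⟨(∫⁻ s in Ioc (0:ℝ) 1, ENNReal.ofReal (s ^ (-0 : ℝ))) ^ p *
    (∫⁻ z, ‖cube (pd (pd (pd gk a) b) i) z‖ₑ) ^ p, ?_, fun g hg h0 => ?_⟩
  · exact ENNReal.mul_lt_top (ENNReal.rpow_lt_top_of_nonneg (by linarith)
      (lintegral_rpow_neg_lt_top (by norm_num)).ne)
      (ENNReal.rpow_lt_top_of_nonneg (by linarith) (cube_lintegral (hψ.dpd i)).ne)
  have hgm : Measurable g := hg.continuous.measurable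
  have hcm := cube_measurable (hψ.dpd i)
  calc _ ≤ ∫⁻ x in ball (0 : E3) 1,
        (∫⁻ s in Ioc (0:ℝ) 1, LK (cube (pd (pd (pd gk a) b) i)) s g x) ^ p := by
        refine setLIntegral_mono_ae' measurableSet_ball (ae_of_all _ fun x hx => ?_)
        refine ENNReal.rpow_le_rpow ((enorm_pd_pd_G_le (hg.dpd i) a b x).trans ?_) (by linarith)
        refine setLIntegral_mono_ae' measurableSet_Ioc (ae_of_all _ fun s hs => ?_)
        refine le_trans ?_ (enorm_Ker_far h0 hs.1 (by simpa using hx))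
        rw [Ker_pd_eq hψ hs.1 hg, enorm_mul, Real.enorm_of_nonneg (Real.rpow_nonneg hs.1.le _),
          ← mul_assoc, ← ENNReal.ofReal_mul (Real.rpow_nonneg hs.1.le _), ← Real.rpow_add hs.1]
        norm_num
    _ ≤ ∫⁻ x, (∫⁻ s in Ioc (0:ℝ) 1, LK (cube (pd (pd (pd gk a) b) i)) s g x) ^ p :=
        setLIntegral_le_lintegral _ _
    _ ≤ (∫⁻ s in Ioc (0:ℝ) 1, ENNReal.ofReal (s ^ (-0 : ℝ))) ^ p *
        ((∫⁻ z, ‖cube (pd (pd (pd gk a) b) i) z‖ₑ) ^ p * Np p g) := by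
        refine minkowski_time (LK_measurable hcm hgm) hp fun s _ => ?_
        have hF : Measurable (Function.uncurry fun (z : E3) x => ‖g (x - √s • z)‖ₑ) := by
          refine (hgm.comp ?_).enorm
          fun_prop
        refine (lintegral_rpow_lintegral_le volume volume hcm.enorm hF hp
          (fun z => (Np_sub_const p g (√s • z)).le)).trans ?_
        simp
    _ = _ := by rw [mul_assoc]

lemma near_P1 {p : ℝ} (hp : 1 ≤ p) (a b : Fin 3) :
    ∃ C : ℝ≥0∞, C < ∞ ∧ ∀ g, CS g →
      ∫⁻ x in ball (0 : E3) 1, ‖pd (pd (P1 g) a) b x‖ₑ ^ p ≤ C * Np p g := by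
  obtain ⟨C, hC, h⟩ := Np_Ker_le ((gk_GP.dpd a).dpd b) hp
  refine ⟨C, hC, fun g hg => (setLIntegral_le_lintegral _ _).trans (le_trans (le_of_eq ?_) (h g hg 1))⟩
  refine lintegral_congr fun x => ?_
  rw [pd_P1 hg, pd_P1 (hg.dpd a), P1, pd_comm hg.1, Ker_pd_eq gk_GP one_pos (hg.dpd b),
    Ker_pd_eq (gk_GP.dpd a) one_pos hg, Real.one_rpow, one_mul, one_mul]

lemma pd_rm_aux {f g : E3 → ℝ} {h : Fin 3 → E3 → ℝ} (hf : CS f) (hg : CS g) (hh : ∀ j, CS (h j))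
    (a : Fin 3) : pd (fun x => P1 f x - G g x - ∑ j, G (h j) x) a =
      fun x => P1 (pd f a) x - G (pd g a) x - ∑ j, G (pd (h j) a) x := by
  funext x
  have d1 : DifferentiableAt ℝ (P1 f) x := hf.P1_IB.smooth.differentiable (by simp) x
  have d2 : DifferentiableAt ℝ (G g) x := hg.G_IB.smooth.differentiable (by simp) x
  have d3 : ∀ j ∈ Finset.univ, DifferentiableAt ℝ (G (h j)) x := fun j _ =>
    (hh j).G_IB.smooth.differentiable (by simp) x
  have d12 : DifferentiableAt ℝ (fun x => P1 f x - G g x) x := d1.sub d2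
  have d3' : DifferentiableAt ℝ (fun x => ∑ j, G (h j) x) x := DifferentiableAt.fun_sum d3
  rw [pd_sub d12 d3', pd_sub d1 d2, pd_sum d3, pd_P1 hf, pd_G hg]
  simp only [fun j => pd_G (hh j) a]

namespace Sl
variable {φ : E3 → ℝ}

lemma pd_eq_zero_of_eq_one {r : ℝ} (h1 : ∀ x : E3, ‖x‖ < r → φ x = 1) (i : Fin 3) {x : E3} (hx : ‖x‖ < r) :
    pd φ i x = 0 := by
  have h : φ =ᶠ[𝓝 x] fun _ => 1 := by
    filter_upwards [(isOpen_lt continuous_norm continuous_const).mem_nhds hx] with y hy using h1 y hy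
  rw [pd, h.fderiv_eq]
  simp

/-- Interior regularity of the remainder. -/
lemma pd_pd_rm (hφ : CS φ) (h1 : ∀ x : E3, ‖x‖ < 2 → φ x = 1) {p : ℝ} (hp : 1 ≤ p) (hp3 : p < 3)
    (k a b : Fin 3) :
    Pol (fun s : Sl => ∫⁻ x in ball (0:E3) 1, ‖pd (pd (s.rm φ k) a) b x‖ₑ ^ p) fun _ => 1 := by
  have hp0 : 0 < p := by linarith
  obtain ⟨C₁, hC₁, H₁⟩ := near_P1 hp a b
  have H₂ := fun i => far_G hp i a b
  choose C₂ hC₂ H₂ using H₂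
  have nmNp : ∀ {X : Sl → E3 → ℝ}, Pol (fun s => nm p (X s)) (fun _ => 1) →
      Pol (fun s => Np p (X s)) fun _ => 1 := fun {X} h => by
    refine Pol.mono_left (fun s => ?_) (h.rpow_one hp0.le)
    rw [nm, ← ENNReal.rpow_mul, one_div_mul_cancel hp0.ne', ENNReal.rpow_one]
  have z : ∀ j : Fin 3, ∀ y : E3, ‖y‖ < 2 → pd φ j y = 0 := fun j y hy =>
    pd_eq_zero_of_eq_one h1 j hy
  refine Pol.mono_left (Y := fun s : Sl => 2 ^ (p - 1) * (2 ^ (p - 1) * (C₁ * Np p (s.w φ k) +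
    C₂ k * Np p (s.dv φ)) + 3 ^ (p - 1) * ∑ j, C₂ j * Np p (s.cm φ j k))) (fun s => ?_) ?_
  · have e : pd (pd (s.rm φ k) a) b = fun x => pd (pd (P1 (s.w φ k)) a) b x -
        pd (pd (G (pd (s.dv φ) k)) a) b x - ∑ j, pd (pd (G (pd (s.cm φ j k) j)) a) b x := by
      have c1 := s.w_CS hφ k
      have c2 := (s.dv_CS hφ).dpd k
      have c3 := fun j => (s.cm_CS hφ j k).dpd j
      have : s.rm φ k = fun x => P1 (s.w φ k) x - G (pd (s.dv φ) k) x
        - ∑ j, G (pd (s.cm φ j k) j) x := rfl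
      rw [this, pd_rm_aux c1 c2 c3, pd_rm_aux (c1.dpd a) (c2.dpd a) fun j => (c3 j).dpd a]
      simp only [pd_P1 c1, pd_P1 (c1.dpd a), pd_G c2, pd_G (c2.dpd a), fun j => pd_G (c3 j) a,
        fun j => pd_G ((c3 j).dpd a) b]
    have m : ∀ g, CS g → Measurable fun x => ‖pd (pd (G g) a) b x‖ₑ ^ p := fun g hg => by
      rw [pd_G hg, pd_G (hg.dpd a)]
      exact ((hg.dpd a).dpd b).G_IB.measurable.enorm.pow_const p
    have m1 : Measurable fun x => ‖pd (pd (P1 (s.w φ k)) a) b x‖ₑ ^ p := by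
      rw [pd_P1 (s.w_CS hφ k), pd_P1 ((s.w_CS hφ k).dpd a)]
      exact (((s.w_CS hφ k).dpd a).dpd b).P1_IB.measurable.enorm.pow_const p
    have m2 := m _ ((s.dv_CS hφ).dpd k)
    have m3 := fun j => m _ ((s.cm_CS hφ j k).dpd j)
    calc _ ≤ ∫⁻ x in ball (0:E3) 1, 2 ^ (p - 1) * (2 ^ (p - 1) *
          (‖pd (pd (P1 (s.w φ k)) a) b x‖ₑ ^ p + ‖pd (pd (G (pd (s.dv φ) k)) a) b x‖ₑ ^ p)
          + 3 ^ (p - 1) * ∑ j, ‖pd (pd (G (pd (s.cm φ j k) j)) a) b x‖ₑ ^ p) := by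
          refine lintegral_mono fun x => ?_
          simp only [e]
          refine (ENNReal.rpow_le_rpow enorm_sub_le hp0.le).trans
            ((ENNReal.rpow_add_le_mul_rpow_add_rpow _ _ hp).trans (mul_le_mul_right (add_le_add
              ((ENNReal.rpow_le_rpow enorm_sub_le hp0.le).trans
              (ENNReal.rpow_add_le_mul_rpow_add_rpow _ _ hp)) ?_) _))
          refine (ENNReal.rpow_le_rpow (enorm_sum_le Finset.univ
            fun j => pd (pd (G (pd (s.cm φ j k) j)) a) b x) hp0.le).trans ?_
          simpa using ENNReal.rpow_sum_le_const_mul_sum_rpow Finset.univ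
            (fun j => ‖pd (pd (G (pd (s.cm φ j k) j)) a) b x‖ₑ) hp
      _ = 2 ^ (p - 1) * (2 ^ (p - 1) *
          ((∫⁻ x in ball (0:E3) 1, ‖pd (pd (P1 (s.w φ k)) a) b x‖ₑ ^ p) +
          ∫⁻ x in ball (0:E3) 1, ‖pd (pd (G (pd (s.dv φ) k)) a) b x‖ₑ ^ p)
          + 3 ^ (p - 1) * ∑ j,
            ∫⁻ x in ball (0:E3) 1, ‖pd (pd (G (pd (s.cm φ j k) j)) a) b x‖ₑ ^ p) := by
          have m4 : Measurable fun x => (2 : ℝ≥0∞) ^ (p - 1) *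
              (‖pd (pd (P1 (s.w φ k)) a) b x‖ₑ ^ p + ‖pd (pd (G (pd (s.dv φ) k)) a) b x‖ₑ ^ p) :=
            (m1.add m2).const_mul _
          rw [lintegral_const_mul' _ _ (by finiteness), lintegral_add_left m4, lintegral_const_mul' _ _ (by finiteness),
            lintegral_const_mul' _ _ (by finiteness), lintegral_add_left m1,
            lintegral_finsetSum _ fun j _ => m3 j]
      _ ≤ _ := by
          gcongr with j
          · exact H₁ _ (s.w_CS hφ k)
          · refine H₂ k _ (s.dv_CS hφ) fun y hy => ?_
            simp [dv, w, z _ y hy]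
          · refine H₂ j _ (s.cm_CS hφ j k) fun y hy => ?_
            simp [cm, w, z _ y hy]
  · have c2 : (2 : ℝ≥0∞) ^ (p - 1) ≠ ∞ := by finiteness
    have c3 : (3 : ℝ≥0∞) ^ (p - 1) ≠ ∞ := by finiteness
    exact Pol.const_mul c2 (Pol.add (Pol.const_mul c2 (Pol.add
      (Pol.const_mul hC₁.ne (nmNp (nm_w hφ k hp hp3)))
      (Pol.const_mul (hC₂ k).ne (nmNp (nm_dv hφ hp hp3)))))
      (Pol.const_mul c3 (Pol.sum _ fun j _ => Pol.const_mul (hC₂ j).ne (nmNp (nm_cm hφ j k hp hp3)))))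

end Sl

end

section

variable {φ : E3 → ℝ} {p : ℝ}

namespace Sl

/-- Second derivatives of the velocity through the localized Biot–Savart law. -/
lemma pd_pd_v (s : Sl) (hφ : CS φ) (h1 : ∀ x : E3, ‖x‖ < 2 → φ x = 1) (k a b : Fin 3) {x : E3}
    (hx : ‖x‖ < 2) :
    pd (pd (s.v k) a) b x =
      pd (pd (s.rm φ k) a) b x - ∑ j, pd (pd (G (pd (s.vf φ j k) j)) a) b x := by
  have hv := fun j => (s.vf_CS hφ j k).dpd j
  have e1 : s.w φ k = fun y => s.rm φ k y - ∑ j, G (pd (s.vf φ j k) j) y := by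
    funext y
    have := s.sum_pd_G_vf hφ k y
    simp only [fun j => pd_G (s.vf_CS hφ j k) j] at this
    linarith
  have h2 : ∀ y : E3, ‖y‖ < 2 → s.v k =ᶠ[𝓝 y] s.w φ k := fun y hy => by
    filter_upwards [(isOpen_lt continuous_norm continuous_const).mem_nhds hy] with z hz
    simp [w, h1 z hz]
  have h3 : ∀ y : E3, ‖y‖ < 2 → pd (s.v k) a y = pd (s.w φ k) a y := fun y hy => by
    rw [pd, pd, (h2 y hy).fderiv_eq]
  have h4 : pd (s.v k) a =ᶠ[𝓝 x] pd (s.w φ k) a := by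
    filter_upwards [(isOpen_lt continuous_norm continuous_const).mem_nhds hx] with z hz
      using h3 z hz
  have e2 : pd (s.w φ k) a = fun y => pd (s.rm φ k) a y - ∑ j, pd (G (pd (s.vf φ j k) j)) a y := by
    rw [e1]
    funext y
    have d1 : DifferentiableAt ℝ (s.rm φ k) y := (s.rm_IB hφ k).smooth.differentiable (by simp) y
    have d2 : ∀ j ∈ Finset.univ, DifferentiableAt ℝ (G (pd (s.vf φ j k) j)) y := fun j _ =>
      (hv j).G_IB.smooth.differentiable (by simp) y
    have d2' : DifferentiableAt ℝ (fun y => ∑ j, G (pd (s.vf φ j k) j) y) y :=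
      DifferentiableAt.fun_sum d2
    rw [pd_sub d1 d2', pd_sum d2]
  have e3 : pd (pd (s.v k) a) b x = pd (pd (s.w φ k) a) b x := by
    rw [pd, pd, h4.fderiv_eq]
  rw [e3, e2]
  have d1 : DifferentiableAt ℝ (pd (s.rm φ k) a) x :=
    (contDiff_pd (s.rm_IB hφ k).smooth a).differentiable (by simp) x
  have d2 : ∀ j ∈ Finset.univ, DifferentiableAt ℝ (pd (G (pd (s.vf φ j k) j)) a) x := fun j _ =>
    (contDiff_pd (hv j).G_IB.smooth a).differentiable (by simp) x
  have d2' : DifferentiableAt ℝ (fun y => ∑ j, pd (G (pd (s.vf φ j k) j)) a y) x :=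
    DifferentiableAt.fun_sum d2
  rw [pd_sub d1 d2', pd_sum d2]

end Sl

/-- A smooth cutoff equal to one on the ball of radius two. -/
lemma exists_cut_two : ∃ φ : E3 → ℝ, CS φ ∧ ∀ x : E3, ‖x‖ < 2 → φ x = 1 := by
  let c : ContDiffBump (0 : E3) := ⟨2, 3, by norm_num, by norm_num⟩
  exact ⟨c, ⟨c.contDiff, c.hasCompactSupport⟩, fun x hx =>
    c.one_of_mem_closedBall (by simpa using hx.le)⟩

namespace Dat

lemma f_eq_vf (d : Dat) (φ : E3 → ℝ) (j k : Fin 3) {t : ℝ} (ht : t ∈ Icc (1 / 2 : ℝ) 1)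
    (ht' : t ∈ Icc (0 : ℝ) 1) : d.f φ j k t = (sl (d, ⟨t, ht'⟩)).vf φ j k := by
  funext x
  change ct t * (φ x * d.Om j k t x) = φ x * d.Om j k t x
  rw [ct_one ht, one_mul]

/-- Interior second derivative bound on the unit cylinder. -/
lemma pd_pd_v_bound (hp : 1 ≤ p) (hp2 : p < 4 / 3) (k a b : Fin 3) :
    Pol (fun d : Dat => ∫⁻ t in Icc (1 / 2 : ℝ) 1, ∫⁻ x in ball (0 : E3) 1,
      ‖pd (pd (d.v k t) a) b x‖ₑ ^ p) fun _ => 1 := by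
  classical
  obtain ⟨φ, hφ, h1⟩ := exists_cut_two
  have hp0 : 0 < p := by linarith
  let Z : Sl → ℝ≥0∞ := fun s => ∫⁻ x in ball (0:E3) 1, ‖pd (pd (s.rm φ k) a) b x‖ₑ ^ p
  have hZ : Pol Z fun _ => 1 := Sl.pd_pd_rm hφ h1 hp (by linarith) k a b
  let X : Dat → ℝ → ℝ≥0∞ := fun d t => if ht : t ∈ Icc (0:ℝ) 1 then Z (sl (d, ⟨t, ht⟩)) else 0
  have hX : Pol (fun d : Dat => ∫⁻ t in Icc (0:ℝ) 1, X d t) fun _ => 1 :=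
    lintegral_static hφ (hZ.mono_right fun s => le_self_add) fun d t ht =>
      (dif_pos ht).le
  let K : Dat → Fin 3 → ℝ → E3 → ℝ≥0∞ := fun d j =>
    TK (pd (pd gk a) b) 0 1 fun t => pd (d.f φ j k t) j
  have hKm : ∀ d j, Measurable (Function.uncurry (K d j)) := fun d j =>
    TK_measurable ((gk_GP.dpd a).dpd b) ((lz_TF ct_TC hφ (d.Om_JS j k)).dpd j).1
  have hK : ∀ j, Pol (fun d : Dat => NP p (K d j)) fun _ => 1 := fun j =>
    Bd_TK_pd_f hp hp2 hφ j k j a b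
  have c2 : (2 : ℝ≥0∞) ^ (p - 1) ≠ ∞ := by finiteness
  have c3 : (3 : ℝ≥0∞) ^ (p - 1) ≠ ∞ := by finiteness
  refine Pol.mono_left (fun d => ?_) (Pol.const_mul c2 (hX.add (Pol.const_mul c3
    (Pol.sum Finset.univ fun j _ => hK j))))
  have key : ∀ t ∈ Icc (1 / 2 : ℝ) 1, ∫⁻ x in ball (0 : E3) 1, ‖pd (pd (d.v k t) a) b x‖ₑ ^ p ≤
      2 ^ (p - 1) * (X d t + 3 ^ (p - 1) * ∑ j, ∫⁻ x, K d j t x ^ p) := fun t ht => by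
    have ht' : t ∈ Icc (0 : ℝ) 1 := ⟨by linarith [ht.1], ht.2⟩
    have hm : ∀ j, Measurable fun x => K d j t x ^ p := fun j =>
      ((hKm d j).comp (measurable_const.prodMk measurable_id)).pow_const p
    have hs : Measurable fun x => (3 : ℝ≥0∞) ^ (p - 1) * ∑ j, K d j t x ^ p :=
      (Finset.measurable_fun_sum _ fun j _ => hm j).const_mul _
    have hXe : X d t = ∫⁻ x in ball (0:E3) 1,
        ‖pd (pd ((sl (d, ⟨t, ht'⟩)).rm φ k) a) b x‖ₑ ^ p := dif_pos ht'
    calc _ ≤ ∫⁻ x in ball (0 : E3) 1, 2 ^ (p - 1) *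
          (‖pd (pd ((sl (d, ⟨t, ht'⟩)).rm φ k) a) b x‖ₑ ^ p +
            3 ^ (p - 1) * ∑ j, K d j t x ^ p) := by
          refine setLIntegral_mono_ae' measurableSet_ball (ae_of_all _ fun x hx => ?_)
          have hx' : ‖x‖ < 2 := by
            have : ‖x‖ < 1 := by simpa using hx
            linarith
          have e : pd (pd (d.v k t) a) b x = _ := (sl (d, ⟨t, ht'⟩)).pd_pd_v hφ h1 k a b hx'
          rw [e]
          refine (ENNReal.rpow_le_rpow enorm_sub_le hp0.le).trans
            ((ENNReal.rpow_add_le_mul_rpow_add_rpow _ _ hp).trans (mul_le_mul_right (add_le_add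
              le_rfl ?_) _))
          refine (ENNReal.rpow_le_rpow (enorm_sum_le Finset.univ
            fun j => pd (pd (G (pd ((sl (d, ⟨t, ht'⟩)).vf φ j k) j)) a) b x) hp0.le).trans ?_
          refine (ENNReal.rpow_sum_le_const_mul_sum_rpow Finset.univ _ hp).trans ?_
          simp only [Finset.card_univ, Fintype.card_fin, Nat.cast_ofNat]
          refine mul_le_mul_right (Finset.sum_le_sum fun j _ => ENNReal.rpow_le_rpow ?_ hp0.le) _
          refine (enorm_pd_pd_G_le (((sl (d, ⟨t, ht'⟩)).vf_CS hφ j k).dpd j) a b x).trans_eq ?_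
          simp only [K, TK, KS, zero_mul, sub_zero, d.f_eq_vf φ j k ht ht']
      _ = 2 ^ (p - 1) * (X d t + 3 ^ (p - 1) * ∑ j, ∫⁻ x in ball (0:E3) 1, K d j t x ^ p) := by
          rw [lintegral_const_mul' _ _ c2, lintegral_add_right _ hs, lintegral_const_mul' _ _ c3,
            lintegral_finsetSum _ fun j _ => hm j, hXe]
      _ ≤ _ := by
          gcongr
          exact Measure.restrict_le_self
  have hm : ∀ j, Measurable fun t => ∫⁻ x, K d j t x ^ p := fun j =>
    ((hKm d j).pow_const p).lintegral_prod_right'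
  have hs : Measurable fun t => (3 : ℝ≥0∞) ^ (p - 1) * ∑ j, ∫⁻ x, K d j t x ^ p :=
    (Finset.measurable_fun_sum _ fun j _ => hm j).const_mul _
  calc _ ≤ ∫⁻ t in Icc (1 / 2 : ℝ) 1, 2 ^ (p - 1) *
        (X d t + 3 ^ (p - 1) * ∑ j, ∫⁻ x, K d j t x ^ p) :=
        setLIntegral_mono_ae' measurableSet_Icc (ae_of_all _ key)
    _ ≤ ∫⁻ t in Icc (0 : ℝ) 1, 2 ^ (p - 1) *
        (X d t + 3 ^ (p - 1) * ∑ j, ∫⁻ x, K d j t x ^ p) :=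
        lintegral_mono_set (Icc_subset_Icc (by norm_num) le_rfl)
    _ = _ := by
        rw [lintegral_const_mul' _ _ c2, lintegral_add_right _ hs, lintegral_const_mul' _ _ c3,
          lintegral_finsetSum _ fun j _ => hm j]
        simp only [NP_eq (hKm d _)]

end Dat

section
variable {F : Type*} [NormedAddCommGroup F] [NormedSpace ℝ F]

lemma norm_le_sum_single (L : E3 →L[ℝ] F) : ‖L‖ ≤ ∑ a, ‖L (EuclideanSpace.single a 1)‖ := by
  refine L.opNorm_le_bound (Finset.sum_nonneg fun a _ => norm_nonneg _) fun v => ?_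
  have hv : v = ∑ i : Fin 3, v i • EuclideanSpace.single i (1:ℝ) := by
    ext j; fin_cases j <;> simp [Fin.sum_univ_three]
  conv_lhs => rw [hv]
  rw [map_sum, Finset.sum_mul]
  refine (norm_sum_le _ _).trans (Finset.sum_le_sum fun i _ => ?_)
  rw [map_smul, norm_smul, mul_comm]
  gcongr
  exact PiLp.norm_apply_le v i

end

lemma norm_le_sum_coord (y : E3) : ‖y‖ ≤ ∑ k, |y k| := by
  have hv : y = ∑ i : Fin 3, y i • EuclideanSpace.single i (1:ℝ) := by
    ext j; fin_cases j <;> simp [Fin.sum_univ_three]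
  conv_lhs => rw [hv]
  refine (norm_sum_le _ _).trans (Finset.sum_le_sum fun i _ => ?_)
  rw [norm_smul]
  simp

/-- The second derivative is controlled by second partial derivatives of the components. -/
lemma norm_iteratedFDeriv_two_le {f : E3 → E3} (hf : ContDiff ℝ (⊤ : ℕ∞) f) (x : E3) :
    ‖iteratedFDeriv ℝ 2 f x‖ ≤ ∑ b, ∑ a, ∑ k, |pd (pd (fun y => f y k) a) b x| := by
  have h2 : ContDiff ℝ (⊤ : ℕ∞) (fderiv ℝ f) := hf.fderiv_right (by simp)
  have e : ‖iteratedFDeriv ℝ 2 f x‖ = ‖fderiv ℝ (fderiv ℝ f) x‖ := by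
    rw [← norm_iteratedFDeriv_one, norm_iteratedFDeriv_fderiv]
  have e1 : ∀ k a, pd (fun y => f y k) a = fun y => fderiv ℝ f y (EuclideanSpace.single a 1) k := by
    intro k a
    funext y
    have : HasFDerivAt (fun y => f y k) ((EuclideanSpace.proj k : E3 →L[ℝ] ℝ).comp (fderiv ℝ f y)) y :=
      (EuclideanSpace.proj k : E3 →L[ℝ] ℝ).hasFDerivAt.comp y
        (hf.differentiable (by simp) y).hasFDerivAt
    rw [pd, this.fderiv]; rfl
  have e2 : ∀ k a b, pd (pd (fun y => f y k) a) b x =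
      fderiv ℝ (fderiv ℝ f) x (EuclideanSpace.single b 1) (EuclideanSpace.single a 1) k := by
    intro k a b
    rw [e1]
    have h3 := (h2.differentiable (by simp) x).hasFDerivAt
    have h4 : HasFDerivAt (fun y => fderiv ℝ f y (EuclideanSpace.single a 1))
        ((fderiv ℝ (fderiv ℝ f) x).flip (EuclideanSpace.single a 1)) x :=
      (h3.clm_apply (hasFDerivAt_const (EuclideanSpace.single a (1:ℝ)) x)).congr_fderiv (by
        ext v; simp)
    have h5 : HasFDerivAt (fun y => fderiv ℝ f y (EuclideanSpace.single a 1) k)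
        ((EuclideanSpace.proj k : E3 →L[ℝ] ℝ).comp
          ((fderiv ℝ (fderiv ℝ f) x).flip (EuclideanSpace.single a 1))) x :=
      (EuclideanSpace.proj k : E3 →L[ℝ] ℝ).hasFDerivAt.comp x h4
    rw [pd, h5.fderiv]; rfl
  rw [e]
  refine (norm_le_sum_single _).trans (Finset.sum_le_sum fun b _ => ?_)
  refine (norm_le_sum_single _).trans (Finset.sum_le_sum fun a _ => ?_)
  refine (norm_le_sum_coord _).trans (Finset.sum_le_sum fun k _ => ?_)
  rw [e2]

end

section
variable {E : Type*} [NormedAddCommGroup E] [NormedSpace ℝ E] [FiniteDimensional ℝ E]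
  [MeasurableSpace E] [BorelSpace E] (μ : Measure E) [μ.IsAddHaarMeasure]

lemma lintegral_comp_affine {r : ℝ} (hr : 0 < r) (y : E) (h : E → ℝ≥0∞) :
    ∫⁻ x, h (y + r • x) ∂μ = ENNReal.ofReal (r ^ Module.finrank ℝ E)⁻¹ * ∫⁻ x, h x ∂μ := by
  have h1 := Measure.map_addHaar_smul μ hr.ne'
  have h2 : ∫⁻ x, h (y + r • x) ∂μ = ∫⁻ z, h (y + z) ∂(Measure.map (r • ·) μ) :=
    (lintegral_map_equiv (fun z => h (y + z))
      (Homeomorph.smul (isUnit_iff_ne_zero.2 hr.ne').unit).toMeasurableEquiv).symm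
  rw [h2, h1, lintegral_smul_measure, abs_of_pos (by positivity), smul_eq_mul,
    lintegral_add_left_eq_self]

lemma setLIntegral_affine {r : ℝ} (hr : 0 < r) (y : E) (h : E → ℝ≥0∞) {s t : Set E}
    (hs : MeasurableSet s) (ht : MeasurableSet t) (hst : ∀ x, y + r • x ∈ s ↔ x ∈ t) :
    ∫⁻ x in s, h x ∂μ =
      ENNReal.ofReal (r ^ Module.finrank ℝ E) * ∫⁻ x in t, h (y + r • x) ∂μ := by
  rw [← lintegral_indicator hs, ← lintegral_indicator ht]
  have e : t.indicator (fun x => h (y + r • x)) = fun x => s.indicator h (y + r • x) := by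
    funext x
    by_cases hx : x ∈ t
    · rw [indicator_of_mem hx, indicator_of_mem ((hst x).2 hx)]
    · rw [indicator_of_notMem hx, indicator_of_notMem fun h' => hx ((hst x).1 h')]
  rw [e, lintegral_comp_affine μ hr, ← mul_assoc, ← ENNReal.ofReal_mul (by positivity),
    mul_inv_cancel₀ (by positivity), ENNReal.ofReal_one, one_mul]

end

lemma setLIntegral_ball {r : ℝ} (hr : 0 < r) (y : E3) (h : E3 → ℝ≥0∞) :
    ∫⁻ x in ball y r, h x = ENNReal.ofReal (r ^ 3) * ∫⁻ x in ball (0:E3) 1, h (y + r • x) := by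
  have := setLIntegral_affine volume hr y h (s := ball y r) (t := ball 0 1) measurableSet_ball
    measurableSet_ball fun x => by
      rw [mem_ball_iff_norm, mem_ball_zero_iff, add_sub_cancel_left, norm_smul,
        Real.norm_of_nonneg hr.le]
      exact mul_lt_iff_lt_one_right hr
  simpa using this

lemma setLIntegral_Icc {T : ℝ} (hT : 0 < T) (h : ℝ → ℝ≥0∞) :
    ∫⁻ t in Icc (T / 2) T, h t = ENNReal.ofReal T * ∫⁻ t in Icc (1 / 2 : ℝ) 1, h (T * t) := by
  have := setLIntegral_affine volume hT 0 h (s := Icc (T / 2) T) (t := Icc (1 / 2) 1)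
    measurableSet_Icc measurableSet_Icc fun x => by
      simp only [zero_add, smul_eq_mul, mem_Icc]
      constructor
      · rintro ⟨h1, h2⟩; constructor <;> nlinarith
      · rintro ⟨h1, h2⟩; constructor <;> nlinarith
  simpa using this

lemma pd_affine {f : E3 → ℝ} (hf : ContDiff ℝ (⊤ : ℕ∞) f) (c r : ℝ) (y : E3) (i : Fin 3) :
    pd (fun x => c * f (y + r • x)) i = fun x => c * r * pd f i (y + r • x) := by
  funext x
  have h1 : HasFDerivAt (fun x : E3 => y + r • x) (r • ContinuousLinearMap.id ℝ E3) x :=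
    ((hasFDerivAt_id x).const_smul r).const_add y
  have h2 : HasFDerivAt f (fderiv ℝ f (y + r • x)) (y + r • x) :=
    (hf.differentiable (by simp) _).hasFDerivAt
  have h3 : HasFDerivAt (fun x => c * f (y + r • x))
      (c • (fderiv ℝ f (y + r • x)).comp (r • ContinuousLinearMap.id ℝ E3)) x :=
    (h2.comp x h1).const_mul c
  rw [pd, h3.fderiv]
  simp [pd, mul_assoc]

lemma wnorm3_affine (f : E3 → E3) {r : ℝ} (hr : 0 < r) (y : E3) :
    wnorm3 (fun x => r • f (y + r • x)) ≤ wnorm3 f := by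
  refine iSup₂_le fun l hl => ?_
  have h1 : volume {x : E3 | l ≤ ‖r • f (y + r • x)‖} =
      ENNReal.ofReal (r ^ 3)⁻¹ * volume {x : E3 | l / r ≤ ‖f x‖} := by
    have e : {x : E3 | l ≤ ‖r • f (y + r • x)‖} = (r • ·) ⁻¹' ((y + ·) ⁻¹' {x | l / r ≤ ‖f x‖}) := by
      ext x
      simp only [mem_preimage, mem_ofPred_eq, norm_smul, Real.norm_of_nonneg hr.le]
      rw [div_le_iff₀' hr]
    rw [e, Measure.addHaar_preimage_smul _ hr.ne', measure_preimage_add, abs_of_pos (by positivity)]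
    simp
  have h2 : ENNReal.ofReal l * (ENNReal.ofReal (r ^ 3)⁻¹) ^ (1 / (3:ℝ)) = ENNReal.ofReal (l / r) := by
    rw [ENNReal.ofReal_rpow_of_nonneg (by positivity) (by norm_num),
      ← ENNReal.ofReal_mul hl.le, Real.inv_rpow (by positivity), ← Real.rpow_natCast,
      ← Real.rpow_mul hr.le]
    norm_num [div_eq_mul_inv]
  rw [h1, ENNReal.mul_rpow_of_nonneg _ _ (by norm_num), ← mul_assoc, h2]
  exact le_iSup₂ (f := fun (l : ℝ) (_ : 0 < l) =>
      ENNReal.ofReal l * (volume {x : E3 | l ≤ ‖f x‖}) ^ (1 / (3:ℝ))) (l / r) (by positivity)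

/-- Parabolic rescaling of a solution to the unit time interval. -/
lemma IsNSSol.rescale {u : ℝ → E3 → E3} {pr : ℝ → E3 → ℝ} {r : ℝ}
    (h : IsNSSol u pr (Icc 0 (r ^ 2))) (hr : 0 < r) (y : E3) :
    IsNSSol (fun t x => r • u (r ^ 2 * t) (y + r • x))
      (fun t x => r ^ 2 * pr (r ^ 2 * t) (y + r • x)) (Icc 0 1) := by
  obtain ⟨hu, hp, heq, hdiv⟩ := h
  have hmap : ContDiff ℝ (⊤ : ℕ∞) fun q : ℝ × E3 => (r ^ 2 * q.1, y + r • q.2) := by fun_prop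
  have hmem : ∀ t ∈ Icc (0:ℝ) 1, r ^ 2 * t ∈ Icc 0 (r ^ 2) := fun t ht =>
    ⟨mul_nonneg (by positivity) ht.1, by nlinarith [ht.2, sq_nonneg r]⟩
  have huk : ∀ k, ContDiff ℝ (⊤ : ℕ∞) fun q : ℝ × E3 => u q.1 q.2 k := fun k =>
    (EuclideanSpace.proj k : E3 →L[ℝ] ℝ).contDiff.comp hu
  have hus : ∀ k t, ContDiff ℝ (⊤ : ℕ∞) fun x => u t x k := fun k t =>
    (huk k).comp (contDiff_const.prodMk contDiff_id)
  have hps : ∀ t, ContDiff ℝ (⊤ : ℕ∞) (pr t) := fun t =>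
    hp.comp (contDiff_const.prodMk contDiff_id)
  have e1 : ∀ t k i, pd (fun x => (r • u t (y + r • x)) k) i =
      fun x => r * r * pd (fun z => u t z k) i (y + r • x) := fun t k i =>
    pd_affine (hus k t) r r y i
  refine ⟨(hu.comp hmap).const_smul r, contDiff_const.mul (hp.comp hmap),
    fun t ht x i => ?_, fun t ht x => ?_⟩
  · have e2 : pd (fun x => r ^ 2 * pr (r ^ 2 * t) (y + r • x)) i x =
        r ^ 2 * r * pd (pr (r ^ 2 * t)) i (y + r • x) := by rw [pd_affine (hps _)]
    have e3 : lap (fun x => (r • u (r ^ 2 * t) (y + r • x)) i) x =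
        r ^ 3 * lap (fun z => u (r ^ 2 * t) z i) (y + r • x) := by
      unfold lap
      rw [Finset.mul_sum]
      refine Finset.sum_congr rfl fun l _ => ?_
      change pd (pd _ l) l x = _
      rw [e1, pd_affine (contDiff_pd (hus i _) l)]
      change _ = r ^ 3 * pd (pd _ l) l _
      ring
    have e4 : deriv (fun s => (r • u (r ^ 2 * s) (y + r • x)) i) t =
        r ^ 3 * deriv (fun s => u s (y + r • x) i) (r ^ 2 * t) := by
      have e5 : (fun s => (r • u (r ^ 2 * s) (y + r • x)) i) =
          fun s => r * u (r ^ 2 * s) (y + r • x) i := rfl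
      have e6 : deriv (fun s => u (r ^ 2 * s) (y + r • x) i) t =
          r ^ 2 * deriv (fun s => u s (y + r • x) i) (r ^ 2 * t) :=
        deriv_comp_mul_left (r ^ 2) (fun s => u s (y + r • x) i) t
      rw [e5, deriv_const_mul_field, e6]
      ring
    rw [e2, e3, e4]
    simp only [e1]
    have e5 : ∀ j, (r • u (r ^ 2 * t) (y + r • x)) j *
        (r * r * pd (fun z => u (r ^ 2 * t) z i) j (y + r • x)) =
        r ^ 3 * (u (r ^ 2 * t) (y + r • x) j * pd (fun z => u (r ^ 2 * t) z i) j (y + r • x)) :=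
      fun j => by
        rw [PiLp.smul_apply, smul_eq_mul]; ring
    simp only [e5, ← Finset.mul_sum]
    linear_combination r ^ 3 * heq _ (hmem t ht) (y + r • x) i
  · simp only [e1, ← Finset.mul_sum]
    rw [hdiv _ (hmem t ht), mul_zero]

/-- Scale-invariant bound for second partial derivatives of a solution. -/
lemma pd_pd_bound {p : ℝ} (hp : 1 ≤ p) (hp2 : p < 4 / 3) (k a b : Fin 3) :
    ∃ n : ℕ, ∀ A r : ℝ, 2 ≤ A → 0 < r → ∀ (u : ℝ → E3 → E3) (pr : ℝ → E3 → ℝ),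
      IsNSSol u pr (Icc 0 (r ^ 2)) → (∀ t ∈ Icc (0:ℝ) (r ^ 2), wnorm3 (u t) ≤ ENNReal.ofReal A) →
      ∀ y : E3, ∫⁻ t in Icc (r ^ 2 / 2) (r ^ 2), ∫⁻ x in ball y r,
        ‖pd (pd (fun x => u t x k) a) b x‖ₑ ^ p ≤
          ENNReal.ofReal A ^ n * ENNReal.ofReal (r ^ (5 - 3 * p)) := by
  obtain ⟨n, hn⟩ := Dat.pd_pd_v_bound hp hp2 k a b
  refine ⟨n, fun A r hA hr u pr hsol hw y => ?_⟩
  have hmem : ∀ t ∈ Icc (0:ℝ) 1, r ^ 2 * t ∈ Icc 0 (r ^ 2) := fun t ht =>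
    ⟨mul_nonneg (by positivity) ht.1, by nlinarith [ht.2, sq_nonneg r]⟩
  let d : Dat := ⟨A, hA, _, _, hsol.rescale hr y, fun t ht =>
    (wnorm3_affine _ hr y).trans (hw _ (hmem t ht))⟩
  have hus : ∀ t, ContDiff ℝ (⊤ : ℕ∞) fun x => u t x k := fun t =>
    ((EuclideanSpace.proj k : E3 →L[ℝ] ℝ).contDiff.comp hsol.1).comp
      (contDiff_const.prodMk contDiff_id)
  have e : ∀ t x, ‖pd (pd (fun x => u (r ^ 2 * t) x k) a) b (y + r • x)‖ₑ ^ p =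
      ENNReal.ofReal (r ^ (-(3 * p))) * ‖pd (pd (d.v k t) a) b x‖ₑ ^ p := fun t x => by
    have h1 : d.v k t = fun x => r * u (r ^ 2 * t) (y + r • x) k := rfl
    rw [h1, pd_affine (hus _), pd_affine (contDiff_pd (hus _) a), enorm_mul,
      Real.enorm_of_nonneg (show 0 ≤ r * r * r by positivity),
      ENNReal.mul_rpow_of_nonneg _ _ (by linarith),
      ← mul_assoc, ENNReal.ofReal_rpow_of_nonneg (by positivity) (by linarith),
      ← ENNReal.ofReal_mul (by positivity)]
    have : r ^ (-(3 * p)) * (r * r * r) ^ p = 1 := by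
      have h3 : r * r * r = r ^ (3:ℝ) := by rw [← pow_three', ← Real.rpow_natCast]; norm_num
      rw [h3, ← Real.rpow_mul hr.le, ← Real.rpow_add hr]; simp
    rw [this, ENNReal.ofReal_one, one_mul]
  have h2 := hn d
  rw [mul_one] at h2
  rw [setLIntegral_Icc (by positivity)]
  simp only [setLIntegral_ball hr, e]
  rw [lintegral_const_mul' _ _ ENNReal.ofReal_ne_top]
  simp only [lintegral_const_mul' _ _ ENNReal.ofReal_ne_top]
  rw [← mul_assoc, ← mul_assoc, ← ENNReal.ofReal_mul (by positivity),
    ← ENNReal.ofReal_mul (by positivity), mul_comm]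
  have e2 : r ^ 2 * r ^ 3 * r ^ (-(3 * p)) = r ^ (5 - 3 * p) := by
    rw [← pow_add, ← Real.rpow_natCast, ← Real.rpow_add hr]
    congr 1
  rw [e2]
  exact mul_le_mul_left h2 _

/-- Second order derivative estimates, uniformly locally at scale `T^{1/2}`. -/
theorem stmt9 (p : ℝ) (hp1 : 1 ≤ p) (hp2 : p < 4 / 3) :
    ∃ Cp C : ℝ, 0 < Cp ∧ 0 < C ∧
      ∀ (A T : ℝ), 2 ≤ A → 0 < T →
        ∀ (u : ℝ → E3 → E3) (π' : ℝ → E3 → ℝ),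
          IsNSSol u π' (Set.Icc 0 T) →
          (∀ t ∈ Set.Icc (0:ℝ) T, wnorm3 (u t) ≤ ENNReal.ofReal A) →
          ∀ x₀ : E3,
            (∫⁻ t in Set.Icc (T / 2) T, ∫⁻ x in Metric.ball x₀ (T ^ ((1:ℝ)/2)),
                (‖iteratedFDeriv ℝ 2 (u t) x‖₊ : ℝ≥0∞) ^ p) ^ (1 / p) ≤
              ENNReal.ofReal (Cp * A ^ C * T ^ (5 / (2 * p) - 3 / 2)) := by
  have hp0 : 0 < p := by linarith
  choose n hn using fun k a b : Fin 3 => pd_pd_bound hp1 hp2 k a b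
  obtain ⟨N, hN0, hN⟩ : ∃ N : ℕ, 0 < N ∧ ∀ q : Fin 3 × Fin 3 × Fin 3, n q.2.2 q.2.1 q.1 ≤ N :=
    ⟨1 + ∑ q : Fin 3 × Fin 3 × Fin 3, n q.2.2 q.2.1 q.1, by omega, fun q =>
      (Finset.single_le_sum (f := fun q : Fin 3 × Fin 3 × Fin 3 => n q.2.2 q.2.1 q.1)
        (fun _ _ => Nat.zero_le _) (Finset.mem_univ q)).trans (Nat.le_add_left _ _)⟩
  refine ⟨27, N / p, by norm_num, div_pos (Nat.cast_pos.2 hN0) hp0,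
    fun A T hA hT u π' hsol hw x₀ => ?_⟩
  obtain ⟨r, hr, rfl⟩ : ∃ r : ℝ, 0 < r ∧ r ^ 2 = T := ⟨√T, Real.sqrt_pos.2 hT, Real.sq_sqrt hT.le⟩
  have hA0 : 0 < A := by linarith
  have er : (r ^ 2) ^ ((1:ℝ) / 2) = r := by rw [← Real.sqrt_eq_rpow, Real.sqrt_sq hr.le]
  have hus : ∀ t, ContDiff ℝ (⊤ : ℕ∞) (u t) := fun t =>
    hsol.1.comp (contDiff_const.prodMk contDiff_id)
  have huk : ∀ k, JS fun t x => u t x k := fun k =>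
    (EuclideanSpace.proj k : E3 →L[ℝ] ℝ).contDiff.comp hsol.1
  obtain ⟨D, hDe⟩ : ∃ D : Fin 3 × Fin 3 × Fin 3 → ℝ → E3 → ℝ,
      ∀ q t, D q t = pd (pd (fun y => u t y q.2.2) q.2.1) q.1 := ⟨_, fun _ _ => rfl⟩
  have hD : ∀ q, Measurable (Function.uncurry fun t x => ‖D q t x‖ₑ ^ p) := fun q => by
    simp only [hDe]
    exact (((huk q.2.2).dpd q.2.1).dpd q.1).measurable.enorm.pow_const p
  have c : (27 : ℝ≥0∞) ^ (p - 1) ≠ ∞ := by finiteness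
  have pt : ∀ t x, (‖iteratedFDeriv ℝ 2 (u t) x‖₊ : ℝ≥0∞) ^ p ≤
      27 ^ (p - 1) * ∑ q, ‖D q t x‖ₑ ^ p := fun t x => by
    have h1 : (‖iteratedFDeriv ℝ 2 (u t) x‖₊ : ℝ≥0∞) ≤ ∑ q, ‖D q t x‖ₑ := by
      have h := norm_iteratedFDeriv_two_le (hus t) x
      have h' : ‖iteratedFDeriv ℝ 2 (u t) x‖ ≤ ∑ q, |D q t x| := by
        simpa only [Fintype.sum_prod_type, hDe] using h
      rw [← enorm_eq_nnnorm, ← ofReal_norm]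
      refine (ENNReal.ofReal_le_ofReal h').trans_eq ?_
      rw [ENNReal.ofReal_sum_of_nonneg fun _ _ => abs_nonneg _]
      simp only [Real.enorm_eq_ofReal_abs]
    refine (ENNReal.rpow_le_rpow h1 hp0.le).trans
      ((ENNReal.rpow_sum_le_const_mul_sum_rpow Finset.univ _ hp1).trans_eq ?_)
    simp
  have hAN : (1 : ℝ≥0∞) ≤ ENNReal.ofReal A := by
    rw [ENNReal.one_le_ofReal]; linarith
  have main : ∫⁻ t in Icc (r ^ 2 / 2) (r ^ 2), ∫⁻ x in ball x₀ r,
      (‖iteratedFDeriv ℝ 2 (u t) x‖₊ : ℝ≥0∞) ^ p ≤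
        27 ^ p * (ENNReal.ofReal A ^ N * ENNReal.ofReal (r ^ (5 - 3 * p))) := by
    have hm : ∀ q t, Measurable fun x => ‖D q t x‖ₑ ^ p := fun q t =>
      (hD q).of_uncurry_left
    have hm' : ∀ q, Measurable fun t => ∫⁻ x in ball x₀ r, ‖D q t x‖ₑ ^ p := fun q =>
      (hD q).lintegral_prod_right'
    calc _ ≤ ∫⁻ t in Icc (r ^ 2 / 2) (r ^ 2), ∫⁻ x in ball x₀ r,
          27 ^ (p - 1) * ∑ q, ‖D q t x‖ₑ ^ p :=
          lintegral_mono fun t => lintegral_mono fun x => pt t x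
      _ = 27 ^ (p - 1) * ∑ q, ∫⁻ t in Icc (r ^ 2 / 2) (r ^ 2), ∫⁻ x in ball x₀ r,
          ‖D q t x‖ₑ ^ p := by
          simp only [lintegral_const_mul' _ _ c, fun t =>
            lintegral_finsetSum (μ := volume.restrict (ball x₀ r)) Finset.univ fun q _ => hm q t]
          rw [lintegral_finsetSum _ fun q _ => hm' q]
      _ ≤ 27 ^ (p - 1) * ∑ q : Fin 3 × Fin 3 × Fin 3,
          ENNReal.ofReal A ^ N * ENNReal.ofReal (r ^ (5 - 3 * p)) := by
          gcongr with q
          simp only [hDe]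
          exact (hn q.2.2 q.2.1 q.1 A r hA hr u π' hsol hw x₀).trans
            (mul_le_mul_left (pow_le_pow_right₀ hAN (hN q)) _)
      _ = _ := by
          rw [Finset.sum_const, nsmul_eq_mul, ← mul_assoc]
          congr 1
          have : (27 : ℝ≥0∞) ^ p = 27 ^ (p - 1) * 27 ^ (1:ℝ) := by
            rw [← ENNReal.rpow_add _ _ (by norm_num) (by norm_num)]; congr 1; ring
          rw [this, ENNReal.rpow_one]
          simp
  rw [er]
  refine (ENNReal.rpow_le_rpow main (by positivity)).trans_eq ?_
  have e27 : (27 : ℝ≥0∞) = ENNReal.ofReal 27 := by simp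
  rw [e27, ENNReal.ofReal_rpow_of_nonneg (by norm_num) hp0.le, ← ENNReal.ofReal_pow hA0.le,
    ← ENNReal.ofReal_mul (by positivity), ← ENNReal.ofReal_mul (by positivity),
    ENNReal.ofReal_rpow_of_nonneg (by positivity) (by positivity)]
  congr 1
  rw [Real.mul_rpow (by positivity) (by positivity), Real.mul_rpow (by positivity) (by positivity),
    ← Real.rpow_mul (by norm_num), ← Real.rpow_natCast A, ← Real.rpow_mul hA0.le,
    ← Real.rpow_mul hr.le, ← Real.rpow_natCast r, ← Real.rpow_mul hr.le, mul_one_div_cancel hp0.ne',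
    Real.rpow_one, mul_one_div, mul_assoc]
  congr 3
  push_cast
  field_simp
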